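/- Soundness and full completeness of the call-by-value translation into EEC: (1) if Θ ⊢ M =_{λc} N : τ then Θᵛ ⊢ Mᵛ = Nᵛ : !(τᵛ) in the equational theory of EEC; (2) if Θ ⊢ M, N : τ are simply-typed terms and Θᵛ ⊢ Mᵛ = Nᵛ : !(τᵛ) in EEC, then Θ ⊢ M =_{λc} N : τ; (3) if Θᵛ ⊢ t : !(τᵛ) is derivable in EEC, then there exists a simply-typed term Θ ⊢ M : τ such that Θᵛ ⊢ Mᵛ = t : !(τᵛ) in EEC. -/

import Mathlib

set_option autoImplicit false

namespace EEC

/-! # The enriched effect calculus (EEC)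

A deep embedding of the enriched effect calculus of Egger, Møgelberg and
Simpson: value types and computation types, raw terms (de Bruijn indices for
value variables, together with a designated stoup variable `svar`), typing
derivations with an (at most singleton) stoup, the βη-equational theory, the
simply-typed λ-calculus together with βη-equality and Moggi's computational
λ-calculus equality, the standard cbv/cbn translations of typed λ-calculus
into EEC, Hasegawa's linear-use CPS translations, and the generic linear-use
CPS self-translation of EEC. -/

mutual
  /-- Value types of EEC. -/
  inductive VType : Type
    | base : ℕ → VType                 -- value type constants α
    | unit : VType                     -- 1
    | prod : VType → VType → VType     -- A × B
    | arr : VType → VType → VType      -- A → B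
    | comp : CType → VType             -- every computation type is a value type
    | lin : CType → CType → VType      -- A̲ ⊸ B̲
  /-- Computation types of EEC. -/
  inductive CType : Type
    | base : ℕ → CType                 -- computation type constants α̲
    | cunit : CType                    -- 1̲
    | cand : CType → CType → CType     -- A̲ & B̲
    | carr : VType → CType → CType     -- A ⇒ B̲
    | iunit : CType                    -- I̲
    | bang : VType → CType             -- !A
    | copow : VType → CType → CType    -- !A ⊗ B̲
    | czero : CType                    -- 0̲
    | csum : CType → CType → CType     -- A̲ ⊕ B̲
end

/-- Raw terms of EEC.  Value variables are de Bruijn indices (`var n`, with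
`var 0` the innermost bound variable); the unique stoup variable is `svar`
(the constructs `llam`, `copowlet` (in its body) and `ccase` (in its
branches) bind the stoup variable). -/
inductive Tm : Type
  | var : ℕ → Tm                -- value variable
  | svar : Tm                   -- the stoup variable
  | unit : Tm                   -- * : 1
  | vpair : Tm → Tm → Tm        -- ⟨t,u⟩
  | vfst : Tm → Tm
  | vsnd : Tm → Tm
  | vlam : VType → Tm → Tm      -- λx:A. t
  | vapp : Tm → Tm → Tm
  | cunit : Tm                  -- ⋆ : 1̲
  | cpair : Tm → Tm → Tm        -- ⟨t,u⟩ : A̲ & B̲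
  | cfst : Tm → Tm
  | csnd : Tm → Tm
  | clam : VType → Tm → Tm      -- λx:A ⇒ t
  | capp : Tm → Tm → Tm         -- s ⋅ t
  | top : Tm                    -- ⊤ : I̲
  | ilet : Tm → Tm → Tm         -- t to ⊤. u
  | bang : Tm → Tm              -- !t
  | banglet : Tm → Tm → Tm      -- let !x = t in u   (binds a value variable in u)
  | copow : Tm → Tm → Tm        -- !t ⊗ u
  | copowlet : Tm → Tm → Tm     -- let !x⊗y = s in t (binds a value variable and the stoup variable in t)
  | cimage : CType → Tm → Tm    -- image_{A̲}(t)
  | cinl : Tm → Tm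
  | cinr : Tm → Tm
  | ccase : Tm → Tm → Tm → Tm   -- case s of (x. t | y. u)  (branches bind the stoup variable)
  | llam : CType → Tm → Tm      -- λ°z:A̲. t (binds the stoup variable)
  | lapp : Tm → Tm → Tm         -- s[t]

namespace Tm

/-- Lift a renaming of value variables under a binder. -/
def liftN (f : ℕ → ℕ) : ℕ → ℕ
  | 0 => 0
  | n + 1 => f n + 1

/-- Renaming of value variables. -/
def rename (f : ℕ → ℕ) : Tm → Tm
  | .var n => .var (f n)
  | .svar => .svar
  | .unit => .unit
  | .vpair t u => .vpair (rename f t) (rename f u)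
  | .vfst t => .vfst (rename f t)
  | .vsnd t => .vsnd (rename f t)
  | .vlam A t => .vlam A (rename (liftN f) t)
  | .vapp s t => .vapp (rename f s) (rename f t)
  | .cunit => .cunit
  | .cpair t u => .cpair (rename f t) (rename f u)
  | .cfst t => .cfst (rename f t)
  | .csnd t => .csnd (rename f t)
  | .clam A t => .clam A (rename (liftN f) t)
  | .capp s t => .capp (rename f s) (rename f t)
  | .top => .top
  | .ilet t u => .ilet (rename f t) (rename f u)
  | .bang t => .bang (rename f t)
  | .banglet t u => .banglet (rename f t) (rename (liftN f) u)
  | .copow t u => .copow (rename f t) (rename f u)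
  | .copowlet s t => .copowlet (rename f s) (rename (liftN f) t)
  | .cimage A t => .cimage A (rename f t)
  | .cinl t => .cinl (rename f t)
  | .cinr t => .cinr (rename f t)
  | .ccase s t u => .ccase (rename f s) (rename f t) (rename f u)
  | .llam A t => .llam A (rename f t)
  | .lapp s t => .lapp (rename f s) (rename f t)

/-- Weakening of value variables. -/
def shift (t : Tm) : Tm := rename Nat.succ t

/-- Lift a parallel substitution of value variables under a binder. -/
def liftS (σ : ℕ → Tm) : ℕ → Tm
  | 0 => .var 0
  | n + 1 => shift (σ n)

/-- Parallel (capture-avoiding) substitution for value variables. -/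
def psubst (σ : ℕ → Tm) : Tm → Tm
  | .var n => σ n
  | .svar => .svar
  | .unit => .unit
  | .vpair t u => .vpair (psubst σ t) (psubst σ u)
  | .vfst t => .vfst (psubst σ t)
  | .vsnd t => .vsnd (psubst σ t)
  | .vlam A t => .vlam A (psubst (liftS σ) t)
  | .vapp s t => .vapp (psubst σ s) (psubst σ t)
  | .cunit => .cunit
  | .cpair t u => .cpair (psubst σ t) (psubst σ u)
  | .cfst t => .cfst (psubst σ t)
  | .csnd t => .csnd (psubst σ t)
  | .clam A t => .clam A (psubst (liftS σ) t)
  | .capp s t => .capp (psubst σ s) (psubst σ t)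
  | .top => .top
  | .ilet t u => .ilet (psubst σ t) (psubst σ u)
  | .bang t => .bang (psubst σ t)
  | .banglet t u => .banglet (psubst σ t) (psubst (liftS σ) u)
  | .copow t u => .copow (psubst σ t) (psubst σ u)
  | .copowlet s t => .copowlet (psubst σ s) (psubst (liftS σ) t)
  | .cimage A t => .cimage A (psubst σ t)
  | .cinl t => .cinl (psubst σ t)
  | .cinr t => .cinr (psubst σ t)
  | .ccase s t u => .ccase (psubst σ s) (psubst σ t) (psubst σ u)
  | .llam A t => .llam A (psubst σ t)
  | .lapp s t => .lapp (psubst σ s) (psubst σ t)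

/-- Capture-avoiding substitution `t[u/x]` of a term `u` for the innermost
value variable of `t`. -/
def subst0 (u : Tm) (t : Tm) : Tm :=
  psubst (fun n => match n with | 0 => u | m + 1 => .var m) t

/-- Capture-avoiding substitution `t[u/z]` of a term `u` for the stoup
variable of `t`.  The substitution stops at the stoup-variable binders
(`llam`-bodies, `copowlet`-bodies and `ccase`-branches). -/
def ssubst (u : Tm) : Tm → Tm
  | .var n => .var n
  | .svar => u
  | .unit => .unit
  | .vpair t t' => .vpair (ssubst u t) (ssubst u t')
  | .vfst t => .vfst (ssubst u t)
  | .vsnd t => .vsnd (ssubst u t)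
  | .vlam A t => .vlam A (ssubst (shift u) t)
  | .vapp s t => .vapp (ssubst u s) (ssubst u t)
  | .cunit => .cunit
  | .cpair t t' => .cpair (ssubst u t) (ssubst u t')
  | .cfst t => .cfst (ssubst u t)
  | .csnd t => .csnd (ssubst u t)
  | .clam A t => .clam A (ssubst (shift u) t)
  | .capp s t => .capp (ssubst u s) (ssubst u t)
  | .top => .top
  | .ilet t t' => .ilet (ssubst u t) (ssubst u t')
  | .bang t => .bang (ssubst u t)
  | .banglet t t' => .banglet (ssubst u t) (ssubst (shift u) t')
  | .copow t t' => .copow (ssubst u t) (ssubst u t')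
  | .copowlet s t => .copowlet (ssubst u s) t
  | .cimage A t => .cimage A (ssubst u t)
  | .cinl t => .cinl (ssubst u t)
  | .cinr t => .cinr (ssubst u t)
  | .ccase s t t' => .ccase (ssubst u s) t t'
  | .llam A t => .llam A t
  | .lapp s t => .lapp (ssubst u s) (ssubst u t)

end Tm

/-- Typing derivations of EEC (Figure 1 of the paper).  `Deriv Γ none t A`
is the judgement `Γ ⊢ t : A` (empty stoup); `Deriv Γ (some A̲) t (.comp B̲)`
is the judgement `Γ | z:A̲ ⊢ t : B̲`.  In the rules below `Δ` ranges over an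
arbitrary (possibly empty) stoup. -/
inductive Deriv : List VType → Option CType → Tm → VType → Type
  | var (Γ : List VType) (n : ℕ) (A : VType) :
      Γ[n]? = some A → Deriv Γ none (.var n) A
  | svar (Γ : List VType) (A : CType) : Deriv Γ (some A) .svar (.comp A)
  | unit (Γ : List VType) : Deriv Γ none .unit .unit
  | vpair (Γ : List VType) (t u : Tm) (A B : VType) :
      Deriv Γ none t A → Deriv Γ none u B → Deriv Γ none (.vpair t u) (.prod A B)
  | vfst (Γ : List VType) (t : Tm) (A B : VType) :
      Deriv Γ none t (.prod A B) → Deriv Γ none (.vfst t) A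
  | vsnd (Γ : List VType) (t : Tm) (A B : VType) :
      Deriv Γ none t (.prod A B) → Deriv Γ none (.vsnd t) B
  | vlam (Γ : List VType) (t : Tm) (A B : VType) :
      Deriv (A :: Γ) none t B → Deriv Γ none (.vlam A t) (.arr A B)
  | vapp (Γ : List VType) (s t : Tm) (A B : VType) :
      Deriv Γ none s (.arr A B) → Deriv Γ none t A → Deriv Γ none (.vapp s t) B
  | cunit (Γ : List VType) (Δ : Option CType) : Deriv Γ Δ .cunit (.comp .cunit)
  | cpair (Γ : List VType) (Δ : Option CType) (t u : Tm) (A B : CType) :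
      Deriv Γ Δ t (.comp A) → Deriv Γ Δ u (.comp B) →
      Deriv Γ Δ (.cpair t u) (.comp (.cand A B))
  | cfst (Γ : List VType) (Δ : Option CType) (t : Tm) (A B : CType) :
      Deriv Γ Δ t (.comp (.cand A B)) → Deriv Γ Δ (.cfst t) (.comp A)
  | csnd (Γ : List VType) (Δ : Option CType) (t : Tm) (A B : CType) :
      Deriv Γ Δ t (.comp (.cand A B)) → Deriv Γ Δ (.csnd t) (.comp B)
  | clam (Γ : List VType) (Δ : Option CType) (t : Tm) (A : VType) (B : CType) :
      Deriv (A :: Γ) Δ t (.comp B) → Deriv Γ Δ (.clam A t) (.comp (.carr A B))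
  | capp (Γ : List VType) (Δ : Option CType) (s t : Tm) (A : VType) (B : CType) :
      Deriv Γ Δ s (.comp (.carr A B)) → Deriv Γ none t A →
      Deriv Γ Δ (.capp s t) (.comp B)
  | top (Γ : List VType) : Deriv Γ none .top (.comp .iunit)
  | ilet (Γ : List VType) (Δ : Option CType) (t u : Tm) (A : CType) :
      Deriv Γ Δ t (.comp .iunit) → Deriv Γ none u (.comp A) →
      Deriv Γ Δ (.ilet t u) (.comp A)
  | bang (Γ : List VType) (t : Tm) (A : VType) :
      Deriv Γ none t A → Deriv Γ none (.bang t) (.comp (.bang A))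
  | banglet (Γ : List VType) (Δ : Option CType) (t u : Tm) (A : VType) (B : CType) :
      Deriv Γ Δ t (.comp (.bang A)) → Deriv (A :: Γ) none u (.comp B) →
      Deriv Γ Δ (.banglet t u) (.comp B)
  | copow (Γ : List VType) (Δ : Option CType) (t u : Tm) (A : VType) (B : CType) :
      Deriv Γ none t A → Deriv Γ Δ u (.comp B) →
      Deriv Γ Δ (.copow t u) (.comp (.copow A B))
  | copowlet (Γ : List VType) (Δ : Option CType) (s t : Tm) (A : VType) (B C : CType) :
      Deriv Γ Δ s (.comp (.copow A B)) → Deriv (A :: Γ) (some B) t (.comp C) →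
      Deriv Γ Δ (.copowlet s t) (.comp C)
  | cimage (Γ : List VType) (Δ : Option CType) (t : Tm) (A : CType) :
      Deriv Γ Δ t (.comp .czero) → Deriv Γ Δ (.cimage A t) (.comp A)
  | cinl (Γ : List VType) (Δ : Option CType) (t : Tm) (A B : CType) :
      Deriv Γ Δ t (.comp A) → Deriv Γ Δ (.cinl t) (.comp (.csum A B))
  | cinr (Γ : List VType) (Δ : Option CType) (t : Tm) (A B : CType) :
      Deriv Γ Δ t (.comp B) → Deriv Γ Δ (.cinr t) (.comp (.csum A B))
  | ccase (Γ : List VType) (Δ : Option CType) (s t u : Tm) (A B C : CType) :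
      Deriv Γ Δ s (.comp (.csum A B)) → Deriv Γ (some A) t (.comp C) →
      Deriv Γ (some B) u (.comp C) → Deriv Γ Δ (.ccase s t u) (.comp C)
  | llam (Γ : List VType) (t : Tm) (A B : CType) :
      Deriv Γ (some A) t (.comp B) → Deriv Γ none (.llam A t) (.lin A B)
  | lapp (Γ : List VType) (Δ : Option CType) (s t : Tm) (A B : CType) :
      Deriv Γ none s (.lin A B) → Deriv Γ Δ t (.comp A) →
      Deriv Γ Δ (.lapp s t) (.comp B)

/-- The equational theory of EEC: the smallest type-respecting congruence
containing the βη-equalities of Figure 2 of the paper. -/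
inductive EEq : List VType → Option CType → Tm → Tm → VType → Prop
  -- equivalence
  | refl {Γ Δ t A} : Deriv Γ Δ t A → EEq Γ Δ t t A
  | symm {Γ Δ t u A} : EEq Γ Δ t u A → EEq Γ Δ u t A
  | trans {Γ Δ t u v A} : EEq Γ Δ t u A → EEq Γ Δ u v A → EEq Γ Δ t v A
  -- congruence rules
  | vpair_cong {Γ t t' u u' A B} : EEq Γ none t t' A → EEq Γ none u u' B →
      EEq Γ none (.vpair t u) (.vpair t' u') (.prod A B)
  | vfst_cong {Γ t t' A B} : EEq Γ none t t' (.prod A B) →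
      EEq Γ none (.vfst t) (.vfst t') A
  | vsnd_cong {Γ t t' A B} : EEq Γ none t t' (.prod A B) →
      EEq Γ none (.vsnd t) (.vsnd t') B
  | vlam_cong {Γ t t' A B} : EEq (A :: Γ) none t t' B →
      EEq Γ none (.vlam A t) (.vlam A t') (.arr A B)
  | vapp_cong {Γ s s' t t' A B} : EEq Γ none s s' (.arr A B) → EEq Γ none t t' A →
      EEq Γ none (.vapp s t) (.vapp s' t') B
  | cpair_cong {Γ Δ t t' u u' A B} : EEq Γ Δ t t' (.comp A) → EEq Γ Δ u u' (.comp B) →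
      EEq Γ Δ (.cpair t u) (.cpair t' u') (.comp (.cand A B))
  | cfst_cong {Γ Δ t t' A B} : EEq Γ Δ t t' (.comp (.cand A B)) →
      EEq Γ Δ (.cfst t) (.cfst t') (.comp A)
  | csnd_cong {Γ Δ t t' A B} : EEq Γ Δ t t' (.comp (.cand A B)) →
      EEq Γ Δ (.csnd t) (.csnd t') (.comp B)
  | clam_cong {Γ Δ t t' A B} : EEq (A :: Γ) Δ t t' (.comp B) →
      EEq Γ Δ (.clam A t) (.clam A t') (.comp (.carr A B))
  | capp_cong {Γ Δ s s' t t' A B} : EEq Γ Δ s s' (.comp (.carr A B)) → EEq Γ none t t' A →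
      EEq Γ Δ (.capp s t) (.capp s' t') (.comp B)
  | ilet_cong {Γ Δ t t' u u' A} : EEq Γ Δ t t' (.comp .iunit) → EEq Γ none u u' (.comp A) →
      EEq Γ Δ (.ilet t u) (.ilet t' u') (.comp A)
  | bang_cong {Γ t t' A} : EEq Γ none t t' A →
      EEq Γ none (.bang t) (.bang t') (.comp (.bang A))
  | banglet_cong {Γ Δ t t' u u' A B} : EEq Γ Δ t t' (.comp (.bang A)) →
      EEq (A :: Γ) none u u' (.comp B) →
      EEq Γ Δ (.banglet t u) (.banglet t' u') (.comp B)
  | copow_cong {Γ Δ t t' u u' A B} : EEq Γ none t t' A → EEq Γ Δ u u' (.comp B) →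
      EEq Γ Δ (.copow t u) (.copow t' u') (.comp (.copow A B))
  | copowlet_cong {Γ Δ s s' t t' A B C} : EEq Γ Δ s s' (.comp (.copow A B)) →
      EEq (A :: Γ) (some B) t t' (.comp C) →
      EEq Γ Δ (.copowlet s t) (.copowlet s' t') (.comp C)
  | cimage_cong {Γ Δ t t' A} : EEq Γ Δ t t' (.comp .czero) →
      EEq Γ Δ (.cimage A t) (.cimage A t') (.comp A)
  | cinl_cong {Γ Δ t t' A B} : EEq Γ Δ t t' (.comp A) →
      EEq Γ Δ (.cinl t) (.cinl t') (.comp (.csum A B))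
  | cinr_cong {Γ Δ t t' A B} : EEq Γ Δ t t' (.comp B) →
      EEq Γ Δ (.cinr t) (.cinr t') (.comp (.csum A B))
  | ccase_cong {Γ Δ s s' t t' u u' A B C} : EEq Γ Δ s s' (.comp (.csum A B)) →
      EEq Γ (some A) t t' (.comp C) → EEq Γ (some B) u u' (.comp C) →
      EEq Γ Δ (.ccase s t u) (.ccase s' t' u') (.comp C)
  | llam_cong {Γ t t' A B} : EEq Γ (some A) t t' (.comp B) →
      EEq Γ none (.llam A t) (.llam A t') (.lin A B)
  | lapp_cong {Γ Δ s s' t t' A B} : EEq Γ none s s' (.lin A B) → EEq Γ Δ t t' (.comp A) →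
      EEq Γ Δ (.lapp s t) (.lapp s' t') (.comp B)
  -- the equalities of Figure 2
  | unit_eta {Γ t} : Deriv Γ none t .unit → EEq Γ none t .unit .unit
  | vfst_beta {Γ t u A B} : Deriv Γ none t A → Deriv Γ none u B →
      EEq Γ none (.vfst (.vpair t u)) t A
  | vsnd_beta {Γ t u A B} : Deriv Γ none t A → Deriv Γ none u B →
      EEq Γ none (.vsnd (.vpair t u)) u B
  | vpair_eta {Γ t A B} : Deriv Γ none t (.prod A B) →
      EEq Γ none (.vpair (.vfst t) (.vsnd t)) t (.prod A B)
  | vlam_beta {Γ t u A B} : Deriv (A :: Γ) none t B → Deriv Γ none u A →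
      EEq Γ none (.vapp (.vlam A t) u) (Tm.subst0 u t) B
  | vlam_eta {Γ t A B} : Deriv Γ none t (.arr A B) →
      EEq Γ none (.vlam A (.vapp (Tm.shift t) (.var 0))) t (.arr A B)
  | cunit_eta {Γ Δ t} : Deriv Γ Δ t (.comp .cunit) → EEq Γ Δ t .cunit (.comp .cunit)
  | cfst_beta {Γ Δ t u A B} : Deriv Γ Δ t (.comp A) → Deriv Γ Δ u (.comp B) →
      EEq Γ Δ (.cfst (.cpair t u)) t (.comp A)
  | csnd_beta {Γ Δ t u A B} : Deriv Γ Δ t (.comp A) → Deriv Γ Δ u (.comp B) →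
      EEq Γ Δ (.csnd (.cpair t u)) u (.comp B)
  | cpair_eta {Γ Δ t A B} : Deriv Γ Δ t (.comp (.cand A B)) →
      EEq Γ Δ (.cpair (.cfst t) (.csnd t)) t (.comp (.cand A B))
  | clam_beta {Γ Δ t u A B} : Deriv (A :: Γ) Δ t (.comp B) → Deriv Γ none u A →
      EEq Γ Δ (.capp (.clam A t) u) (Tm.subst0 u t) (.comp B)
  | clam_eta {Γ Δ t A B} : Deriv Γ Δ t (.comp (.carr A B)) →
      EEq Γ Δ (.clam A (.capp (Tm.shift t) (.var 0))) t (.comp (.carr A B))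
  | ilet_beta {Γ t A} : Deriv Γ none t (.comp A) →
      EEq Γ none (.ilet .top t) t (.comp A)
  | ilet_eta {Γ Δ t u A} : Deriv Γ Δ t (.comp .iunit) → Deriv Γ (some .iunit) u (.comp A) →
      EEq Γ Δ (.ilet t (Tm.ssubst .top u)) (Tm.ssubst t u) (.comp A)
  | bang_beta {Γ t u A B} : Deriv Γ none t A → Deriv (A :: Γ) none u (.comp B) →
      EEq Γ none (.banglet (.bang t) u) (Tm.subst0 t u) (.comp B)
  | bang_eta {Γ Δ t u A B} : Deriv Γ Δ t (.comp (.bang A)) →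
      Deriv Γ (some (.bang A)) u (.comp B) →
      EEq Γ Δ (.banglet t (Tm.ssubst (.bang (.var 0)) (Tm.shift u))) (Tm.ssubst t u) (.comp B)
  | copow_beta {Γ Δ t s u A B C} : Deriv Γ none t A → Deriv Γ Δ s (.comp B) →
      Deriv (A :: Γ) (some B) u (.comp C) →
      EEq Γ Δ (.copowlet (.copow t s) u) (Tm.ssubst s (Tm.subst0 t u)) (.comp C)
  | copow_eta {Γ Δ t u A B C} : Deriv Γ Δ t (.comp (.copow A B)) →
      Deriv Γ (some (.copow A B)) u (.comp C) →
      EEq Γ Δ (.copowlet t (Tm.ssubst (.copow (.var 0) .svar) (Tm.shift u))) (Tm.ssubst t u) (.comp C)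
  | czero_eta {Γ Δ t u A} : Deriv Γ Δ t (.comp .czero) → Deriv Γ (some .czero) u (.comp A) →
      EEq Γ Δ (.cimage A t) (Tm.ssubst t u) (.comp A)
  | csum_beta_inl {Γ Δ t u u' A B C} : Deriv Γ (some A) u (.comp C) →
      Deriv Γ (some B) u' (.comp C) → Deriv Γ Δ t (.comp A) →
      EEq Γ Δ (.ccase (.cinl t) u u') (Tm.ssubst t u) (.comp C)
  | csum_beta_inr {Γ Δ t u u' A B C} : Deriv Γ (some A) u (.comp C) →
      Deriv Γ (some B) u' (.comp C) → Deriv Γ Δ t (.comp B) →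
      EEq Γ Δ (.ccase (.cinr t) u u') (Tm.ssubst t u') (.comp C)
  | csum_eta {Γ Δ t u A B C} : Deriv Γ Δ t (.comp (.csum A B)) →
      Deriv Γ (some (.csum A B)) u (.comp C) →
      EEq Γ Δ (.ccase t (Tm.ssubst (.cinl .svar) u) (Tm.ssubst (.cinr .svar) u)) (Tm.ssubst t u) (.comp C)
  | llam_beta {Γ Δ t u A B} : Deriv Γ (some A) t (.comp B) → Deriv Γ Δ u (.comp A) →
      EEq Γ Δ (.lapp (.llam A t) u) (Tm.ssubst u t) (.comp B)
  | llam_eta {Γ t A B} : Deriv Γ none t (.lin A B) →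
      EEq Γ none (.llam A (.lapp t .svar)) t (.lin A B)

end EEC

namespace EEC

/-! ## The generic linear-use CPS self-translation of EEC (Figures 4–6) -/

mutual
  /-- CPS translation `Aᶜ` of value types, relative to the result type `R̲`. -/
  def cpsV (R : CType) : VType → VType
    | .base a => .base a
    | .unit => .unit
    | .prod A B => .prod (cpsV R A) (cpsV R B)
    | .arr A B => .arr (cpsV R A) (cpsV R B)
    | .comp A => .lin (cpsC R A) R
    | .lin A B => .lin (cpsC R B) (cpsC R A)
  /-- CPS translation `A̲ᶜ` of computation types, relative to the result type
  `R̲` (a computation-type constant equal to `R̲` is translated to `I̲`). -/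
  def cpsC (R : CType) : CType → CType
    | .base a =>
        match R with
        | .base b => if b = a then .iunit else .base a
        | _ => .base a
    | .cunit => .czero
    | .cand A B => .csum (cpsC R A) (cpsC R B)
    | .carr A B => .copow (cpsV R A) (cpsC R B)
    | .iunit => R
    | .bang A => .carr (cpsV R A) R
    | .copow A B => .carr (cpsV R A) (cpsC R B)
    | .czero => .cunit
    | .csum A B => .cand (cpsC R A) (cpsC R B)
end

/-- Pointwise CPS translation `Γᶜ` of a context. -/
def cpsCtx (R : CType) (Γ : List VType) : List VType := Γ.map (cpsV R)

/-- The generic linear-use CPS self-translation on terms (Figures 5 and 6 of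
the paper), defined by recursion on typing derivations.  A value judgement
`Γ ⊢ t : A` is sent to a term `tᶜ` with `Γᶜ ⊢ tᶜ : Aᶜ`, and a stoup
judgement `Γ | z:A̲ ⊢ t : B̲` is sent (contravariantly) to a term `tᶜ` with
`Γᶜ | k_z:B̲ᶜ ⊢ tᶜ : A̲ᶜ`. -/
def cps (R : CType) : {Γ : List VType} → {Δ : Option CType} → {t : Tm} → {A : VType} →
    Deriv Γ Δ t A → Tm
  | _, _, _, _, .var _ n _ _ => .var n
  | _, _, _, _, .svar _ _ => .svar
  | _, _, _, _, .unit _ => .unit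
  | _, _, _, _, .vpair _ _ _ _ _ d1 d2 => .vpair (cps R d1) (cps R d2)
  | _, _, _, _, .vfst _ _ _ _ d => .vfst (cps R d)
  | _, _, _, _, .vsnd _ _ _ _ d => .vsnd (cps R d)
  | _, _, _, _, .vlam _ _ A _ d => .vlam (cpsV R A) (cps R d)
  | _, _, _, _, .vapp _ _ _ _ _ d1 d2 => .vapp (cps R d1) (cps R d2)
  | _, _, _, _, .cunit _ none => .llam .czero (.cimage R .svar)
  | _, _, _, _, .cunit _ (some D) => .cimage (cpsC R D) .svar
  | _, _, _, _, .cpair _ none _ _ A B d1 d2 =>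
      .llam (.csum (cpsC R A) (cpsC R B))
        (.ccase .svar (.lapp (cps R d1) .svar) (.lapp (cps R d2) .svar))
  | _, _, _, _, .cpair _ (some _) _ _ _ _ d1 d2 => .ccase .svar (cps R d1) (cps R d2)
  | _, _, _, _, .cfst _ none _ A _ d => .llam (cpsC R A) (.lapp (cps R d) (.cinl .svar))
  | _, _, _, _, .cfst _ (some _) _ _ _ d => Tm.ssubst (.cinl .svar) (cps R d)
  | _, _, _, _, .csnd _ none _ _ B d => .llam (cpsC R B) (.lapp (cps R d) (.cinr .svar))
  | _, _, _, _, .csnd _ (some _) _ _ _ d => Tm.ssubst (.cinr .svar) (cps R d)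
  | _, _, _, _, .clam _ none _ A B d =>
      .llam (.copow (cpsV R A) (cpsC R B)) (.copowlet .svar (.lapp (cps R d) .svar))
  | _, _, _, _, .clam _ (some _) _ _ _ d => .copowlet .svar (cps R d)
  | _, _, _, _, .capp _ none _ _ _ B d1 d2 =>
      .llam (cpsC R B) (.lapp (cps R d1) (.copow (cps R d2) .svar))
  | _, _, _, _, .capp _ (some _) _ _ _ _ d1 d2 =>
      Tm.ssubst (.copow (cps R d2) .svar) (cps R d1)
  | _, _, _, _, .top _ => .llam R .svar
  | _, _, _, _, .ilet _ none _ _ A d1 d2 =>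
      .llam (cpsC R A) (.lapp (cps R d1) (.lapp (cps R d2) .svar))
  | _, _, _, _, .ilet _ (some _) _ _ _ d1 d2 =>
      Tm.ssubst (.lapp (cps R d2) .svar) (cps R d1)
  | _, _, _, _, .bang _ _ A d => .llam (.carr (cpsV R A) R) (.capp .svar (cps R d))
  | _, _, _, _, .banglet _ none _ _ A B d1 d2 =>
      .llam (cpsC R B) (.lapp (cps R d1) (.clam (cpsV R A) (.lapp (cps R d2) .svar)))
  | _, _, _, _, .banglet _ (some _) _ _ A _ d1 d2 =>
      Tm.ssubst (.clam (cpsV R A) (.lapp (cps R d2) .svar)) (cps R d1)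
  | _, _, _, _, .copow _ none _ _ A B d1 d2 =>
      .llam (.carr (cpsV R A) (cpsC R B)) (.lapp (cps R d2) (.capp .svar (cps R d1)))
  | _, _, _, _, .copow _ (some _) _ _ _ _ d1 d2 =>
      Tm.ssubst (.capp .svar (cps R d1)) (cps R d2)
  | _, _, _, _, .copowlet _ none _ _ A _ C d1 d2 =>
      .llam (cpsC R C) (.lapp (cps R d1) (.clam (cpsV R A) (cps R d2)))
  | _, _, _, _, .copowlet _ (some _) _ _ A _ _ d1 d2 =>
      Tm.ssubst (.clam (cpsV R A) (cps R d2)) (cps R d1)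
  | _, _, _, _, .cimage _ none _ A d => .llam (cpsC R A) (.lapp (cps R d) .cunit)
  | _, _, _, _, .cimage _ (some _) _ _ d => Tm.ssubst .cunit (cps R d)
  | _, _, _, _, .cinl _ none _ A B d =>
      .llam (.cand (cpsC R A) (cpsC R B)) (.lapp (cps R d) (.cfst .svar))
  | _, _, _, _, .cinl _ (some _) _ _ _ d => Tm.ssubst (.cfst .svar) (cps R d)
  | _, _, _, _, .cinr _ none _ A B d =>
      .llam (.cand (cpsC R A) (cpsC R B)) (.lapp (cps R d) (.csnd .svar))
  | _, _, _, _, .cinr _ (some _) _ _ _ d => Tm.ssubst (.csnd .svar) (cps R d)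
  | _, _, _, _, .ccase _ none _ _ _ _ _ C d1 d2 d3 =>
      .llam (cpsC R C) (.lapp (cps R d1) (.cpair (cps R d2) (cps R d3)))
  | _, _, _, _, .ccase _ (some _) _ _ _ _ _ _ d1 d2 d3 =>
      Tm.ssubst (.cpair (cps R d2) (cps R d3)) (cps R d1)
  | _, _, _, _, .llam _ _ _ B d => .llam (cpsC R B) (cps R d)
  | _, _, _, _, .lapp _ none _ _ _ B d1 d2 =>
      .llam (cpsC R B) (.lapp (cps R d2) (.lapp (cps R d1) .svar))
  | _, _, _, _, .lapp _ (some _) _ _ _ _ d1 d2 =>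
      Tm.ssubst (.lapp (cps R d1) .svar) (cps R d2)

end EEC

namespace EEC

/-! ## The type isomorphisms `ι` of Figure 7, with explicit inverses -/

mutual
  /-- The closed term `ι_A : (Aᶜ)ᶜ → A` (Figure 7). -/
  def iotaV (R : CType) : VType → Tm
    | .base a => .vlam (.base a) (.var 0)
    | .unit => .vlam .unit .unit
    | .prod A B => .vlam (cpsV R (cpsV R (.prod A B)))
        (.vpair (.vapp (iotaV R A) (.vfst (.var 0))) (.vapp (iotaV R B) (.vsnd (.var 0))))
    | .arr A B => .vlam (cpsV R (cpsV R (.arr A B)))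
        (.vlam A (.vapp (iotaV R B) (.vapp (.var 1) (.vapp (iotaVinv R A) (.var 0)))))
    | .comp A => .vlam (cpsV R (cpsV R (.comp A)))
        (.lapp (iotaC R A) (.lapp (.var 0) .top))
    | .lin A B => .vlam (cpsV R (cpsV R (.lin A B)))
        (.llam A (.lapp (iotaC R B) (.lapp (.var 0) (.lapp (iotaCinv R A) .svar))))
  /-- The closed term `ι_A⁻¹ : A → (Aᶜ)ᶜ`. -/
  def iotaVinv (R : CType) : VType → Tm
    | .base a => .vlam (.base a) (.var 0)
    | .unit => .vlam .unit .unit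
    | .prod A B => .vlam (.prod A B)
        (.vpair (.vapp (iotaVinv R A) (.vfst (.var 0))) (.vapp (iotaVinv R B) (.vsnd (.var 0))))
    | .arr A B => .vlam (.arr A B)
        (.vlam (cpsV R (cpsV R A)) (.vapp (iotaVinv R B) (.vapp (.var 1) (.vapp (iotaV R A) (.var 0)))))
    | .comp A => .vlam (.comp A)
        (.llam .iunit (.ilet .svar (.lapp (iotaCinv R A) (.var 0))))
    | .lin A B => .vlam (.lin A B)
        (.llam (cpsC R (cpsC R A)) (.lapp (iotaCinv R B) (.lapp (.var 0) (.lapp (iotaC R A) .svar))))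
  /-- The closed term `ι_A̲ : (A̲ᶜ)ᶜ ⊸ A̲` (Figure 7). -/
  def iotaC (R : CType) : CType → Tm
    | .base a => .llam (cpsC R (cpsC R (.base a))) .svar
    | .cunit => .llam (cpsC R (cpsC R .cunit)) .cunit
    | .cand A B => .llam (cpsC R (cpsC R (.cand A B)))
        (.cpair (.lapp (iotaC R A) (.cfst .svar)) (.lapp (iotaC R B) (.csnd .svar)))
    | .carr A B => .llam (cpsC R (cpsC R (.carr A B)))
        (.clam A (.lapp (iotaC R B) (.capp .svar (.vapp (iotaVinv R A) (.var 0)))))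
    | .iunit => .llam (cpsC R (cpsC R .iunit)) .svar
    | .bang A => .llam (cpsC R (cpsC R (.bang A)))
        (.copowlet .svar (.ilet .svar (.bang (.vapp (iotaV R A) (.var 0)))))
    | .copow A B => .llam (cpsC R (cpsC R (.copow A B)))
        (.copowlet .svar (.copow (.vapp (iotaV R A) (.var 0)) (.lapp (iotaC R B) .svar)))
    | .czero => .llam (cpsC R (cpsC R .czero)) .svar
    | .csum A B => .llam (cpsC R (cpsC R (.csum A B)))
        (.ccase .svar (.cinl (.lapp (iotaC R A) .svar)) (.cinr (.lapp (iotaC R B) .svar)))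
  /-- The closed term `ι_A̲⁻¹ : A̲ ⊸ (A̲ᶜ)ᶜ`. -/
  def iotaCinv (R : CType) : CType → Tm
    | .base a => .llam (.base a) .svar
    | .cunit => .llam .cunit .cunit
    | .cand A B => .llam (.cand A B)
        (.cpair (.lapp (iotaCinv R A) (.cfst .svar)) (.lapp (iotaCinv R B) (.csnd .svar)))
    | .carr A B => .llam (.carr A B)
        (.clam (cpsV R (cpsV R A)) (.lapp (iotaCinv R B) (.capp .svar (.vapp (iotaV R A) (.var 0)))))
    | .iunit => .llam .iunit .svar
    | .bang A => .llam (.bang A)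
        (.banglet .svar (.copow (.vapp (iotaVinv R A) (.var 0)) .top))
    | .copow A B => .llam (.copow A B)
        (.copowlet .svar (.copow (.vapp (iotaVinv R A) (.var 0)) (.lapp (iotaCinv R B) .svar)))
    | .czero => .llam .czero .svar
    | .csum A B => .llam (.csum A B)
        (.ccase .svar (.cinl (.lapp (iotaCinv R A) .svar)) (.cinr (.lapp (iotaCinv R B) .svar)))
end

/-- The substitution `[ι⁻¹(Γ)]`, replacing each variable `xᵢ : Cᵢ` of `Γ` by
`ι_{Cᵢ}⁻¹(xᵢ)`. -/
def iotaSubst (R : CType) (Γ : List VType) (t : Tm) : Tm :=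
  Tm.psubst (fun n =>
    match Γ[n]? with
    | some C => .vapp (iotaVinv R C) (.var n)
    | none => .var n) t

/-! ## The simply-typed λ-calculus -/

/-- Simple types. -/
inductive STy : Type
  | base : ℕ → STy
  | unit : STy
  | prod : STy → STy → STy
  | arr : STy → STy → STy

/-- Raw simply-typed λ-terms (de Bruijn indices). -/
inductive LTm : Type
  | var : ℕ → LTm
  | unit : LTm
  | pair : LTm → LTm → LTm
  | fst : LTm → LTm
  | snd : LTm → LTm
  | lam : STy → LTm → LTm
  | app : LTm → LTm → LTm

namespace LTm

/-- Renaming of variables. -/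
def rename (f : ℕ → ℕ) : LTm → LTm
  | .var n => .var (f n)
  | .unit => .unit
  | .pair M N => .pair (rename f M) (rename f N)
  | .fst M => .fst (rename f M)
  | .snd M => .snd (rename f M)
  | .lam σ M => .lam σ (rename (Tm.liftN f) M)
  | .app M N => .app (rename f M) (rename f N)

/-- Weakening. -/
def shift (M : LTm) : LTm := rename Nat.succ M

/-- Parallel capture-avoiding substitution. -/
def psubst (σ : ℕ → LTm) : LTm → LTm
  | .var n => σ n
  | .unit => .unit
  | .pair M N => .pair (psubst σ M) (psubst σ N)
  | .fst M => .fst (psubst σ M)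
  | .snd M => .snd (psubst σ M)
  | .lam τ M => .lam τ (psubst (fun n => match n with | 0 => .var 0 | m + 1 => shift (σ m)) M)
  | .app M N => .app (psubst σ M) (psubst σ N)

/-- Capture-avoiding substitution `M[N/x]` for the innermost variable. -/
def subst0 (N : LTm) (M : LTm) : LTm :=
  psubst (fun n => match n with | 0 => N | m + 1 => .var m) M

end LTm

/-- Typing derivations of the simply-typed λ-calculus (Figure 3). -/
inductive LDeriv : List STy → LTm → STy → Type
  | var (Θ : List STy) (n : ℕ) (σ : STy) : Θ[n]? = some σ → LDeriv Θ (.var n) σ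
  | unit (Θ : List STy) : LDeriv Θ .unit .unit
  | pair (Θ : List STy) (M N : LTm) (σ τ : STy) :
      LDeriv Θ M σ → LDeriv Θ N τ → LDeriv Θ (.pair M N) (.prod σ τ)
  | fst (Θ : List STy) (M : LTm) (σ τ : STy) :
      LDeriv Θ M (.prod σ τ) → LDeriv Θ (.fst M) σ
  | snd (Θ : List STy) (M : LTm) (σ τ : STy) :
      LDeriv Θ M (.prod σ τ) → LDeriv Θ (.snd M) τ
  | lam (Θ : List STy) (M : LTm) (σ τ : STy) :
      LDeriv (σ :: Θ) M τ → LDeriv Θ (.lam σ M) (.arr σ τ)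
  | app (Θ : List STy) (M N : LTm) (σ τ : STy) :
      LDeriv Θ M (.arr σ τ) → LDeriv Θ N σ → LDeriv Θ (.app M N) τ

/-- Values of the (call-by-value) λ-calculus. -/
inductive LVal : LTm → Prop
  | var (n : ℕ) : LVal (.var n)
  | unit : LVal .unit
  | lam (σ : STy) (M : LTm) : LVal (.lam σ M)
  | pair {M N : LTm} : LVal M → LVal N → LVal (.pair M N)

/-- βη-equality of the simply-typed λ-calculus. -/
inductive LBetaEta : List STy → LTm → LTm → STy → Prop
  | refl {Θ M σ} : LDeriv Θ M σ → LBetaEta Θ M M σ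
  | symm {Θ M N σ} : LBetaEta Θ M N σ → LBetaEta Θ N M σ
  | trans {Θ M N P σ} : LBetaEta Θ M N σ → LBetaEta Θ N P σ → LBetaEta Θ M P σ
  | pair_cong {Θ M M' N N' σ τ} : LBetaEta Θ M M' σ → LBetaEta Θ N N' τ →
      LBetaEta Θ (.pair M N) (.pair M' N') (.prod σ τ)
  | fst_cong {Θ M M' σ τ} : LBetaEta Θ M M' (.prod σ τ) → LBetaEta Θ (.fst M) (.fst M') σ
  | snd_cong {Θ M M' σ τ} : LBetaEta Θ M M' (.prod σ τ) → LBetaEta Θ (.snd M) (.snd M') τ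
  | lam_cong {Θ M M' σ τ} : LBetaEta (σ :: Θ) M M' τ →
      LBetaEta Θ (.lam σ M) (.lam σ M') (.arr σ τ)
  | app_cong {Θ M M' N N' σ τ} : LBetaEta Θ M M' (.arr σ τ) → LBetaEta Θ N N' σ →
      LBetaEta Θ (.app M N) (.app M' N') τ
  | beta {Θ M N σ τ} : LDeriv (σ :: Θ) M τ → LDeriv Θ N σ →
      LBetaEta Θ (.app (.lam σ M) N) (LTm.subst0 N M) τ
  | eta {Θ M σ τ} : LDeriv Θ M (.arr σ τ) →
      LBetaEta Θ (.lam σ (.app (LTm.shift M) (.var 0))) M (.arr σ τ)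
  | fst_beta {Θ M N σ τ} : LDeriv Θ M σ → LDeriv Θ N τ →
      LBetaEta Θ (.fst (.pair M N)) M σ
  | snd_beta {Θ M N σ τ} : LDeriv Θ M σ → LDeriv Θ N τ →
      LBetaEta Θ (.snd (.pair M N)) N τ
  | pair_eta {Θ M σ τ} : LDeriv Θ M (.prod σ τ) →
      LBetaEta Θ (.pair (.fst M) (.snd M)) M (.prod σ τ)
  | unit_eta {Θ M} : LDeriv Θ M .unit → LBetaEta Θ M .unit .unit

/-- Equality in Moggi's computational λ-calculus `λc` (call-by-value
βη-equalities restricted to values, together with the `let`-laws, expressed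
via the standard encoding `let x = M in N := (λx.N) M`). -/
inductive LamC : List STy → LTm → LTm → STy → Prop
  | refl {Θ M σ} : LDeriv Θ M σ → LamC Θ M M σ
  | symm {Θ M N σ} : LamC Θ M N σ → LamC Θ N M σ
  | trans {Θ M N P σ} : LamC Θ M N σ → LamC Θ N P σ → LamC Θ M P σ
  | pair_cong {Θ M M' N N' σ τ} : LamC Θ M M' σ → LamC Θ N N' τ →
      LamC Θ (.pair M N) (.pair M' N') (.prod σ τ)
  | fst_cong {Θ M M' σ τ} : LamC Θ M M' (.prod σ τ) → LamC Θ (.fst M) (.fst M') σ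
  | snd_cong {Θ M M' σ τ} : LamC Θ M M' (.prod σ τ) → LamC Θ (.snd M) (.snd M') τ
  | lam_cong {Θ M M' σ τ} : LamC (σ :: Θ) M M' τ →
      LamC Θ (.lam σ M) (.lam σ M') (.arr σ τ)
  | app_cong {Θ M M' N N' σ τ} : LamC Θ M M' (.arr σ τ) → LamC Θ N N' σ →
      LamC Θ (.app M N) (.app M' N') τ
  | beta_v {Θ M V σ τ} : LDeriv (σ :: Θ) M τ → LDeriv Θ V σ → LVal V →
      LamC Θ (.app (.lam σ M) V) (LTm.subst0 V M) τ
  | eta_v {Θ V σ τ} : LVal V → LDeriv Θ V (.arr σ τ) →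
      LamC Θ (.lam σ (.app (LTm.shift V) (.var 0))) V (.arr σ τ)
  | fst_beta_v {Θ V W σ τ} : LVal V → LVal W → LDeriv Θ V σ → LDeriv Θ W τ →
      LamC Θ (.fst (.pair V W)) V σ
  | snd_beta_v {Θ V W σ τ} : LVal V → LVal W → LDeriv Θ V σ → LDeriv Θ W τ →
      LamC Θ (.snd (.pair V W)) W τ
  | pair_eta_v {Θ V σ τ} : LVal V → LDeriv Θ V (.prod σ τ) →
      LamC Θ (.pair (.fst V) (.snd V)) V (.prod σ τ)
  | unit_eta_v {Θ V} : LVal V → LDeriv Θ V .unit → LamC Θ V .unit .unit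
  | let_eta {Θ M σ} : LDeriv Θ M σ → LamC Θ (.app (.lam σ (.var 0)) M) M σ
  | let_assoc {Θ M N L σ ρ τ} : LDeriv (σ :: Θ) M τ → LDeriv (ρ :: Θ) N σ →
      LDeriv Θ L ρ →
      LamC Θ (.app (.lam σ M) (.app (.lam ρ N) L))
        (.app (.lam ρ (.app (.lam σ (LTm.rename (Tm.liftN Nat.succ) M)) N)) L) τ
  | app_left {Θ M N σ τ} : LDeriv Θ M (.arr σ τ) → LDeriv Θ N σ →
      LamC Θ (.app M N) (.app (.lam (.arr σ τ) (.app (.var 0) (LTm.shift N))) M) τ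
  | app_right {Θ V N σ τ} : LVal V → LDeriv Θ V (.arr σ τ) → LDeriv Θ N σ →
      LamC Θ (.app V N) (.app (.lam σ (.app (LTm.shift V) (.var 0))) N) τ
  | pair_left {Θ M N σ τ} : LDeriv Θ M σ → LDeriv Θ N τ →
      LamC Θ (.pair M N) (.app (.lam σ (.pair (.var 0) (LTm.shift N))) M) (.prod σ τ)
  | pair_right {Θ V N σ τ} : LVal V → LDeriv Θ V σ → LDeriv Θ N τ →
      LamC Θ (.pair V N) (.app (.lam τ (.pair (LTm.shift V) (.var 0))) N) (.prod σ τ)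
  | fst_cc {Θ M σ τ} : LDeriv Θ M (.prod σ τ) →
      LamC Θ (.fst M) (.app (.lam (.prod σ τ) (.fst (.var 0))) M) σ
  | snd_cc {Θ M σ τ} : LDeriv Θ M (.prod σ τ) →
      LamC Θ (.snd M) (.app (.lam (.prod σ τ) (.snd (.var 0))) M) τ

end EEC

namespace EEC

/-! ## The standard cbv and cbn translations of typed λ-calculus into EEC -/

/-- The computation-type constant `α̲` associated with a simply-typed
λ-calculus type constant `α` (the association is injective but not
surjective, so that some computation-type constants of EEC are different
from `α̲` for every λ-calculus type constant `α`). -/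
def assocC (a : ℕ) : CType := .base (a + 1)

/-- The call-by-value translation `σᵛ` on types. -/
def cbvT : STy → VType
  | .base a => .base a
  | .unit => .unit
  | .prod σ τ => .prod (cbvT σ) (cbvT τ)
  | .arr σ τ => .arr (cbvT σ) (.comp (.bang (cbvT τ)))

/-- The call-by-value translation `Θᵛ` on contexts. -/
def cbvCtx (Θ : List STy) : List VType := Θ.map cbvT

/-- The call-by-value translation on terms: `Θ ⊢ M : τ` is sent to
`Θᵛ ⊢ Mᵛ : !(τᵛ)`. -/
def cbvTm : LTm → Tm
  | .var n => .bang (.var n)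
  | .unit => .bang .unit
  | .pair M N => .banglet (cbvTm M) (.banglet (Tm.shift (cbvTm N)) (.bang (.vpair (.var 1) (.var 0))))
  | .fst M => .banglet (cbvTm M) (.bang (.vfst (.var 0)))
  | .snd M => .banglet (cbvTm M) (.bang (.vsnd (.var 0)))
  | .lam σ M => .bang (.vlam (cbvT σ) (cbvTm M))
  | .app M N => .banglet (cbvTm M) (.banglet (Tm.shift (cbvTm N)) (.vapp (.var 1) (.var 0)))

/-- The call-by-name translation `σⁿ` on types. -/
def cbnT : STy → CType
  | .base a => assocC a
  | .unit => .cunit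
  | .prod σ τ => .cand (cbnT σ) (cbnT τ)
  | .arr σ τ => .carr (.comp (cbnT σ)) (cbnT τ)

/-- The call-by-name translation `Θⁿ` on contexts. -/
def cbnCtx (Θ : List STy) : List VType := Θ.map (fun σ => .comp (cbnT σ))

/-- The call-by-name translation on terms: `Θ ⊢ M : τ` is sent to
`Θⁿ ⊢ Mⁿ : τⁿ`, mimicking each construct by the corresponding
computation-type construct of EEC. -/
def cbnTm : LTm → Tm
  | .var n => .var n
  | .unit => .cunit
  | .pair M N => .cpair (cbnTm M) (cbnTm N)
  | .fst M => .cfst (cbnTm M)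
  | .snd M => .csnd (cbnTm M)
  | .lam σ M => .clam (.comp (cbnT σ)) (cbnTm M)
  | .app M N => .capp (cbnTm M) (cbnTm N)

/-! ## Hasegawa's linear-use CPS translations (Section 4) -/

/-- The call-by-value linear-use CPS translation `σᵛᶜ` on types. -/
def cbvcpsT (R : CType) : STy → VType
  | .base a => .base a
  | .unit => .unit
  | .prod σ τ => .prod (cbvcpsT R σ) (cbvcpsT R τ)
  | .arr σ τ => .arr (cbvcpsT R σ) (.lin (.carr (cbvcpsT R τ) R) R)

/-- `Θᵛᶜ`. -/
def cbvcpsCtx (R : CType) (Θ : List STy) : List VType := Θ.map (cbvcpsT R)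

/-- The call-by-value linear-use CPS translation on terms: `Θ ⊢ M : τ` is
sent to `Θᵛᶜ ⊢ Mᵛᶜ : (τᵛᶜ ⇒ R̲) ⊸ R̲`. -/
def cbvcps (R : CType) : {Θ : List STy} → {M : LTm} → {σ : STy} → LDeriv Θ M σ → Tm
  | _, _, _, .var _ n σ _ => .llam (.carr (cbvcpsT R σ) R) (.capp .svar (.var n))
  | _, _, _, .unit _ => .llam (.carr .unit R) (.capp .svar .unit)
  | _, _, _, .pair _ _ _ σ τ dM dN =>
      .llam (.carr (.prod (cbvcpsT R σ) (cbvcpsT R τ)) R)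
        (.lapp (cbvcps R dM)
          (.clam (cbvcpsT R σ)
            (.lapp (Tm.shift (cbvcps R dN))
              (.clam (cbvcpsT R τ) (.capp .svar (.vpair (.var 1) (.var 0)))))))
  | _, _, _, .fst _ _ σ τ dM =>
      .llam (.carr (cbvcpsT R σ) R)
        (.lapp (cbvcps R dM)
          (.clam (.prod (cbvcpsT R σ) (cbvcpsT R τ)) (.capp .svar (.vfst (.var 0)))))
  | _, _, _, .snd _ _ σ τ dM =>
      .llam (.carr (cbvcpsT R τ) R)
        (.lapp (cbvcps R dM)
          (.clam (.prod (cbvcpsT R σ) (cbvcpsT R τ)) (.capp .svar (.vsnd (.var 0)))))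
  | _, _, _, .lam _ _ σ τ dM =>
      .llam (.carr (.arr (cbvcpsT R σ) (.lin (.carr (cbvcpsT R τ) R) R)) R)
        (.capp .svar (.vlam (cbvcpsT R σ) (cbvcps R dM)))
  | _, _, _, .app _ _ _ σ τ dM dN =>
      .llam (.carr (cbvcpsT R τ) R)
        (.lapp (cbvcps R dM)
          (.clam (.arr (cbvcpsT R σ) (.lin (.carr (cbvcpsT R τ) R) R))
            (.lapp (Tm.shift (cbvcps R dN))
              (.clam (cbvcpsT R σ) (.lapp (.vapp (.var 1) (.var 0)) .svar)))))

/-- The call-by-name linear-use CPS translation `σⁿᶜ` on types. -/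
def cbncpsT (R : CType) : STy → CType
  | .base a => assocC a
  | .unit => .czero
  | .prod σ τ => .csum (cbncpsT R σ) (cbncpsT R τ)
  | .arr σ τ => .copow (.lin (cbncpsT R σ) R) (cbncpsT R τ)

/-- `Θⁿᶜ ⊸ R̲`, assigning each variable `xᵢ : σᵢ` the type `σᵢⁿᶜ ⊸ R̲`. -/
def cbncpsCtx (R : CType) (Θ : List STy) : List VType :=
  Θ.map (fun σ => .lin (cbncpsT R σ) R)

/-- The call-by-name linear-use CPS translation on terms: `Θ ⊢ M : τ` is
sent to `Θⁿᶜ ⊸ R̲ ⊢ Mⁿᶜ : τⁿᶜ ⊸ R̲`. -/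
def cbncps (R : CType) : {Θ : List STy} → {M : LTm} → {σ : STy} → LDeriv Θ M σ → Tm
  | _, _, _, .var _ n _ _ => .var n
  | _, _, _, .unit _ => .llam .czero (.cimage R .svar)
  | _, _, _, .pair _ _ _ σ τ dM dN =>
      .llam (.csum (cbncpsT R σ) (cbncpsT R τ))
        (.ccase .svar (.lapp (cbncps R dM) .svar) (.lapp (cbncps R dN) .svar))
  | _, _, _, .fst _ _ σ _τ dM => .llam (cbncpsT R σ) (.lapp (cbncps R dM) (.cinl .svar))
  | _, _, _, .snd _ _ _ τ dM => .llam (cbncpsT R τ) (.lapp (cbncps R dM) (.cinr .svar))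
  | _, _, _, .lam _ _ σ τ dM =>
      .llam (.copow (.lin (cbncpsT R σ) R) (cbncpsT R τ))
        (.copowlet .svar (.lapp (cbncps R dM) .svar))
  | _, _, _, .app _ _ _ σ τ dM dN =>
      .llam (cbncpsT R τ) (.lapp (cbncps R dM) (.copow (cbncps R dN) .svar))

end EEC

namespace EEC

namespace Tm

/-- Extension of a parallel substitution by a term for the innermost variable. -/
def scons (u : Tm) (σ : ℕ → Tm) : ℕ → Tm
  | 0 => u
  | n + 1 => σ n

@[simp] theorem scons_zero (u : Tm) (σ : ℕ → Tm) : scons u σ 0 = u := rfl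

@[simp] theorem liftS_zero (σ : ℕ → Tm) : liftS σ 0 = .var 0 := rfl

@[simp] theorem liftS_one (σ : ℕ → Tm) : liftS σ 1 = shift (σ 0) := rfl

@[simp] theorem liftN_zero (f : ℕ → ℕ) : liftN f 0 = 0 := rfl

@[simp] theorem liftN_one (f : ℕ → ℕ) : liftN f 1 = f 0 + 1 := rfl

theorem subst0_eq (u t : Tm) : subst0 u t = psubst (scons u .var) t := by
  unfold subst0
  congr 1

theorem liftN_comp (f g : ℕ → ℕ) : liftN g ∘ liftN f = liftN (g ∘ f) := by
  funext n; cases n <;> rfl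

theorem liftN_id : liftN id = id := by
  funext n; cases n <;> rfl

theorem rename_rename (t : Tm) (f g : ℕ → ℕ) : rename g (rename f t) = rename (g ∘ f) t := by
  induction t generalizing f g <;> simp [rename, *, liftN_comp]

theorem rename_id (t : Tm) : rename id t = t := by
  induction t <;> simp [rename, *, liftN_id]

theorem liftS_comp_liftN (f : ℕ → ℕ) (σ : ℕ → Tm) : liftS σ ∘ liftN f = liftS (σ ∘ f) := by
  funext n; cases n <;> rfl

theorem psubst_rename (t : Tm) (f : ℕ → ℕ) (σ : ℕ → Tm) :
    psubst σ (rename f t) = psubst (σ ∘ f) t := by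
  induction t generalizing f σ <;> simp [rename, psubst, *, liftS_comp_liftN]

theorem rename_comp_liftS (f : ℕ → ℕ) (σ : ℕ → Tm) :
    rename (liftN f) ∘ liftS σ = liftS (rename f ∘ σ) := by
  funext n
  cases n
  · rfl
  · simp only [Function.comp, liftS, shift, rename_rename]
    congr 1

theorem rename_psubst (t : Tm) (f : ℕ → ℕ) (σ : ℕ → Tm) :
    rename f (psubst σ t) = psubst (rename f ∘ σ) t := by
  induction t generalizing f σ <;> simp [rename, psubst, *, rename_comp_liftS]

theorem psubst_comp_liftS (σ τ : ℕ → Tm) :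
    psubst (liftS τ) ∘ liftS σ = liftS (psubst τ ∘ σ) := by
  funext n
  cases n
  · rfl
  · simp only [Function.comp, liftS, shift, psubst_rename, rename_psubst]
    congr 1

theorem psubst_psubst (t : Tm) (σ τ : ℕ → Tm) :
    psubst τ (psubst σ t) = psubst (psubst τ ∘ σ) t := by
  induction t generalizing σ τ <;> simp [psubst, *, psubst_comp_liftS]

theorem liftS_var : liftS .var = .var := by
  funext n; cases n <;> rfl

@[simp] theorem psubst_var (t : Tm) : psubst .var t = t := by
  induction t <;> simp [psubst, *, liftS_var]

@[simp] theorem psubst_shift (u t : Tm) (σ : ℕ → Tm) : psubst (scons u σ) (shift t) = psubst σ t := by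
  rw [shift, psubst_rename]; rfl

@[simp] theorem psubst_liftS_shift (t : Tm) (σ : ℕ → Tm) :
    psubst (liftS σ) (shift t) = shift (psubst σ t) := by
  rw [shift, psubst_rename, shift, rename_psubst]; rfl

@[simp] theorem rename_liftN_shift (t : Tm) (f : ℕ → ℕ) :
    rename (liftN f) (shift t) = shift (rename f t) := by
  rw [shift, rename_rename, shift, rename_rename]; rfl

theorem subst0_psubst_liftS (a t : Tm) (σ : ℕ → Tm) :
    subst0 a (psubst (liftS σ) t) = psubst (scons a σ) t := by
  rw [subst0_eq, psubst_psubst]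
  congr 1
  funext n
  cases n
  · rfl
  · exact (psubst_shift _ _ _).trans (psubst_var _)

theorem rename_subst0 (f : ℕ → ℕ) (u t : Tm) :
    rename f (subst0 u t) = subst0 (rename f u) (rename (liftN f) t) := by
  rw [subst0_eq, subst0_eq, rename_psubst, psubst_rename]
  congr 1
  funext n
  cases n <;> rfl

/-- The stoup variable does not occur free. -/
def SFree : Tm → Prop
  | .svar => False
  | .var _ | .unit | .cunit | .top | .llam _ _ => True
  | .vfst t | .vsnd t | .vlam _ t | .cfst t | .csnd t | .clam _ t | .bang t | .cimage _ t
  | .cinl t | .cinr t | .copowlet t _ | .ccase t _ _ => SFree t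
  | .vpair t u | .vapp t u | .cpair t u | .capp t u | .ilet t u | .banglet t u | .copow t u
  | .lapp t u => SFree t ∧ SFree u

theorem SFree.ssubst {t : Tm} (h : SFree t) (u : Tm) : ssubst u t = t := by
  induction t generalizing u <;> simp_all [SFree, Tm.ssubst]

theorem SFree.rename {t : Tm} (h : SFree t) (f : ℕ → ℕ) : SFree (rename f t) := by
  induction t generalizing f <;> simp_all [SFree, Tm.rename]

@[simp] theorem ssubst_svar (t : Tm) : ssubst .svar t = t := by
  have h : shift .svar = .svar := rfl
  induction t <;> simp_all [ssubst]

theorem rename_ssubst (f : ℕ → ℕ) (u t : Tm) :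
    rename f (ssubst u t) = ssubst (rename f u) (rename f t) := by
  induction t generalizing f u <;> simp [ssubst, rename, *]

theorem shift_ssubst (u t : Tm) : shift (ssubst u t) = ssubst (shift u) (shift t) :=
  rename_ssubst _ _ _

theorem ssubst_ssubst (u v t : Tm) : ssubst u (ssubst v t) = ssubst (ssubst u v) t := by
  induction t generalizing u v <;> simp [ssubst, *, shift_ssubst]

end Tm

theorem Deriv.sfree {Γ : List VType} {Δ : Option CType} {t : Tm} {A : VType}
    (d : Deriv Γ Δ t A) : Δ = none → t.SFree := by
  induction d <;> simp_all [Tm.SFree]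

namespace LTm

/-- Lift a parallel substitution under a binder. -/
def liftS (θ : ℕ → LTm) : ℕ → LTm
  | 0 => .var 0
  | n + 1 => shift (θ n)

/-- Extension of a parallel substitution by a term for the innermost variable. -/
def scons (V : LTm) (θ : ℕ → LTm) : ℕ → LTm
  | 0 => V
  | n + 1 => θ n

@[simp] theorem scons_zero (V : LTm) (θ : ℕ → LTm) : scons V θ 0 = V := rfl

@[simp] theorem scons_succ (V : LTm) (θ : ℕ → LTm) (n : ℕ) : scons V θ (n + 1) = θ n := rfl

theorem psubst_lam (θ : ℕ → LTm) (σ : STy) (M : LTm) :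
    psubst θ (.lam σ M) = .lam σ (psubst (liftS θ) M) := by
  rw [psubst]
  congr 2

theorem subst0_eq (V M : LTm) : subst0 V M = psubst (scons V .var) M := by
  unfold subst0
  congr 1

theorem rename_rename (M : LTm) (f g : ℕ → ℕ) : rename g (rename f M) = rename (g ∘ f) M := by
  induction M generalizing f g <;> simp [rename, *, Tm.liftN_comp]

theorem rename_id (M : LTm) : rename id M = M := by
  induction M <;> simp [rename, *, Tm.liftN_id]

theorem liftS_comp_liftN (f : ℕ → ℕ) (θ : ℕ → LTm) :
    liftS θ ∘ Tm.liftN f = liftS (θ ∘ f) := by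
  funext n; cases n <;> rfl

theorem psubst_rename (M : LTm) (f : ℕ → ℕ) (θ : ℕ → LTm) :
    psubst θ (rename f M) = psubst (θ ∘ f) M := by
  induction M generalizing f θ with
  | lam _ _ ih => rw [rename, psubst_lam, psubst_lam, ih, liftS_comp_liftN]
  | _ => simp [rename, psubst, *]

theorem rename_comp_liftS (f : ℕ → ℕ) (θ : ℕ → LTm) :
    rename (Tm.liftN f) ∘ liftS θ = liftS (rename f ∘ θ) := by
  funext n
  cases n
  · rfl
  · simp only [Function.comp, liftS, shift, rename_rename]
    congr 1

theorem rename_psubst (M : LTm) (f : ℕ → ℕ) (θ : ℕ → LTm) :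
    rename f (psubst θ M) = psubst (rename f ∘ θ) M := by
  induction M generalizing f θ with
  | lam _ _ ih => rw [psubst_lam, psubst_lam, rename, ih, rename_comp_liftS]
  | _ => simp [rename, psubst, *]

theorem psubst_comp_liftS (θ η : ℕ → LTm) :
    psubst (liftS η) ∘ liftS θ = liftS (psubst η ∘ θ) := by
  funext n
  cases n
  · rfl
  · simp only [Function.comp, liftS, shift, psubst_rename, rename_psubst]
    congr 1

theorem psubst_psubst (M : LTm) (θ η : ℕ → LTm) :
    psubst η (psubst θ M) = psubst (psubst η ∘ θ) M := by
  induction M generalizing θ η with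
  | lam _ _ ih => rw [psubst_lam, psubst_lam, psubst_lam, ih, psubst_comp_liftS]
  | _ => simp [psubst, *]

theorem liftS_var : liftS .var = .var := by
  funext n; cases n <;> rfl

@[simp] theorem psubst_var (M : LTm) : psubst .var M = M := by
  induction M with
  | lam _ _ ih => rw [psubst_lam, liftS_var, ih]
  | _ => simp [psubst, *]

@[simp] theorem psubst_shift (V M : LTm) (θ : ℕ → LTm) :
    psubst (scons V θ) (shift M) = psubst θ M := by
  rw [shift, psubst_rename]; rfl

@[simp] theorem rename_liftN_shift (M : LTm) (f : ℕ → ℕ) :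
    rename (Tm.liftN f) (shift M) = shift (rename f M) := by
  rw [shift, rename_rename, shift, rename_rename]; rfl

theorem subst0_psubst_liftS (V M : LTm) (θ : ℕ → LTm) :
    subst0 V (psubst (liftS θ) M) = psubst (scons V θ) M := by
  rw [subst0_eq, psubst_psubst]
  congr 1
  funext n
  cases n
  · rfl
  · exact (psubst_shift _ _ _).trans (psubst_var _)

theorem rename_subst0 (f : ℕ → ℕ) (V M : LTm) :
    rename f (subst0 V M) = subst0 (rename f V) (rename (Tm.liftN f) M) := by
  rw [subst0_eq, subst0_eq, rename_psubst, psubst_rename]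
  congr 1
  funext n
  cases n <;> rfl

end LTm

/-! ### A set-theoretic continuation model of EEC -/

/-- Answers of the continuation model: for each simple type and each context, a set of λ-terms. -/
abbrev Ans : Type := STy → List STy → Set LTm

mutual
  /-- Interpretation of types, with the answer type for computations as a parameter. -/
  def Mean : Type → VType → Type
    | _, .base _ => LTm
    | _, .unit => Unit
    | _, .prod A B => Mean Ans A × Mean Ans B
    | _, .arr A B => Mean Ans A → Mean Ans B
    | X, .comp A => Stk A → X
    | _, .lin A B => Stk B → Stk A
  /-- Interpretation of computation types as sets of stacks. -/
  def Stk : CType → Type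
    | .base _ => Empty
    | .cunit => Empty
    | .cand A B => Stk A ⊕ Stk B
    | .carr A B => Mean Ans A × Stk B
    | .iunit => Ans
    | .bang A => Mean Ans A → Ans
    | .copow A B => Mean Ans A → Stk B
    | .czero => Unit
    | .csum A B => Stk A × Stk B
end

/-- The answers of computations over a given stoup. -/
def SAns : Option CType → Type
  | none => Ans
  | some D => Stk D

/-- Environments interpreting a context. -/
def Env (Γ : List VType) : Type := ∀ (n : ℕ) (A : VType), Γ[n]? = some A → Mean Ans A

/-- Extension of an environment. -/
def Env.cons {Γ : List VType} {A : VType} (a : Mean Ans A) (ρ : Env Γ) : Env (A :: Γ)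
  | 0, _, h => Option.some.inj h ▸ a
  | n + 1, B, h => ρ n B h

/-- Interpretation of typing derivations in the continuation model. -/
def sem {Γ : List VType} {Δ : Option CType} {t : Tm} {A : VType} :
    Deriv Γ Δ t A → Env Γ → Mean (SAns Δ) A
  | .var _ n A h, ρ => ρ n A h
  | .svar _ _, _ => fun s => s
  | .unit _, _ => ()
  | .vpair _ _ _ _ _ d e, ρ => (sem d ρ, sem e ρ)
  | .vfst _ _ _ _ d, ρ => (sem d ρ).1
  | .vsnd _ _ _ _ d, ρ => (sem d ρ).2
  | .vlam _ _ _ _ d, ρ => fun a => sem d (ρ.cons a)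
  | .vapp _ _ _ _ _ d e, ρ => sem d ρ (sem e ρ)
  | .cunit _ _, _ => fun s => Empty.elim s
  | .cpair _ _ _ _ _ _ d e, ρ => fun s => Sum.elim (sem d ρ) (sem e ρ) s
  | .cfst _ _ _ _ _ d, ρ => fun s => sem d ρ (.inl s)
  | .csnd _ _ _ _ _ d, ρ => fun s => sem d ρ (.inr s)
  | .clam _ _ _ _ _ d, ρ => fun s => sem d (ρ.cons s.1) s.2
  | .capp _ _ _ _ _ _ d e, ρ => fun s => sem d ρ (sem e ρ, s)
  | .top _, _ => fun s => s
  | .ilet _ _ _ _ _ d e, ρ => fun s => sem d ρ (sem e ρ s)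
  | .bang _ _ _ d, ρ => fun k => k (sem d ρ)
  | .banglet _ _ _ _ _ _ d e, ρ => fun s => sem d ρ (fun a => sem e (ρ.cons a) s)
  | .copow _ _ _ _ _ _ d e, ρ => fun k => sem e ρ (k (sem d ρ))
  | .copowlet _ _ _ _ _ _ _ d e, ρ => fun s => sem d ρ (fun a => sem e (ρ.cons a) s)
  | .cimage _ _ _ _ d, ρ => fun _ => sem d ρ ()
  | .cinl _ _ _ _ _ d, ρ => fun s => sem d ρ s.1
  | .cinr _ _ _ _ _ d, ρ => fun s => sem d ρ s.2
  | .ccase _ _ _ _ _ _ _ _ d e f, ρ => fun s => sem d ρ (sem e ρ s, sem f ρ s)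
  | .llam _ _ _ _ d, ρ => fun s => sem d ρ s
  | .lapp _ _ _ _ _ _ d e, ρ => fun s => sem e ρ (sem d ρ s)

/-- Restriction of an environment along a renaming. -/
def Env.rename {Γ Γ' : List VType} (ρ : Env Γ') (f : ℕ → ℕ)
    (hf : ∀ n A, Γ[n]? = some A → Γ'[f n]? = some A) : Env Γ :=
  fun n A h => ρ (f n) A (hf n A h)

theorem liftN_typed {X : Type} {Γ Γ' : List X} {f : ℕ → ℕ} (B : X)
    (hf : ∀ n A, Γ[n]? = some A → Γ'[f n]? = some A) :
    ∀ n A, (B :: Γ)[n]? = some A → (B :: Γ')[Tm.liftN f n]? = some A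
  | 0, _, h => h
  | n + 1, A, h => hf n A h

theorem Env.cons_rename {Γ Γ' : List VType} {B : VType} (ρ : Env Γ') (b : Mean Ans B) (f : ℕ → ℕ)
    (hf : ∀ n A, Γ[n]? = some A → Γ'[f n]? = some A) :
    (ρ.cons b).rename (Tm.liftN f) (liftN_typed B hf) = (ρ.rename f hf).cons b := by
  funext n A h
  cases n <;> rfl

/-- Typing and interpretation of a renamed term. -/
theorem Deriv.exists_rename {Γ : List VType} {Δ : Option CType} {t : Tm} {A : VType}
    (d : Deriv Γ Δ t A) : ∀ {Γ' : List VType} (f : ℕ → ℕ)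
    (hf : ∀ n A, Γ[n]? = some A → Γ'[f n]? = some A),
    ∃ d' : Deriv Γ' Δ (t.rename f) A, ∀ ρ, sem d' ρ = sem d (ρ.rename f hf) := by
  induction d with
  | var _ n A h => exact fun f hf => ⟨.var _ _ _ (hf n A h), fun ρ => rfl⟩
  | svar => exact fun f hf => ⟨.svar _ _, fun ρ => rfl⟩
  | unit => exact fun f hf => ⟨.unit _, fun ρ => rfl⟩
  | cunit => exact fun f hf => ⟨.cunit _ _, fun ρ => rfl⟩
  | top => exact fun f hf => ⟨.top _, fun ρ => rfl⟩
  | vpair _ _ _ _ _ _ _ ih ih' =>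
    intro Γ' f hf
    obtain ⟨d, hd⟩ := ih f hf
    obtain ⟨e, he⟩ := ih' f hf
    exact ⟨.vpair _ _ _ _ _ d e, fun ρ => by simp only [sem, hd, he]; rfl⟩
  | vfst _ _ _ _ _ ih =>
    intro Γ' f hf
    obtain ⟨d, hd⟩ := ih f hf
    exact ⟨.vfst _ _ _ _ d, fun ρ => by simp only [sem, hd]; rfl⟩
  | vsnd _ _ _ _ _ ih =>
    intro Γ' f hf
    obtain ⟨d, hd⟩ := ih f hf
    exact ⟨.vsnd _ _ _ _ d, fun ρ => by simp only [sem, hd]; rfl⟩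
  | vlam _ _ A _ _ ih =>
    intro Γ' f hf
    obtain ⟨d, hd⟩ := ih _ (liftN_typed A hf)
    exact ⟨.vlam _ _ _ _ d, fun ρ => funext fun a => (hd _).trans (congrArg (sem _) (Env.cons_rename ρ a f hf))⟩
  | vapp _ _ _ _ _ _ _ ih ih' =>
    intro Γ' f hf
    obtain ⟨d, hd⟩ := ih f hf
    obtain ⟨e, he⟩ := ih' f hf
    exact ⟨.vapp _ _ _ _ _ d e, fun ρ => by simp only [sem, hd, he]; rfl⟩
  | cpair _ _ _ _ _ _ _ _ ih ih' =>
    intro Γ' f hf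
    obtain ⟨d, hd⟩ := ih f hf
    obtain ⟨e, he⟩ := ih' f hf
    exact ⟨.cpair _ _ _ _ _ _ d e, fun ρ => by simp only [sem, hd, he]; rfl⟩
  | cfst _ _ _ _ _ _ ih =>
    intro Γ' f hf
    obtain ⟨d, hd⟩ := ih f hf
    exact ⟨.cfst _ _ _ _ _ d, fun ρ => by simp only [sem, hd]; rfl⟩
  | csnd _ _ _ _ _ _ ih =>
    intro Γ' f hf
    obtain ⟨d, hd⟩ := ih f hf
    exact ⟨.csnd _ _ _ _ _ d, fun ρ => by simp only [sem, hd]; rfl⟩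
  | clam _ _ _ A _ _ ih =>
    intro Γ' f hf
    obtain ⟨d, hd⟩ := ih _ (liftN_typed A hf)
    exact ⟨.clam _ _ _ _ _ d, fun ρ => funext fun s =>
      congrFun ((hd _).trans (congrArg (sem _) (Env.cons_rename ρ s.1 f hf))) s.2⟩
  | capp _ _ _ _ _ _ _ _ ih ih' =>
    intro Γ' f hf
    obtain ⟨d, hd⟩ := ih f hf
    obtain ⟨e, he⟩ := ih' f hf
    exact ⟨.capp _ _ _ _ _ _ d e, fun ρ => by simp only [sem, hd]; rw [he]⟩
  | ilet _ _ _ _ _ _ _ ih ih' =>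
    intro Γ' f hf
    obtain ⟨d, hd⟩ := ih f hf
    obtain ⟨e, he⟩ := ih' f hf
    exact ⟨.ilet _ _ _ _ _ d e, fun ρ => by simp only [sem, hd, he]; rfl⟩
  | bang _ _ _ _ ih =>
    intro Γ' f hf
    obtain ⟨d, hd⟩ := ih f hf
    exact ⟨.bang _ _ _ d, fun ρ => by simp only [sem, hd]; rfl⟩
  | banglet _ _ _ _ A _ _ _ ih ih' =>
    intro Γ' f hf
    obtain ⟨d, hd⟩ := ih f hf
    obtain ⟨e, he⟩ := ih' _ (liftN_typed A hf)
    exact ⟨.banglet _ _ _ _ _ _ d e, fun ρ => by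
      have he' := fun a => (he (ρ.cons a)).trans (congrArg (sem _) (Env.cons_rename ρ a f hf))
      simp only [sem, hd, he']; rfl⟩
  | copow _ _ _ _ _ _ _ _ ih ih' =>
    intro Γ' f hf
    obtain ⟨d, hd⟩ := ih f hf
    obtain ⟨e, he⟩ := ih' f hf
    exact ⟨.copow _ _ _ _ _ _ d e, fun ρ => by simp only [sem, hd, he]; rfl⟩
  | copowlet _ _ _ _ A _ _ _ _ ih ih' =>
    intro Γ' f hf
    obtain ⟨d, hd⟩ := ih f hf
    obtain ⟨e, he⟩ := ih' _ (liftN_typed A hf)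
    exact ⟨.copowlet _ _ _ _ _ _ _ d e, fun ρ => by
      have he' := fun a => (he (ρ.cons a)).trans (congrArg (sem _) (Env.cons_rename ρ a f hf))
      simp only [sem, hd, he']; rfl⟩
  | cimage _ _ _ _ _ ih =>
    intro Γ' f hf
    obtain ⟨d, hd⟩ := ih f hf
    exact ⟨.cimage _ _ _ _ d, fun ρ => by simp only [sem, hd]; rfl⟩
  | cinl _ _ _ _ _ _ ih =>
    intro Γ' f hf
    obtain ⟨d, hd⟩ := ih f hf
    exact ⟨.cinl _ _ _ _ _ d, fun ρ => by simp only [sem, hd]; rfl⟩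
  | cinr _ _ _ _ _ _ ih =>
    intro Γ' f hf
    obtain ⟨d, hd⟩ := ih f hf
    exact ⟨.cinr _ _ _ _ _ d, fun ρ => by simp only [sem, hd]; rfl⟩
  | ccase _ _ _ _ _ _ _ _ _ _ _ ih ih' ih'' =>
    intro Γ' f hf
    obtain ⟨d, hd⟩ := ih f hf
    obtain ⟨e, he⟩ := ih' f hf
    obtain ⟨g, hg⟩ := ih'' f hf
    exact ⟨.ccase _ _ _ _ _ _ _ _ d e g, fun ρ => by simp only [sem, hd, he, hg]; rfl⟩
  | llam _ _ _ _ _ ih =>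
    intro Γ' f hf
    obtain ⟨d, hd⟩ := ih f hf
    exact ⟨.llam _ _ _ _ d, fun ρ => by simp only [sem, hd]; rfl⟩
  | lapp _ _ _ _ _ _ _ _ ih ih' =>
    intro Γ' f hf
    obtain ⟨d, hd⟩ := ih f hf
    obtain ⟨e, he⟩ := ih' f hf
    exact ⟨.lapp _ _ _ _ _ _ d e, fun ρ => by simp only [sem, hd, he]; rfl⟩

/-- The environment denoted by a substitution. -/
def Env.psubst {Γ Γ' : List VType} {σ : ℕ → Tm}
    (hσ : ∀ n A, Γ[n]? = some A → Deriv Γ' none (σ n) A) (ρ : Env Γ') : Env Γ :=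
  fun n A h => sem (hσ n A h) ρ

theorem exists_liftS {Γ Γ' : List VType} {σ : ℕ → Tm} (B : VType)
    (hσ : ∀ n A, Γ[n]? = some A → Deriv Γ' none (σ n) A) :
    ∃ hσ' : ∀ n A, (B :: Γ)[n]? = some A → Deriv (B :: Γ') none (Tm.liftS σ n) A,
      ∀ (ρ : Env Γ') (b : Mean Ans B),
        Env.psubst hσ' (ρ.cons b) = (Env.psubst hσ ρ).cons b := by
  have hs : ∀ n A, ∀ h : Γ[n]? = some A, ∃ d : Deriv (B :: Γ') none (Tm.shift (σ n)) A,
      ∀ (ρ : Env Γ') (b : Mean Ans B), sem d (ρ.cons b) = sem (hσ n A h) ρ := by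
    intro n A h
    obtain ⟨d, hd⟩ := (hσ n A h).exists_rename (Γ' := B :: Γ') Nat.succ (fun _ _ h => h)
    exact ⟨d, fun ρ b => hd _⟩
  choose e he using hs
  refine ⟨fun n => match n with
    | 0 => fun A h => .var _ 0 A h
    | n + 1 => fun A h => e n A h, fun ρ b => ?_⟩
  funext n A h
  cases n with
  | zero => rfl
  | succ n => exact he n A h ρ b

/-- Typing and interpretation of a substituted term. -/
theorem Deriv.exists_psubst {Γ : List VType} {Δ : Option CType} {t : Tm} {A : VType}
    (d : Deriv Γ Δ t A) : ∀ {Γ' : List VType} (f : ℕ → Tm)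
    (hf : ∀ n A, Γ[n]? = some A → Deriv Γ' none (f n) A),
    ∃ d' : Deriv Γ' Δ (t.psubst f) A, ∀ ρ, sem d' ρ = sem d (Env.psubst hf ρ) := by
  induction d with
  | var _ n A h => exact fun f hf => ⟨hf n A h, fun ρ => rfl⟩
  | svar => exact fun f hf => ⟨.svar _ _, fun ρ => rfl⟩
  | unit => exact fun f hf => ⟨.unit _, fun ρ => rfl⟩
  | cunit => exact fun f hf => ⟨.cunit _ _, fun ρ => rfl⟩
  | top => exact fun f hf => ⟨.top _, fun ρ => rfl⟩
  | vpair _ _ _ _ _ _ _ ih ih' =>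
    intro Γ' f hf
    obtain ⟨d, hd⟩ := ih f hf
    obtain ⟨e, he⟩ := ih' f hf
    exact ⟨.vpair _ _ _ _ _ d e, fun ρ => by simp only [sem, hd, he]; rfl⟩
  | vfst _ _ _ _ _ ih =>
    intro Γ' f hf
    obtain ⟨d, hd⟩ := ih f hf
    exact ⟨.vfst _ _ _ _ d, fun ρ => by simp only [sem, hd]; rfl⟩
  | vsnd _ _ _ _ _ ih =>
    intro Γ' f hf
    obtain ⟨d, hd⟩ := ih f hf
    exact ⟨.vsnd _ _ _ _ d, fun ρ => by simp only [sem, hd]; rfl⟩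
  | vlam _ _ A _ _ ih =>
    intro Γ' f hf
    obtain ⟨hg, hl⟩ := exists_liftS A hf
    obtain ⟨d, hd⟩ := ih _ hg
    exact ⟨.vlam _ _ _ _ d, fun ρ => funext fun a => (hd _).trans (congrArg (sem _) (hl ρ a))⟩
  | vapp _ _ _ _ _ _ _ ih ih' =>
    intro Γ' f hf
    obtain ⟨d, hd⟩ := ih f hf
    obtain ⟨e, he⟩ := ih' f hf
    exact ⟨.vapp _ _ _ _ _ d e, fun ρ => by simp only [sem, hd, he]; rfl⟩
  | cpair _ _ _ _ _ _ _ _ ih ih' =>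
    intro Γ' f hf
    obtain ⟨d, hd⟩ := ih f hf
    obtain ⟨e, he⟩ := ih' f hf
    exact ⟨.cpair _ _ _ _ _ _ d e, fun ρ => by simp only [sem, hd, he]; rfl⟩
  | cfst _ _ _ _ _ _ ih =>
    intro Γ' f hf
    obtain ⟨d, hd⟩ := ih f hf
    exact ⟨.cfst _ _ _ _ _ d, fun ρ => by simp only [sem, hd]; rfl⟩
  | csnd _ _ _ _ _ _ ih =>
    intro Γ' f hf
    obtain ⟨d, hd⟩ := ih f hf
    exact ⟨.csnd _ _ _ _ _ d, fun ρ => by simp only [sem, hd]; rfl⟩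
  | clam _ _ _ A _ _ ih =>
    intro Γ' f hf
    obtain ⟨hg, hl⟩ := exists_liftS A hf
    obtain ⟨d, hd⟩ := ih _ hg
    exact ⟨.clam _ _ _ _ _ d, fun ρ => funext fun s =>
      congrFun ((hd _).trans (congrArg (sem _) (hl ρ s.1))) s.2⟩
  | capp _ _ _ _ _ _ _ _ ih ih' =>
    intro Γ' f hf
    obtain ⟨d, hd⟩ := ih f hf
    obtain ⟨e, he⟩ := ih' f hf
    exact ⟨.capp _ _ _ _ _ _ d e, fun ρ => by simp only [sem, hd]; rw [he]⟩
  | ilet _ _ _ _ _ _ _ ih ih' =>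
    intro Γ' f hf
    obtain ⟨d, hd⟩ := ih f hf
    obtain ⟨e, he⟩ := ih' f hf
    exact ⟨.ilet _ _ _ _ _ d e, fun ρ => by simp only [sem, hd, he]; rfl⟩
  | bang _ _ _ _ ih =>
    intro Γ' f hf
    obtain ⟨d, hd⟩ := ih f hf
    exact ⟨.bang _ _ _ d, fun ρ => by simp only [sem, hd]; rfl⟩
  | banglet _ _ _ _ A _ _ _ ih ih' =>
    intro Γ' f hf
    obtain ⟨d, hd⟩ := ih f hf
    obtain ⟨hg, hl⟩ := exists_liftS A hf
    obtain ⟨e, he⟩ := ih' _ hg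
    exact ⟨.banglet _ _ _ _ _ _ d e, fun ρ => by
      have he' := fun a => (he (ρ.cons a)).trans (congrArg (sem _) (hl ρ a))
      simp only [sem, hd, he']; rfl⟩
  | copow _ _ _ _ _ _ _ _ ih ih' =>
    intro Γ' f hf
    obtain ⟨d, hd⟩ := ih f hf
    obtain ⟨e, he⟩ := ih' f hf
    exact ⟨.copow _ _ _ _ _ _ d e, fun ρ => by simp only [sem, hd, he]; rfl⟩
  | copowlet _ _ _ _ A _ _ _ _ ih ih' =>
    intro Γ' f hf
    obtain ⟨d, hd⟩ := ih f hf
    obtain ⟨hg, hl⟩ := exists_liftS A hf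
    obtain ⟨e, he⟩ := ih' _ hg
    exact ⟨.copowlet _ _ _ _ _ _ _ d e, fun ρ => by
      have he' := fun a => (he (ρ.cons a)).trans (congrArg (sem _) (hl ρ a))
      simp only [sem, hd, he']; rfl⟩
  | cimage _ _ _ _ _ ih =>
    intro Γ' f hf
    obtain ⟨d, hd⟩ := ih f hf
    exact ⟨.cimage _ _ _ _ d, fun ρ => by simp only [sem, hd]; rfl⟩
  | cinl _ _ _ _ _ _ ih =>
    intro Γ' f hf
    obtain ⟨d, hd⟩ := ih f hf
    exact ⟨.cinl _ _ _ _ _ d, fun ρ => by simp only [sem, hd]; rfl⟩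
  | cinr _ _ _ _ _ _ ih =>
    intro Γ' f hf
    obtain ⟨d, hd⟩ := ih f hf
    exact ⟨.cinr _ _ _ _ _ d, fun ρ => by simp only [sem, hd]; rfl⟩
  | ccase _ _ _ _ _ _ _ _ _ _ _ ih ih' ih'' =>
    intro Γ' f hf
    obtain ⟨d, hd⟩ := ih f hf
    obtain ⟨e, he⟩ := ih' f hf
    obtain ⟨g, hg⟩ := ih'' f hf
    exact ⟨.ccase _ _ _ _ _ _ _ _ d e g, fun ρ => by simp only [sem, hd, he, hg]; rfl⟩
  | llam _ _ _ _ _ ih =>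
    intro Γ' f hf
    obtain ⟨d, hd⟩ := ih f hf
    exact ⟨.llam _ _ _ _ d, fun ρ => by simp only [sem, hd]; rfl⟩
  | lapp _ _ _ _ _ _ _ _ ih ih' =>
    intro Γ' f hf
    obtain ⟨d, hd⟩ := ih f hf
    obtain ⟨e, he⟩ := ih' f hf
    exact ⟨.lapp _ _ _ _ _ _ d e, fun ρ => by simp only [sem, hd, he]; rfl⟩

/-- Postcomposition of a meaning with a map of answers. -/
def Mean.map {X Y : Type} (g : X → Y) : ∀ {A : VType}, Mean X A → Mean Y A
  | .base _, v => v
  | .unit, v => v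
  | .prod _ _, v => v
  | .arr _ _, v => v
  | .comp _, v => fun s => g (v s)
  | .lin _ _, v => v

/-- Derivations of a term that may be substituted for the stoup variable. -/
def StoupD (Γ : List VType) (Δ : Option CType) (u : Tm) : Option CType → Type
  | none => Empty
  | some D => Deriv Γ Δ u (.comp D)

/-- Interpretation of a stoup substitution. -/
def StoupD.sem {Γ : List VType} {Δ : Option CType} {u : Tm} :
    ∀ {Δ₀ : Option CType}, StoupD Γ Δ u Δ₀ → Env Γ → SAns Δ₀ → SAns Δ
  | none, e, _ => Empty.elim e
  | some _, e, ρ => EEC.sem e ρ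

theorem StoupD.exists_shift {Γ : List VType} {Δ Δ₀ : Option CType} {u : Tm}
    (e : StoupD Γ Δ u Δ₀) (B : VType) :
    ∃ e' : StoupD (B :: Γ) Δ (Tm.shift u) Δ₀,
      ∀ (ρ : Env Γ) (b : Mean Ans B), e'.sem (ρ.cons b) = e.sem ρ := by
  cases Δ₀ with
  | none => exact e.elim
  | some D =>
    obtain ⟨d, hd⟩ := Deriv.exists_rename e (Γ' := B :: Γ) Nat.succ (fun _ _ h => h)
    exact ⟨d, fun ρ b => hd _⟩

/-- Typing and interpretation of substitution for the stoup variable. -/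
theorem Deriv.exists_stoup {Γ : List VType} {Δ₀ : Option CType} {t : Tm} {A : VType}
    (d : Deriv Γ Δ₀ t A) : ∀ {Δ : Option CType} {u : Tm} (e : StoupD Γ Δ u Δ₀),
    ∃ d' : Deriv Γ Δ (Tm.ssubst u t) A, ∀ ρ, sem d' ρ = Mean.map (e.sem ρ) (sem d ρ) := by
  induction d with
  | var => exact fun e => e.elim
  | svar => exact fun e => ⟨e, fun ρ => rfl⟩
  | unit => exact fun e => e.elim
  | vpair => exact fun e => e.elim
  | vfst => exact fun e => e.elim
  | vsnd => exact fun e => e.elim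
  | vlam => exact fun e => e.elim
  | vapp => exact fun e => e.elim
  | top => exact fun e => e.elim
  | bang => exact fun e => e.elim
  | llam => exact fun e => e.elim
  | cunit => exact fun e => ⟨.cunit _ _, fun ρ => funext fun s => Empty.elim s⟩
  | cpair _ _ _ _ _ _ _ _ ih ih' =>
    intro Δ u e
    obtain ⟨d, hd⟩ := ih e
    obtain ⟨f, hf⟩ := ih' e
    refine ⟨.cpair _ _ _ _ _ _ d f, fun ρ => ?_⟩
    funext s
    simp only [sem, hd, hf]
    cases s <;> rfl
  | cfst _ _ _ _ _ _ ih =>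
    intro Δ u e
    obtain ⟨d, hd⟩ := ih e
    exact ⟨.cfst _ _ _ _ _ d, fun ρ => by simp only [sem, hd]; rfl⟩
  | csnd _ _ _ _ _ _ ih =>
    intro Δ u e
    obtain ⟨d, hd⟩ := ih e
    exact ⟨.csnd _ _ _ _ _ d, fun ρ => by simp only [sem, hd]; rfl⟩
  | clam _ _ _ A _ _ ih =>
    intro Δ u e
    obtain ⟨e', he⟩ := e.exists_shift A
    obtain ⟨d, hd⟩ := ih e'
    refine ⟨.clam _ _ _ _ _ d, fun ρ => ?_⟩
    funext s
    exact (congrFun (hd _) s.2).trans (congrFun (he ρ s.1) _)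
  | capp _ _ _ _ _ _ _ f ih _ =>
    intro Δ u e
    obtain ⟨d, hd⟩ := ih e
    rw [Tm.ssubst, (f.sfree rfl).ssubst]
    exact ⟨.capp _ _ _ _ _ _ d f, fun ρ => by simp only [sem, hd]; rfl⟩
  | ilet _ _ _ _ _ _ f ih _ =>
    intro Δ u e
    obtain ⟨d, hd⟩ := ih e
    rw [Tm.ssubst, (f.sfree rfl).ssubst]
    refine ⟨.ilet _ _ _ _ _ d f, fun ρ => by simp only [sem, hd]; rfl⟩
  | banglet _ _ _ _ A _ _ f ih _ =>
    intro Δ u e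
    obtain ⟨d, hd⟩ := ih e
    rw [Tm.ssubst, (f.sfree rfl).ssubst]
    exact ⟨.banglet _ _ _ _ _ _ d f, fun ρ => by simp only [sem, hd]; rfl⟩
  | copow _ _ _ _ _ _ f _ _ ih =>
    intro Δ u e
    obtain ⟨d, hd⟩ := ih e
    rw [Tm.ssubst, (f.sfree rfl).ssubst]
    exact ⟨.copow _ _ _ _ _ _ f d, fun ρ => by simp only [sem, hd]; rfl⟩
  | copowlet _ _ _ _ A _ _ _ f ih _ =>
    intro Δ u e
    obtain ⟨d, hd⟩ := ih e
    exact ⟨.copowlet _ _ _ _ _ _ _ d f, fun ρ => by simp only [sem, hd]; rfl⟩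
  | cimage _ _ _ _ _ ih =>
    intro Δ u e
    obtain ⟨d, hd⟩ := ih e
    exact ⟨.cimage _ _ _ _ d, fun ρ => by simp only [sem, hd]; rfl⟩
  | cinl _ _ _ _ _ _ ih =>
    intro Δ u e
    obtain ⟨d, hd⟩ := ih e
    exact ⟨.cinl _ _ _ _ _ d, fun ρ => by simp only [sem, hd]; rfl⟩
  | cinr _ _ _ _ _ _ ih =>
    intro Δ u e
    obtain ⟨d, hd⟩ := ih e
    exact ⟨.cinr _ _ _ _ _ d, fun ρ => by simp only [sem, hd]; rfl⟩
  | ccase _ _ _ _ _ _ _ _ _ f g ih _ _ =>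
    intro Δ u e
    obtain ⟨d, hd⟩ := ih e
    exact ⟨.ccase _ _ _ _ _ _ _ _ d f g, fun ρ => by simp only [sem, hd]; rfl⟩
  | lapp _ _ _ _ _ _ f _ _ ih =>
    intro Δ u e
    obtain ⟨d, hd⟩ := ih e
    rw [Tm.ssubst, (f.sfree rfl).ssubst]
    exact ⟨.lapp _ _ _ _ _ _ f d, fun ρ => by simp only [sem, hd]; rfl⟩

theorem Deriv.exists_ssubst {Γ : List VType} {Δ : Option CType} {t u : Tm} {A B : CType}
    (d : Deriv Γ (some A) t (.comp B)) (e : Deriv Γ Δ u (.comp A)) :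
    ∃ d' : Deriv Γ Δ (Tm.ssubst u t) (.comp B),
      ∀ (ρ : Env Γ) (s : Stk B), sem d' ρ s = sem e ρ (sem d ρ s) := by
  obtain ⟨d', h⟩ := d.exists_stoup (Δ := Δ) (u := u) e
  exact ⟨d', fun ρ s => congrFun (h ρ) s⟩

theorem Deriv.exists_shift {Γ : List VType} {Δ : Option CType} {t : Tm} {A : VType}
    (d : Deriv Γ Δ t A) (B : VType) :
    ∃ d' : Deriv (B :: Γ) Δ (Tm.shift t) A,
      ∀ (ρ : Env Γ) (b : Mean Ans B), sem d' (ρ.cons b) = sem d ρ := by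
  obtain ⟨d', h⟩ := d.exists_rename (Γ' := B :: Γ) Nat.succ (fun _ _ h => h)
  exact ⟨d', fun ρ b => h _⟩

theorem Deriv.exists_subst0 {Γ : List VType} {Δ : Option CType} {t u : Tm} {A B : VType}
    (d : Deriv (A :: Γ) Δ t B) (e : Deriv Γ none u A) :
    ∃ d' : Deriv Γ Δ (Tm.subst0 u t) B, ∀ ρ : Env Γ, sem d' ρ = sem d (ρ.cons (sem e ρ)) := by
  obtain ⟨d', h⟩ := d.exists_psubst (Γ' := Γ) (Tm.scons u .var)
    (fun n => match n with
      | 0 => fun A h => Option.some.inj h ▸ e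
      | n + 1 => fun A h => .var _ n A h)
  rw [Tm.subst0_eq]
  refine ⟨d', fun ρ => (h ρ).trans (congrArg _ ?_)⟩
  funext n B h
  cases n with
  | zero => obtain rfl := Option.some.inj h; rfl
  | succ n => rfl

mutual
  /-- Heterogeneous logical relation between meanings, vacuous at types of different shapes. -/
  def MRel : ∀ Δ Δ' : Option CType, (SAns Δ → SAns Δ' → Prop) →
      ∀ A A' : VType, Mean (SAns Δ) A → Mean (SAns Δ') A' → Prop
    | _, _, _, .base _ => fun A' v => match A' with
      | .base _ => fun v' => v = v'
      | _ => fun _ => True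
    | _, _, _, .unit => fun _ _ _ => True
    | _, _, _, .prod A B => fun A' v => match A' with
      | .prod A' B' => fun v' => MRel none none Eq A A' v.1 v'.1 ∧ MRel none none Eq B B' v.2 v'.2
      | _ => fun _ => True
    | _, _, _, .arr A B => fun A' v => match A' with
      | .arr A' B' => fun v' =>
        ∀ a a', MRel none none Eq A A' a a' → MRel none none Eq B B' (v a) (v' a')
      | _ => fun _ => True
    | _, _, r, .comp A => fun A' v => match A' with
      | .comp A' => fun v' => ∀ s s', SRel A A' s s' → r (v s) (v' s')
      | _ => fun _ => True
    | _, _, _, .lin A B => fun A' v => match A' with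
      | .lin A' B' => fun v' => ∀ s s', SRel B B' s s' → SRel A A' (v s) (v' s')
      | _ => fun _ => True
  termination_by structural _ _ _ A => A
  /-- Heterogeneous logical relation between stacks, vacuous at types of different shapes. -/
  def SRel : ∀ A A' : CType, Stk A → Stk A' → Prop
    | .base _ => fun _ _ _ => True
    | .cunit => fun _ _ _ => True
    | .cand A B => fun A' s => match A' with
      | .cand A' B' => fun s' => match s, s' with
        | .inl s, .inl s' => SRel A A' s s'
        | .inr s, .inr s' => SRel B B' s s'
        | .inl _, .inr _ => False
        | .inr _, .inl _ => False
      | _ => fun _ => True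
    | .carr A B => fun A' s => match A' with
      | .carr A' B' => fun s' => MRel none none Eq A A' s.1 s'.1 ∧ SRel B B' s.2 s'.2
      | _ => fun _ => True
    | .iunit => fun A' s => match A' with
      | .iunit => fun s' => s = s'
      | _ => fun _ => True
    | .bang A => fun A' k => match A' with
      | .bang A' => fun k' => ∀ a a', MRel none none Eq A A' a a' → k a = k' a'
      | _ => fun _ => True
    | .copow A B => fun A' k => match A' with
      | .copow A' B' => fun k' => ∀ a a', MRel none none Eq A A' a a' → SRel B B' (k a) (k' a')
      | _ => fun _ => True
    | .czero => fun _ _ _ => True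
    | .csum A B => fun A' s => match A' with
      | .csum A' B' => fun s' => SRel A A' s.1 s'.1 ∧ SRel B B' s.2 s'.2
      | _ => fun _ => True
  termination_by structural A => A
end

/-- The induced relation between answers. -/
def ARel : ∀ Δ Δ' : Option CType, SAns Δ → SAns Δ' → Prop
  | none, none => Eq
  | some D, some D' => SRel D D'
  | _, _ => fun _ _ => True

/-- The induced relation between environments. -/
def ERel {Γ Γ' : List VType} (ρ : Env Γ) (ρ' : Env Γ') : Prop :=
  ∀ n A A' h h', MRel none none Eq A A' (ρ n A h) (ρ' n A' h')

theorem ERel.cons {Γ Γ' : List VType} {ρ : Env Γ} {ρ' : Env Γ'} (h : ERel ρ ρ') {A A' : VType}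
    {a : Mean Ans A} {a' : Mean Ans A'} (ha : MRel none none Eq A A' a a') :
    ERel (ρ.cons a) (ρ'.cons a') := by
  intro n B B' hB hB'
  cases n with
  | zero =>
    obtain rfl := Option.some.inj hB
    obtain rfl := Option.some.inj hB'
    exact ha
  | succ n => exact h n B B' hB hB'

theorem Deriv.mrel {Γ : List VType} {Δ : Option CType} {t : Tm} {A : VType} (d : Deriv Γ Δ t A) :
    ∀ {Γ' : List VType} {Δ' : Option CType} {A' : VType} (d' : Deriv Γ' Δ' t A') {ρ : Env Γ}
      {ρ' : Env Γ'}, ERel ρ ρ' → MRel Δ Δ' (ARel Δ Δ') A A' (sem d ρ) (sem d' ρ') := by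
  induction d with
  | var _ n A h =>
    intro Γ' Δ' A' d' ρ ρ' hρ
    cases d' with | var _ _ _ h' => exact hρ n _ _ h h'
  | svar =>
    intro Γ' Δ' A' d' ρ ρ' hρ
    cases d' with | svar => exact fun s s' hs => hs
  | unit =>
    intro Γ' Δ' A' d' ρ ρ' hρ
    cases d' with | unit => exact trivial
  | vpair _ _ _ _ _ _ _ ih ih' =>
    intro Γ' Δ' A' d' ρ ρ' hρ
    cases d' with | vpair _ _ _ _ _ d e => exact ⟨ih d hρ, ih' e hρ⟩
  | vfst _ _ _ _ _ ih =>
    intro Γ' Δ' A' d' ρ ρ' hρ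
    cases d' with | vfst _ _ _ _ d => exact (ih d hρ).1
  | vsnd _ _ _ _ _ ih =>
    intro Γ' Δ' A' d' ρ ρ' hρ
    cases d' with | vsnd _ _ _ _ d => exact (ih d hρ).2
  | vlam _ _ _ _ _ ih =>
    intro Γ' Δ' A' d' ρ ρ' hρ
    cases d' with | vlam _ _ _ _ d => exact fun a a' ha => ih d (hρ.cons ha)
  | vapp _ _ _ _ _ _ _ ih ih' =>
    intro Γ' Δ' A' d' ρ ρ' hρ
    cases d' with | vapp _ _ _ _ _ d e => exact ih d hρ _ _ (ih' e hρ)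
  | cunit =>
    intro Γ' Δ' A' d' ρ ρ' hρ
    cases d' with | cunit => exact fun s => Empty.elim s
  | cpair _ _ _ _ _ _ _ _ ih ih' =>
    intro Γ' Δ' A' d' ρ ρ' hρ
    cases d' with
    | cpair _ _ _ _ _ _ d e =>
      intro s s' hs
      match s, s', hs with
      | .inl s, .inl s', hs => exact ih d hρ s s' hs
      | .inr s, .inr s', hs => exact ih' e hρ s s' hs
  | cfst _ _ _ _ _ _ ih =>
    intro Γ' Δ' A' d' ρ ρ' hρ
    cases d' with | cfst _ _ _ _ _ d => exact fun s s' hs => ih d hρ (.inl s) (.inl s') hs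
  | csnd _ _ _ _ _ _ ih =>
    intro Γ' Δ' A' d' ρ ρ' hρ
    cases d' with | csnd _ _ _ _ _ d => exact fun s s' hs => ih d hρ (.inr s) (.inr s') hs
  | clam _ _ _ _ _ _ ih =>
    intro Γ' Δ' A' d' ρ ρ' hρ
    cases d' with | clam _ _ _ _ _ d => exact fun s s' hs => ih d (hρ.cons hs.1) _ _ hs.2
  | capp _ _ _ _ _ _ _ _ ih ih' =>
    intro Γ' Δ' A' d' ρ ρ' hρ
    cases d' with
    | capp _ _ _ _ _ _ d e => exact fun s s' hs => ih d hρ (_, s) (_, s') ⟨ih' e hρ, hs⟩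
  | top =>
    intro Γ' Δ' A' d' ρ ρ' hρ
    cases d' with | top => exact fun s s' hs => hs
  | ilet _ _ _ _ _ _ _ ih ih' =>
    intro Γ' Δ' A' d' ρ ρ' hρ
    cases d' with | ilet _ _ _ _ _ d e => exact fun s s' hs => ih d hρ _ _ (ih' e hρ s s' hs)
  | bang _ _ _ _ ih =>
    intro Γ' Δ' A' d' ρ ρ' hρ
    cases d' with | bang _ _ _ d => exact fun k k' hk => hk _ _ (ih d hρ)
  | banglet _ _ _ _ _ _ _ f ih ih' =>
    intro Γ' Δ' A' d' ρ ρ' hρ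
    cases d' with
    | banglet _ _ _ _ _ _ d e =>
      exact fun s s' hs => ih d hρ (fun a => sem f (ρ.cons a) s) (fun a => sem e (ρ'.cons a) s')
        fun a a' ha => ih' e (hρ.cons ha) s s' hs
  | copow _ _ _ _ _ _ _ _ ih ih' =>
    intro Γ' Δ' A' d' ρ ρ' hρ
    cases d' with
    | copow _ _ _ _ _ _ d e => exact fun k k' hk => ih' e hρ _ _ (hk _ _ (ih d hρ))
  | copowlet _ _ _ _ _ _ _ _ f ih ih' =>
    intro Γ' Δ' A' d' ρ ρ' hρ
    cases d' with
    | copowlet _ _ _ _ _ _ _ d e =>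
      exact fun s s' hs => ih d hρ (fun a => sem f (ρ.cons a) s) (fun a => sem e (ρ'.cons a) s')
        fun a a' ha => ih' e (hρ.cons ha) s s' hs
  | cimage _ _ _ _ _ ih =>
    intro Γ' Δ' A' d' ρ ρ' hρ
    cases d' with | cimage _ _ _ _ d => exact fun s s' hs => ih d hρ () () trivial
  | cinl _ _ _ _ _ _ ih =>
    intro Γ' Δ' A' d' ρ ρ' hρ
    cases d' with | cinl _ _ _ _ _ d => exact fun s s' hs => ih d hρ _ _ hs.1
  | cinr _ _ _ _ _ _ ih =>
    intro Γ' Δ' A' d' ρ ρ' hρ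
    cases d' with | cinr _ _ _ _ _ d => exact fun s s' hs => ih d hρ _ _ hs.2
  | ccase _ _ _ _ _ _ _ _ _ _ _ ih ih' ih'' =>
    intro Γ' Δ' A' d' ρ ρ' hρ
    cases d' with
    | ccase _ _ _ _ _ _ _ _ d e f =>
      exact fun s s' hs => ih d hρ (_, _) (_, _) ⟨ih' e hρ s s' hs, ih'' f hρ s s' hs⟩
  | llam _ _ _ _ _ ih =>
    intro Γ' Δ' A' d' ρ ρ' hρ
    cases d' with | llam _ _ _ _ d => exact fun s s' hs => ih d hρ s s' hs
  | lapp _ _ _ _ _ _ _ _ ih ih' =>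
    intro Γ' Δ' A' d' ρ ρ' hρ
    cases d' with
    | lapp _ _ _ _ _ _ d e => exact fun s s' hs => ih' e hρ _ _ (ih d hρ s s' hs)

mutual
  theorem mrel_iff : ∀ (Δ : Option CType) (A : VType) (v v' : Mean (SAns Δ) A),
      MRel Δ Δ Eq A A v v' ↔ v = v'
    | _, .base _, _, _ => Iff.rfl
    | _, .unit, _, _ => ⟨fun _ => rfl, fun _ => trivial⟩
    | _, .prod A B, _, _ =>
      ⟨fun h => Prod.ext ((mrel_iff none A _ _).1 h.1) ((mrel_iff none B _ _).1 h.2), fun h =>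
        ⟨(mrel_iff none A _ _).2 (congrArg Prod.fst h), (mrel_iff none B _ _).2 (congrArg Prod.snd h)⟩⟩
    | _, .arr A B, _, _ =>
      ⟨fun h => funext fun a => (mrel_iff none B _ _).1 (h a a ((mrel_iff none A _ _).2 rfl)), fun h _ _ ha =>
        (mrel_iff none B _ _).2 (congr h ((mrel_iff none A _ _).1 ha))⟩
    | _, .comp A, _, _ =>
      ⟨fun h => funext fun s => h s s ((srel_iff A _ _).2 rfl), fun h _ _ hs =>
        congr h ((srel_iff A _ _).1 hs)⟩
    | _, .lin A B, _, _ =>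
      ⟨fun h => funext fun s => (srel_iff A _ _).1 (h s s ((srel_iff B _ _).2 rfl)), fun h _ _ hs =>
        (srel_iff A _ _).2 (congr h ((srel_iff B _ _).1 hs))⟩
  theorem srel_iff : ∀ (A : CType) (s s' : Stk A), SRel A A s s' ↔ s = s'
    | .base _, s, _ => Empty.elim s
    | .cunit, s, _ => Empty.elim s
    | .cand A B, s, s' => by
      match s, s' with
      | .inl s, .inl s' =>
        exact (srel_iff A s s').trans ⟨fun h => congrArg Sum.inl h, fun h => Sum.inl.inj h⟩
      | .inr s, .inr s' =>
        exact (srel_iff B s s').trans ⟨fun h => congrArg Sum.inr h, fun h => Sum.inr.inj h⟩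
      | .inl s, .inr s' => exact ⟨fun h => False.elim h, fun h => nomatch h⟩
      | .inr s, .inl s' => exact ⟨fun h => False.elim h, fun h => nomatch h⟩
    | .carr A B, _, _ =>
      ⟨fun h => Prod.ext ((mrel_iff none A _ _).1 h.1) ((srel_iff B _ _).1 h.2), fun h =>
        ⟨(mrel_iff none A _ _).2 (congrArg Prod.fst h), (srel_iff B _ _).2 (congrArg Prod.snd h)⟩⟩
    | .iunit, _, _ => Iff.rfl
    | .bang A, _, _ =>
      ⟨fun h => funext fun a => h a a ((mrel_iff none A _ _).2 rfl), fun h _ _ ha =>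
        congr h ((mrel_iff none A _ _).1 ha)⟩
    | .copow A B, _, _ =>
      ⟨fun h => funext fun a => (srel_iff B _ _).1 (h a a ((mrel_iff none A _ _).2 rfl)), fun h _ _ ha =>
        (srel_iff B _ _).2 (congr h ((mrel_iff none A _ _).1 ha))⟩
    | .czero, _, _ => ⟨fun _ => rfl, fun _ => trivial⟩
    | .csum A B, _, _ =>
      ⟨fun h => Prod.ext ((srel_iff A _ _).1 h.1) ((srel_iff B _ _).1 h.2), fun h =>
        ⟨(srel_iff A _ _).2 (congrArg Prod.fst h), (srel_iff B _ _).2 (congrArg Prod.snd h)⟩⟩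
end

theorem ARel_self : ∀ Δ : Option CType, ARel Δ Δ = Eq
  | none => rfl
  | some D => by
    funext s s'
    exact propext (srel_iff D s s')

/-- Coherence: the interpretation depends on the judgement only. -/
theorem Deriv.sem_eq {Γ : List VType} {Δ : Option CType} {t : Tm} {A : VType}
    (d d' : Deriv Γ Δ t A) (ρ : Env Γ) : sem d ρ = sem d' ρ := by
  have h := d.mrel d' (ρ := ρ) (ρ' := ρ) (fun n A A' h h' => by
    obtain rfl : A = A' := Option.some.inj (h.symm.trans h')
    exact (mrel_iff none A _ _).2 rfl)
  rw [ARel_self] at h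
  exact (mrel_iff Δ A _ _).1 h

/-- Soundness of the continuation model: both sides of an equation are typed and have the same
interpretation. -/
theorem EEq.exists_sem {Γ : List VType} {Δ : Option CType} {t u : Tm} {A : VType}
    (h : EEq Γ Δ t u A) :
    ∃ (d : Deriv Γ Δ t A) (e : Deriv Γ Δ u A), ∀ ρ, sem d ρ = sem e ρ := by
  induction h with
  | refl d => exact ⟨d, d, fun _ => rfl⟩
  | symm _ ih =>
    obtain ⟨d, e, h⟩ := ih
    exact ⟨e, d, fun ρ => (h ρ).symm⟩
  | trans _ _ ih ih' =>
    obtain ⟨d, e, h⟩ := ih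
    obtain ⟨d', e', h'⟩ := ih'
    exact ⟨d, e', fun ρ => ((h ρ).trans (e.sem_eq d' ρ)).trans (h' ρ)⟩
  | vpair_cong _ _ ih ih' =>
    obtain ⟨d, e, h⟩ := ih
    obtain ⟨d', e', h'⟩ := ih'
    exact ⟨.vpair _ _ _ _ _ d d', .vpair _ _ _ _ _ e e', fun ρ => by simp only [sem, h, h']; rfl⟩
  | vfst_cong _ ih =>
    obtain ⟨d, e, h⟩ := ih
    exact ⟨.vfst _ _ _ _ d, .vfst _ _ _ _ e, fun ρ => by simp only [sem, h]; rfl⟩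
  | vsnd_cong _ ih =>
    obtain ⟨d, e, h⟩ := ih
    exact ⟨.vsnd _ _ _ _ d, .vsnd _ _ _ _ e, fun ρ => by simp only [sem, h]; rfl⟩
  | vlam_cong _ ih =>
    obtain ⟨d, e, h⟩ := ih
    exact ⟨.vlam _ _ _ _ d, .vlam _ _ _ _ e, fun ρ => by simp only [sem, h]; rfl⟩
  | vapp_cong _ _ ih ih' =>
    obtain ⟨d, e, h⟩ := ih
    obtain ⟨d', e', h'⟩ := ih'
    exact ⟨.vapp _ _ _ _ _ d d', .vapp _ _ _ _ _ e e', fun ρ => by simp only [sem, h, h']; rfl⟩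
  | cpair_cong _ _ ih ih' =>
    obtain ⟨d, e, h⟩ := ih
    obtain ⟨d', e', h'⟩ := ih'
    exact ⟨.cpair _ _ _ _ _ _ d d', .cpair _ _ _ _ _ _ e e', fun ρ => by simp only [sem, h, h']; rfl⟩
  | cfst_cong _ ih =>
    obtain ⟨d, e, h⟩ := ih
    exact ⟨.cfst _ _ _ _ _ d, .cfst _ _ _ _ _ e, fun ρ => by simp only [sem, h]; rfl⟩
  | csnd_cong _ ih =>
    obtain ⟨d, e, h⟩ := ih
    exact ⟨.csnd _ _ _ _ _ d, .csnd _ _ _ _ _ e, fun ρ => by simp only [sem, h]; rfl⟩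
  | clam_cong _ ih =>
    obtain ⟨d, e, h⟩ := ih
    exact ⟨.clam _ _ _ _ _ d, .clam _ _ _ _ _ e, fun ρ => by simp only [sem, h]; rfl⟩
  | capp_cong _ _ ih ih' =>
    obtain ⟨d, e, h⟩ := ih
    obtain ⟨d', e', h'⟩ := ih'
    exact ⟨.capp _ _ _ _ _ _ d d', .capp _ _ _ _ _ _ e e', fun ρ => by simp only [sem, h, h']; rfl⟩
  | ilet_cong _ _ ih ih' =>
    obtain ⟨d, e, h⟩ := ih
    obtain ⟨d', e', h'⟩ := ih'
    exact ⟨.ilet _ _ _ _ _ d d', .ilet _ _ _ _ _ e e', fun ρ => by simp only [sem, h, h']; rfl⟩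
  | bang_cong _ ih =>
    obtain ⟨d, e, h⟩ := ih
    exact ⟨.bang _ _ _ d, .bang _ _ _ e, fun ρ => by simp only [sem, h]; rfl⟩
  | banglet_cong _ _ ih ih' =>
    obtain ⟨d, e, h⟩ := ih
    obtain ⟨d', e', h'⟩ := ih'
    exact ⟨.banglet _ _ _ _ _ _ d d', .banglet _ _ _ _ _ _ e e', fun ρ => by
      simp only [sem, h, h']; rfl⟩
  | copow_cong _ _ ih ih' =>
    obtain ⟨d, e, h⟩ := ih
    obtain ⟨d', e', h'⟩ := ih'
    exact ⟨.copow _ _ _ _ _ _ d d', .copow _ _ _ _ _ _ e e', fun ρ => by simp only [sem, h, h']; rfl⟩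
  | copowlet_cong _ _ ih ih' =>
    obtain ⟨d, e, h⟩ := ih
    obtain ⟨d', e', h'⟩ := ih'
    exact ⟨.copowlet _ _ _ _ _ _ _ d d', .copowlet _ _ _ _ _ _ _ e e', fun ρ => by
      simp only [sem, h, h']; rfl⟩
  | cimage_cong _ ih =>
    obtain ⟨d, e, h⟩ := ih
    exact ⟨.cimage _ _ _ _ d, .cimage _ _ _ _ e, fun ρ => by simp only [sem, h]; rfl⟩
  | cinl_cong _ ih =>
    obtain ⟨d, e, h⟩ := ih
    exact ⟨.cinl _ _ _ _ _ d, .cinl _ _ _ _ _ e, fun ρ => by simp only [sem, h]; rfl⟩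
  | cinr_cong _ ih =>
    obtain ⟨d, e, h⟩ := ih
    exact ⟨.cinr _ _ _ _ _ d, .cinr _ _ _ _ _ e, fun ρ => by simp only [sem, h]; rfl⟩
  | ccase_cong _ _ _ ih ih' ih'' =>
    obtain ⟨d, e, h⟩ := ih
    obtain ⟨d', e', h'⟩ := ih'
    obtain ⟨d'', e'', h''⟩ := ih''
    exact ⟨.ccase _ _ _ _ _ _ _ _ d d' d'', .ccase _ _ _ _ _ _ _ _ e e' e'', fun ρ => by
      simp only [sem, h, h', h'']; rfl⟩
  | llam_cong _ ih =>
    obtain ⟨d, e, h⟩ := ih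
    exact ⟨.llam _ _ _ _ d, .llam _ _ _ _ e, fun ρ => by simp only [sem, h]; rfl⟩
  | lapp_cong _ _ ih ih' =>
    obtain ⟨d, e, h⟩ := ih
    obtain ⟨d', e', h'⟩ := ih'
    exact ⟨.lapp _ _ _ _ _ _ d d', .lapp _ _ _ _ _ _ e e', fun ρ => by simp only [sem, h, h']; rfl⟩
  | unit_eta d => exact ⟨d, .unit _, fun ρ => rfl⟩
  | vfst_beta d e => exact ⟨.vfst _ _ _ _ (.vpair _ _ _ _ _ d e), d, fun ρ => rfl⟩
  | vsnd_beta d e => exact ⟨.vsnd _ _ _ _ (.vpair _ _ _ _ _ d e), e, fun ρ => rfl⟩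
  | vpair_eta d => exact ⟨.vpair _ _ _ _ _ (.vfst _ _ _ _ d) (.vsnd _ _ _ _ d), d, fun ρ => rfl⟩
  | vlam_beta d e =>
    obtain ⟨f, hf⟩ := d.exists_subst0 e
    exact ⟨.vapp _ _ _ _ _ (.vlam _ _ _ _ d) e, f, fun ρ => (hf ρ).symm⟩
  | @vlam_eta _ _ A _ d =>
    obtain ⟨f, hf⟩ := d.exists_shift A
    exact ⟨.vlam _ _ _ _ (.vapp _ _ _ _ _ f (.var _ 0 _ rfl)), d, fun ρ => funext fun a =>
      congrFun (hf ρ a) a⟩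
  | cunit_eta d => exact ⟨d, .cunit _ _, fun ρ => funext fun s => Empty.elim s⟩
  | cfst_beta d e => exact ⟨.cfst _ _ _ _ _ (.cpair _ _ _ _ _ _ d e), d, fun ρ => rfl⟩
  | csnd_beta d e => exact ⟨.csnd _ _ _ _ _ (.cpair _ _ _ _ _ _ d e), e, fun ρ => rfl⟩
  | cpair_eta d =>
    exact ⟨.cpair _ _ _ _ _ _ (.cfst _ _ _ _ _ d) (.csnd _ _ _ _ _ d), d, fun ρ => funext fun s =>
      match s with
      | .inl _ => rfl
      | .inr _ => rfl⟩
  | clam_beta d e =>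
    obtain ⟨f, hf⟩ := d.exists_subst0 e
    exact ⟨.capp _ _ _ _ _ _ (.clam _ _ _ _ _ d) e, f, fun ρ => (hf ρ).symm⟩
  | @clam_eta _ _ _ A _ d =>
    obtain ⟨f, hf⟩ := d.exists_shift A
    exact ⟨.clam _ _ _ _ _ (.capp _ _ _ _ _ _ f (.var _ 0 _ rfl)), d, fun ρ => funext fun s =>
      congrFun (hf ρ s.1) s⟩
  | ilet_beta d => exact ⟨.ilet _ _ _ _ _ (.top _) d, d, fun ρ => rfl⟩
  | ilet_eta d e =>
    obtain ⟨f, hf⟩ := e.exists_ssubst (.top _)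
    obtain ⟨g, hg⟩ := e.exists_ssubst d
    exact ⟨.ilet _ _ _ _ _ d f, g, fun ρ => funext fun s =>
      (congrArg (sem d ρ) (hf ρ s)).trans (hg ρ s).symm⟩
  | bang_beta d e =>
    obtain ⟨f, hf⟩ := e.exists_subst0 d
    exact ⟨.banglet _ _ _ _ _ _ (.bang _ _ _ d) e, f, fun ρ => (hf ρ).symm⟩
  | @bang_eta _ _ _ _ A _ d e =>
    obtain ⟨e', he⟩ := e.exists_shift A
    obtain ⟨f, hf⟩ := e'.exists_ssubst (.bang _ _ _ (.var _ 0 _ rfl))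
    obtain ⟨g, hg⟩ := e.exists_ssubst d
    exact ⟨.banglet _ _ _ _ _ _ d f, g, fun ρ => funext fun s =>
      (congrArg (sem d ρ) (funext fun a =>
        (hf _ s).trans (congrFun (congrFun (he ρ a) s) a))).trans (hg ρ s).symm⟩
  | copow_beta d e f =>
    obtain ⟨f', hf⟩ := f.exists_subst0 d
    obtain ⟨g, hg⟩ := f'.exists_ssubst e
    exact ⟨.copowlet _ _ _ _ _ _ _ (.copow _ _ _ _ _ _ d e) f, g, fun ρ => funext fun s =>
      ((hg ρ s).trans (congrArg (sem e ρ) (congrFun (hf ρ) s))).symm⟩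
  | @copow_eta _ _ _ _ A _ _ d e =>
    obtain ⟨e', he⟩ := e.exists_shift A
    obtain ⟨f, hf⟩ := e'.exists_ssubst (.copow _ _ _ _ _ _ (.var _ 0 _ rfl) (.svar _ _))
    obtain ⟨g, hg⟩ := e.exists_ssubst d
    exact ⟨.copowlet _ _ _ _ _ _ _ d f, g, fun ρ => funext fun s =>
      (congrArg (sem d ρ) (funext fun a =>
        (hf _ s).trans (congrFun (congrFun (he ρ a) s) a))).trans (hg ρ s).symm⟩
  | czero_eta d e =>
    obtain ⟨g, hg⟩ := e.exists_ssubst d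
    exact ⟨.cimage _ _ _ _ d, g, fun ρ => funext fun s => (hg ρ s).symm⟩
  | csum_beta_inl d e f =>
    obtain ⟨g, hg⟩ := d.exists_ssubst f
    exact ⟨.ccase _ _ _ _ _ _ _ _ (.cinl _ _ _ _ _ f) d e, g, fun ρ => funext fun s =>
      (hg ρ s).symm⟩
  | csum_beta_inr d e f =>
    obtain ⟨g, hg⟩ := e.exists_ssubst f
    exact ⟨.ccase _ _ _ _ _ _ _ _ (.cinr _ _ _ _ _ f) d e, g, fun ρ => funext fun s =>
      (hg ρ s).symm⟩
  | csum_eta d e =>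
    obtain ⟨f, hf⟩ := e.exists_ssubst (.cinl _ _ _ _ _ (.svar _ _))
    obtain ⟨f', hf'⟩ := e.exists_ssubst (.cinr _ _ _ _ _ (.svar _ _))
    obtain ⟨g, hg⟩ := e.exists_ssubst d
    exact ⟨.ccase _ _ _ _ _ _ _ _ d f f', g, fun ρ => funext fun s =>
      (congrArg (sem d ρ) (Prod.ext (hf ρ s) (hf' ρ s))).trans (hg ρ s).symm⟩
  | llam_beta d e =>
    obtain ⟨g, hg⟩ := d.exists_ssubst e
    exact ⟨.lapp _ _ _ _ _ _ (.llam _ _ _ _ d) e, g, fun ρ => funext fun s => (hg ρ s).symm⟩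
  | llam_eta d => exact ⟨.llam _ _ _ _ (.lapp _ _ _ _ _ _ d (.svar _ _)), d, fun ρ => rfl⟩

theorem EEq.left {Γ : List VType} {Δ : Option CType} {t u : Tm} {A : VType}
    (h : EEq Γ Δ t u A) : Nonempty (Deriv Γ Δ t A) :=
  let ⟨d, _⟩ := h.exists_sem
  ⟨d⟩

theorem EEq.right {Γ : List VType} {Δ : Option CType} {t u : Tm} {A : VType}
    (h : EEq Γ Δ t u A) : Nonempty (Deriv Γ Δ u A) :=
  h.symm.left

/-- Renaming of derivations. -/
noncomputable def Deriv.rename {Γ Γ' : List VType} {Δ : Option CType} {t : Tm} {A : VType}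
    (d : Deriv Γ Δ t A) (f : ℕ → ℕ) (hf : ∀ n A, Γ[n]? = some A → Γ'[f n]? = some A) :
    Deriv Γ' Δ (t.rename f) A :=
  (d.exists_rename f hf).choose

theorem EEq.rename {Γ : List VType} {Δ : Option CType} {t u : Tm} {A : VType}
    (h : EEq Γ Δ t u A) : ∀ {Γ' : List VType} (f : ℕ → ℕ)
    (_ : ∀ n A, Γ[n]? = some A → Γ'[f n]? = some A), EEq Γ' Δ (t.rename f) (u.rename f) A := by
  induction h with
  | refl d => exact fun f hf => .refl (d.rename f hf)
  | symm _ ih => exact fun f hf => (ih f hf).symm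
  | trans _ _ ih ih' => exact fun f hf => (ih f hf).trans (ih' f hf)
  | vpair_cong _ _ ih ih' => exact fun f hf => .vpair_cong (ih f hf) (ih' f hf)
  | vfst_cong _ ih => exact fun f hf => .vfst_cong (ih f hf)
  | vsnd_cong _ ih => exact fun f hf => .vsnd_cong (ih f hf)
  | vlam_cong _ ih => exact fun f hf => .vlam_cong (ih _ (liftN_typed _ hf))
  | vapp_cong _ _ ih ih' => exact fun f hf => .vapp_cong (ih f hf) (ih' f hf)
  | cpair_cong _ _ ih ih' => exact fun f hf => .cpair_cong (ih f hf) (ih' f hf)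
  | cfst_cong _ ih => exact fun f hf => .cfst_cong (ih f hf)
  | csnd_cong _ ih => exact fun f hf => .csnd_cong (ih f hf)
  | clam_cong _ ih => exact fun f hf => .clam_cong (ih _ (liftN_typed _ hf))
  | capp_cong _ _ ih ih' => exact fun f hf => .capp_cong (ih f hf) (ih' f hf)
  | ilet_cong _ _ ih ih' => exact fun f hf => .ilet_cong (ih f hf) (ih' f hf)
  | bang_cong _ ih => exact fun f hf => .bang_cong (ih f hf)
  | banglet_cong _ _ ih ih' =>
    exact fun f hf => .banglet_cong (ih f hf) (ih' _ (liftN_typed _ hf))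
  | copow_cong _ _ ih ih' => exact fun f hf => .copow_cong (ih f hf) (ih' f hf)
  | copowlet_cong _ _ ih ih' =>
    exact fun f hf => .copowlet_cong (ih f hf) (ih' _ (liftN_typed _ hf))
  | cimage_cong _ ih => exact fun f hf => .cimage_cong (ih f hf)
  | cinl_cong _ ih => exact fun f hf => .cinl_cong (ih f hf)
  | cinr_cong _ ih => exact fun f hf => .cinr_cong (ih f hf)
  | ccase_cong _ _ _ ih ih' ih'' =>
    exact fun f hf => .ccase_cong (ih f hf) (ih' f hf) (ih'' f hf)
  | llam_cong _ ih => exact fun f hf => .llam_cong (ih f hf)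
  | lapp_cong _ _ ih ih' => exact fun f hf => .lapp_cong (ih f hf) (ih' f hf)
  | unit_eta d => exact fun f hf => .unit_eta (d.rename f hf)
  | vfst_beta d e => exact fun f hf => .vfst_beta (d.rename f hf) (e.rename f hf)
  | vsnd_beta d e => exact fun f hf => .vsnd_beta (d.rename f hf) (e.rename f hf)
  | vpair_eta d => exact fun f hf => .vpair_eta (d.rename f hf)
  | vlam_beta d e =>
    intro Γ' f hf
    rw [Tm.rename_subst0]
    exact .vlam_beta (d.rename _ (liftN_typed _ hf)) (e.rename f hf)
  | vlam_eta d =>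
    intro Γ' f hf
    simpa [Tm.rename] using EEq.vlam_eta (d.rename f hf)
  | cunit_eta d => exact fun f hf => .cunit_eta (d.rename f hf)
  | cfst_beta d e => exact fun f hf => .cfst_beta (d.rename f hf) (e.rename f hf)
  | csnd_beta d e => exact fun f hf => .csnd_beta (d.rename f hf) (e.rename f hf)
  | cpair_eta d => exact fun f hf => .cpair_eta (d.rename f hf)
  | clam_beta d e =>
    intro Γ' f hf
    rw [Tm.rename_subst0]
    exact .clam_beta (d.rename _ (liftN_typed _ hf)) (e.rename f hf)
  | clam_eta d =>
    intro Γ' f hf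
    simpa [Tm.rename] using EEq.clam_eta (d.rename f hf)
  | ilet_beta d => exact fun f hf => .ilet_beta (d.rename f hf)
  | ilet_eta d e =>
    intro Γ' f hf
    simpa [Tm.rename, Tm.rename_ssubst] using EEq.ilet_eta (d.rename f hf) (e.rename f hf)
  | bang_beta d e =>
    intro Γ' f hf
    rw [Tm.rename_subst0]
    exact .bang_beta (d.rename f hf) (e.rename _ (liftN_typed _ hf))
  | bang_eta d e =>
    intro Γ' f hf
    simpa [Tm.rename, Tm.rename_ssubst] using EEq.bang_eta (d.rename f hf) (e.rename f hf)
  | copow_beta d e g =>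
    intro Γ' f hf
    rw [Tm.rename_ssubst, Tm.rename_subst0]
    exact .copow_beta (d.rename f hf) (e.rename f hf) (g.rename _ (liftN_typed _ hf))
  | copow_eta d e =>
    intro Γ' f hf
    simpa [Tm.rename, Tm.rename_ssubst] using EEq.copow_eta (d.rename f hf) (e.rename f hf)
  | czero_eta d e =>
    intro Γ' f hf
    rw [Tm.rename_ssubst]
    exact .czero_eta (d.rename f hf) (e.rename f hf)
  | csum_beta_inl d e g =>
    intro Γ' f hf
    rw [Tm.rename_ssubst]
    exact .csum_beta_inl (d.rename f hf) (e.rename f hf) (g.rename f hf)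
  | csum_beta_inr d e g =>
    intro Γ' f hf
    rw [Tm.rename_ssubst]
    exact .csum_beta_inr (d.rename f hf) (e.rename f hf) (g.rename f hf)
  | csum_eta d e =>
    intro Γ' f hf
    simpa [Tm.rename, Tm.rename_ssubst] using EEq.csum_eta (d.rename f hf) (e.rename f hf)
  | llam_beta d e =>
    intro Γ' f hf
    rw [Tm.rename_ssubst]
    exact .llam_beta (d.rename f hf) (e.rename f hf)
  | llam_eta d => exact fun f hf => .llam_eta (d.rename f hf)

theorem EEq.shift {Γ : List VType} {Δ : Option CType} {t u : Tm} {A : VType}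
    (h : EEq Γ Δ t u A) (B : VType) : EEq (B :: Γ) Δ t.shift u.shift A :=
  h.rename Nat.succ fun _ _ h => h

theorem EEq.ssubst {Γ : List VType} {Δ : Option CType} {t t' u u' : Tm} {A B : CType}
    (h : EEq Γ (some A) t t' (.comp B)) (hu : EEq Γ Δ u u' (.comp A)) :
    EEq Γ Δ (Tm.ssubst u t) (Tm.ssubst u' t') (.comp B) := by
  obtain ⟨d⟩ := h.left
  obtain ⟨d'⟩ := h.right
  obtain ⟨e⟩ := hu.left
  obtain ⟨e'⟩ := hu.right
  exact (EEq.llam_beta d e).symm.trans ((EEq.lapp_cong (.llam_cong h) hu).trans (.llam_beta d' e'))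

/-! ### Typing of λ-terms and soundness of the call-by-value translation -/

/-- Renaming of derivations. -/
noncomputable def LDeriv.rename {Θ : List STy} {M : LTm} {τ : STy} (d : LDeriv Θ M τ) :
    ∀ {Θ' : List STy} (f : ℕ → ℕ) (_ : ∀ n σ, Θ[n]? = some σ → Θ'[f n]? = some σ),
    LDeriv Θ' (M.rename f) τ := by
  induction d with
  | var _ n σ h => exact fun f hf => .var _ _ _ (hf n σ h)
  | unit => exact fun f hf => .unit _
  | pair _ _ _ _ _ _ _ ih ih' => exact fun f hf => .pair _ _ _ _ _ (ih f hf) (ih' f hf)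
  | fst _ _ _ _ _ ih => exact fun f hf => .fst _ _ _ _ (ih f hf)
  | snd _ _ _ _ _ ih => exact fun f hf => .snd _ _ _ _ (ih f hf)
  | lam _ _ _ _ _ ih => exact fun f hf => .lam _ _ _ _ (ih _ (liftN_typed _ hf))
  | app _ _ _ _ _ _ _ ih ih' => exact fun f hf => .app _ _ _ _ _ (ih f hf) (ih' f hf)

/-- Weakening of derivations. -/
noncomputable def LDeriv.shift {Θ : List STy} {M : LTm} {τ : STy} (d : LDeriv Θ M τ) (σ : STy) :
    LDeriv (σ :: Θ) M.shift τ :=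
  d.rename Nat.succ fun _ _ h => h

/-- Lifting of a well-typed substitution under a binder. -/
noncomputable def LDeriv.liftS {Θ Θ' : List STy} {θ : ℕ → LTm} (σ : STy)
    (hθ : ∀ n τ, Θ[n]? = some τ → LDeriv Θ' (θ n) τ) :
    ∀ n τ, (σ :: Θ)[n]? = some τ → LDeriv (σ :: Θ') (LTm.liftS θ n) τ
  | 0, _, h => .var _ _ _ h
  | n + 1, τ, h => (hθ n τ h).shift σ

/-- Substitution of derivations. -/
noncomputable def LDeriv.psubst {Θ : List STy} {M : LTm} {τ : STy} (d : LDeriv Θ M τ) :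
    ∀ {Θ' : List STy} (θ : ℕ → LTm) (_ : ∀ n σ, Θ[n]? = some σ → LDeriv Θ' (θ n) σ),
    LDeriv Θ' (M.psubst θ) τ := by
  induction d with
  | var _ n σ h => exact fun θ hθ => hθ n σ h
  | unit => exact fun θ hθ => .unit _
  | pair _ _ _ _ _ _ _ ih ih' => exact fun θ hθ => .pair _ _ _ _ _ (ih θ hθ) (ih' θ hθ)
  | fst _ _ _ _ _ ih => exact fun θ hθ => .fst _ _ _ _ (ih θ hθ)
  | snd _ _ _ _ _ ih => exact fun θ hθ => .snd _ _ _ _ (ih θ hθ)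
  | lam _ _ σ _ _ ih =>
    exact fun θ hθ => LTm.psubst_lam θ _ _ ▸ .lam _ _ _ _ (ih _ (LDeriv.liftS σ hθ))
  | app _ _ _ _ _ _ _ ih ih' => exact fun θ hθ => .app _ _ _ _ _ (ih θ hθ) (ih' θ hθ)

/-- Extension of a well-typed substitution. -/
def LDeriv.scons {Θ Θ' : List STy} {θ : ℕ → LTm} {V : LTm} {σ : STy} (d : LDeriv Θ' V σ)
    (hθ : ∀ n τ, Θ[n]? = some τ → LDeriv Θ' (θ n) τ) :
    ∀ n τ, (σ :: Θ)[n]? = some τ → LDeriv Θ' (LTm.scons V θ n) τ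
  | 0, _, h => Option.some.inj h ▸ d
  | n + 1, τ, h => hθ n τ h

/-- Substitution for the innermost variable preserves typing. -/
noncomputable def LDeriv.subst0 {Θ : List STy} {M V : LTm} {σ τ : STy} (d : LDeriv (σ :: Θ) M τ)
    (e : LDeriv Θ V σ) : LDeriv Θ (LTm.subst0 V M) τ :=
  LTm.subst0_eq V M ▸ d.psubst _ (e.scons fun n σ h => .var _ n σ h)

theorem LVal.rename {V : LTm} (h : LVal V) (f : ℕ → ℕ) : LVal (V.rename f) := by
  induction h with
  | var => exact .var _
  | unit => exact .unit
  | lam => exact .lam _ _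
  | pair _ _ ih ih' => exact .pair ih ih'

/-- The innermost variable. -/
def LDeriv.var0 (Θ : List STy) (σ : STy) : LDeriv (σ :: Θ) (.var 0) σ :=
  .var _ _ _ rfl

theorem cbvTm_rename (M : LTm) (f : ℕ → ℕ) : cbvTm (M.rename f) = (cbvTm M).rename f := by
  induction M generalizing f <;> simp [LTm.rename, cbvTm, Tm.rename, *]

theorem cbvTm_shift (M : LTm) : cbvTm M.shift = (cbvTm M).shift :=
  cbvTm_rename M _

theorem cbvCtx_lookup {Θ : List STy} {n : ℕ} {σ : STy} (h : Θ[n]? = some σ) :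
    (cbvCtx Θ)[n]? = some (cbvT σ) := by
  simp [cbvCtx, h]

/-- The innermost variable. -/
def Deriv.var0 (Γ : List VType) (A : VType) : Deriv (A :: Γ) none (.var 0) A :=
  .var _ _ _ rfl

/-- The second innermost variable. -/
def Deriv.var1 (Γ : List VType) (A B : VType) : Deriv (B :: A :: Γ) none (.var 1) A :=
  .var _ _ _ rfl

/-- Weakening of derivations. -/
noncomputable def Deriv.shift {Γ : List VType} {Δ : Option CType} {t : Tm} {A : VType}
    (d : Deriv Γ Δ t A) (B : VType) : Deriv (B :: Γ) Δ t.shift A :=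
  d.rename Nat.succ fun _ _ h => h

/-- Typing of the call-by-value translation. -/
noncomputable def LDeriv.cbv {Θ : List STy} {M : LTm} {τ : STy} (d : LDeriv Θ M τ) :
    Deriv (cbvCtx Θ) none (cbvTm M) (.comp (.bang (cbvT τ))) := by
  induction d with
  | var _ n σ h => exact .bang _ _ _ (.var _ _ _ (cbvCtx_lookup h))
  | unit => exact .bang _ _ _ (.unit _)
  | pair _ _ _ _ _ _ _ ih ih' =>
    exact .banglet _ _ _ _ _ _ ih (.banglet _ _ _ _ _ _ (ih'.shift _)
      (.bang _ _ _ (.vpair _ _ _ _ _ (.var1 _ _ _) (.var0 _ _))))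
  | fst _ _ _ _ _ ih => exact .banglet _ _ _ _ _ _ ih (.bang _ _ _ (.vfst _ _ _ _ (.var0 _ _)))
  | snd _ _ _ _ _ ih => exact .banglet _ _ _ _ _ _ ih (.bang _ _ _ (.vsnd _ _ _ _ (.var0 _ _)))
  | lam _ _ _ _ _ ih => exact .bang _ _ _ (.vlam _ _ _ _ ih)
  | app _ _ _ _ _ _ _ ih ih' =>
    exact .banglet _ _ _ _ _ _ ih (.banglet _ _ _ _ _ _ (ih'.shift _)
      (.vapp _ _ _ _ _ (.var1 _ _ _) (.var0 _ _)))

/-- The value denoted by a syntactic value under the call-by-value translation. -/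
def cbvVal : LTm → Tm
  | .var n => .var n
  | .pair M N => .vpair (cbvVal M) (cbvVal N)
  | .lam σ M => .vlam (cbvT σ) (cbvTm M)
  | _ => .unit

/-- Typing of the translation of a value. -/
theorem LVal.cbvVal_typed {V : LTm} (h : LVal V) :
    ∀ {Θ : List STy} {τ : STy}, LDeriv Θ V τ → Nonempty (Deriv (cbvCtx Θ) none (cbvVal V) (cbvT τ)) := by
  induction h with
  | var n => rintro Θ τ ⟨⟩; exact ⟨.var _ _ _ (cbvCtx_lookup (by assumption))⟩
  | unit => rintro Θ τ ⟨⟩; exact ⟨.unit _⟩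
  | lam σ M => rintro Θ τ (_ | _ | _ | _ | _ | ⟨_, _, _, _, d⟩); exact ⟨.vlam _ _ _ _ d.cbv⟩
  | pair _ _ ih ih' =>
    rintro Θ τ (_ | _ | ⟨_, _, _, _, _, d, e⟩)
    obtain ⟨d⟩ := ih d
    obtain ⟨e⟩ := ih' e
    exact ⟨.vpair _ _ _ _ _ d e⟩

theorem banglet_assoc {Γ : List VType} {t u v : Tm} {A B : VType} {C : CType}
    (d : Deriv Γ none t (.comp (.bang A))) (e : Deriv (A :: Γ) none u (.comp (.bang B)))
    (g : Deriv (B :: Γ) none v (.comp C)) :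
    EEq Γ none (.banglet (.banglet t u) v)
      (.banglet t (.banglet u (v.rename (Tm.liftN Nat.succ)))) (.comp C) := by
  have h := EEq.bang_eta d (.banglet _ _ _ _ _ _ (.banglet _ _ _ _ _ _ (.svar Γ (.bang A)) e) g)
  simp only [Tm.ssubst, Tm.shift, Tm.rename, (e.sfree rfl).ssubst, (g.sfree rfl).ssubst,
    ((e.sfree rfl).rename _).ssubst, ((g.sfree rfl).rename _).ssubst] at h
  refine h.symm.trans (.banglet_cong (.refl d) (.banglet_cong (A := B) ?_ (.refl ?_)))
  · have := EEq.bang_beta (.var0 Γ A) (e.rename (Γ' := A :: A :: Γ) (Tm.liftN Nat.succ)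
      (liftN_typed _ fun _ _ h => h))
    rw [Tm.subst0_eq, Tm.psubst_rename] at this
    refine Eq.mp ?_ this
    congr
    convert Tm.psubst_var u using 2
    funext n
    cases n <;> rfl
  · exact g.rename _ (liftN_typed _ fun _ _ h => h)

theorem subst0_var_rename (t : Tm) :
    Tm.subst0 (.var 0) (t.rename (Tm.liftN Nat.succ)) = t := by
  rw [Tm.subst0_eq, Tm.psubst_rename]
  convert Tm.psubst_var t using 2
  funext n
  cases n <;> rfl

/-- The `let`-construct of the λ-calculus is translated to the `let`-construct of EEC. -/
theorem cbv_let {Θ : List STy} {M N : LTm} {σ τ : STy} (d : LDeriv (σ :: Θ) M τ)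
    (e : LDeriv Θ N σ) :
    EEq (cbvCtx Θ) none (cbvTm (.app (.lam σ M) N)) (.banglet (cbvTm N) (cbvTm M))
      (.comp (.bang (cbvT τ))) := by
  have hl : Deriv (cbvCtx Θ) none (.vlam (cbvT σ) (cbvTm M))
    (.arr (cbvT σ) (.comp (.bang (cbvT τ)))) := .vlam _ _ _ _ d.cbv
  refine (EEq.bang_beta hl (.banglet _ _ _ _ _ _ (e.cbv.shift _)
    (.vapp _ _ _ _ _ (.var1 _ _ _) (.var0 _ _)))).trans ?_
  rw [Tm.subst0_eq]
  simp only [Tm.psubst, Tm.psubst_shift, Tm.psubst_var, Tm.liftS_one, Tm.liftS_zero, Tm.scons_zero]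
  refine .banglet_cong (.refl e.cbv) ?_
  have := EEq.vlam_beta (d.cbv.rename (Γ' := cbvT σ :: cbvT σ :: cbvCtx Θ) (Tm.liftN Nat.succ)
    (liftN_typed _ fun _ _ h => h)) (.var0 _ _)
  rwa [subst0_var_rename] at this

theorem cbv_pair {Θ : List STy} {M N : LTm} {t u : Tm} {σ τ : STy}
    (h : EEq (cbvCtx Θ) none (cbvTm M) (.bang t) (.comp (.bang (cbvT σ))))
    (h' : EEq (cbvCtx Θ) none (cbvTm N) (.bang u) (.comp (.bang (cbvT τ))))
    (d : Deriv (cbvCtx Θ) none t (cbvT σ)) (e : Deriv (cbvCtx Θ) none u (cbvT τ)) :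
    EEq (cbvCtx Θ) none (cbvTm (.pair M N)) (.bang (.vpair t u))
      (.comp (.bang (cbvT (.prod σ τ)))) := by
  have hp := Deriv.bang _ _ _ (.vpair _ _ _ _ _ (.var1 (cbvCtx Θ) (cbvT σ) (cbvT τ)) (.var0 _ _))
  have hs : EEq _ none (cbvTm N).shift (.bang u.shift) _ := h'.shift (cbvT σ)
  refine (EEq.banglet_cong h (.banglet_cong hs (.refl hp))).trans ?_
  refine (EEq.bang_beta d (.banglet _ _ _ _ _ _ (.bang _ _ _ (e.shift _)) hp)).trans ?_
  rw [Tm.subst0_eq]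
  simp only [Tm.psubst, Tm.psubst_shift, Tm.psubst_var, Tm.liftS_one, Tm.liftS_zero,
    Tm.scons_zero]
  have := EEq.bang_beta e (.bang _ _ _ (.vpair _ _ _ _ _ (d.shift (cbvT τ)) (.var0 _ _)))
  rw [Tm.subst0_eq] at this
  simpa [Tm.psubst] using this

/-- The translation of a syntactic value is a value computation. -/
theorem LVal.cbv_eq {V : LTm} (h : LVal V) : ∀ {Θ : List STy} {τ : STy} (_ : LDeriv Θ V τ),
    EEq (cbvCtx Θ) none (cbvTm V) (.bang (cbvVal V)) (.comp (.bang (cbvT τ))) := by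
  induction h with
  | var => exact fun d => .refl d.cbv
  | unit => exact fun d => .refl d.cbv
  | lam => exact fun d => .refl d.cbv
  | pair hV hW ih ih' =>
    rintro Θ τ (_ | _ | ⟨_, V, W, σ, τ, d, e⟩)
    obtain ⟨d'⟩ := hV.cbvVal_typed d
    obtain ⟨e'⟩ := hW.cbvVal_typed e
    exact cbv_pair (ih d) (ih' e) d' e'

theorem cbv_fst {Θ : List STy} {M : LTm} {t : Tm} {σ τ : STy}
    (h : EEq (cbvCtx Θ) none (cbvTm M) (.bang t) (.comp (.bang (cbvT (.prod σ τ)))))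
    (d : Deriv (cbvCtx Θ) none t (cbvT (.prod σ τ))) :
    EEq (cbvCtx Θ) none (cbvTm (.fst M)) (.bang (.vfst t)) (.comp (.bang (cbvT σ))) := by
  have hp := Deriv.bang _ _ _ (.vfst _ _ _ _ (.var0 (cbvCtx Θ) (.prod (cbvT σ) (cbvT τ))))
  exact (EEq.banglet_cong h (.refl hp)).trans (.bang_beta d hp)

theorem cbv_snd {Θ : List STy} {M : LTm} {t : Tm} {σ τ : STy}
    (h : EEq (cbvCtx Θ) none (cbvTm M) (.bang t) (.comp (.bang (cbvT (.prod σ τ)))))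
    (d : Deriv (cbvCtx Θ) none t (cbvT (.prod σ τ))) :
    EEq (cbvCtx Θ) none (cbvTm (.snd M)) (.bang (.vsnd t)) (.comp (.bang (cbvT τ))) := by
  have hp := Deriv.bang _ _ _ (.vsnd _ _ _ _ (.var0 (cbvCtx Θ) (.prod (cbvT σ) (cbvT τ))))
  exact (EEq.banglet_cong h (.refl hp)).trans (.bang_beta d hp)

theorem cbv_app_left {Θ : List STy} {M N : LTm} {t : Tm} {σ τ : STy}
    (h : EEq (cbvCtx Θ) none (cbvTm M) (.bang t) (.comp (.bang (cbvT (.arr σ τ)))))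
    (d : Deriv (cbvCtx Θ) none t (cbvT (.arr σ τ))) (e : LDeriv Θ N σ) :
    EEq (cbvCtx Θ) none (cbvTm (.app M N)) (.banglet (cbvTm N) (.vapp t.shift (.var 0)))
      (.comp (.bang (cbvT τ))) := by
  have hp := Deriv.banglet _ _ _ _ _ _ (e.cbv.shift (cbvT (.arr σ τ)))
    (.vapp _ _ _ _ _ (.var1 _ _ _) (.var0 _ _))
  refine (EEq.banglet_cong h (.refl hp)).trans ?_
  have := EEq.bang_beta d hp
  rw [Tm.subst0_eq] at this
  simpa [Tm.psubst] using this

theorem cbv_app {Θ : List STy} {M N : LTm} {t u : Tm} {σ τ : STy}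
    (h : EEq (cbvCtx Θ) none (cbvTm M) (.bang t) (.comp (.bang (cbvT (.arr σ τ)))))
    (h' : EEq (cbvCtx Θ) none (cbvTm N) (.bang u) (.comp (.bang (cbvT σ))))
    (d : Deriv (cbvCtx Θ) none t (cbvT (.arr σ τ))) (e : Deriv (cbvCtx Θ) none u (cbvT σ))
    (g : LDeriv Θ N σ) :
    EEq (cbvCtx Θ) none (cbvTm (.app M N)) (.vapp t u) (.comp (.bang (cbvT τ))) := by
  have hp := Deriv.vapp _ _ _ _ _ (d.shift (cbvT σ)) (.var0 _ _)
  refine (cbv_app_left h d g).trans ((EEq.banglet_cong h' (.refl hp)).trans ?_)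
  have := EEq.bang_beta e hp
  rw [Tm.subst0_eq] at this
  simpa [Tm.psubst] using this

/-- The call-by-value translation commutes with substitution of values. -/
theorem cbv_psubst {Θ : List STy} {M : LTm} {τ : STy} (d : LDeriv Θ M τ) :
    ∀ {Θ' : List STy} (θ : ℕ → LTm) (θ' : ℕ → Tm) (_ : ∀ n σ, Θ[n]? = some σ →
      EEq (cbvCtx Θ') none (cbvTm (θ n)) (.bang (θ' n)) (.comp (.bang (cbvT σ)))),
    EEq (cbvCtx Θ') none (cbvTm (M.psubst θ)) ((cbvTm M).psubst θ') (.comp (.bang (cbvT τ))) := by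
  induction d with
  | var _ n σ h => exact fun θ θ' hθ => hθ n σ h
  | unit => exact fun θ θ' hθ => .refl (.bang _ _ _ (.unit _))
  | pair _ _ _ _ _ _ _ ih ih' =>
    intro Θ' θ θ' hθ
    simp only [LTm.psubst, cbvTm, Tm.psubst, Tm.psubst_liftS_shift]
    exact .banglet_cong (ih θ θ' hθ) (.banglet_cong ((ih' θ θ' hθ).shift _)
      (.refl (.bang _ _ _ (.vpair _ _ _ _ _ (.var1 _ _ _) (.var0 _ _)))))
  | fst _ _ _ _ _ ih =>
    exact fun θ θ' hθ => .banglet_cong (ih θ θ' hθ)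
      (.refl (.bang _ _ _ (.vfst _ _ _ _ (.var0 _ _))))
  | snd _ _ _ _ _ ih =>
    exact fun θ θ' hθ => .banglet_cong (ih θ θ' hθ)
      (.refl (.bang _ _ _ (.vsnd _ _ _ _ (.var0 _ _))))
  | lam _ _ σ _ _ ih =>
    intro Θ' θ θ' hθ
    rw [LTm.psubst_lam]
    refine .bang_cong (.vlam_cong (ih (Θ' := σ :: Θ') _ _ ?_))
    rintro (_ | n) τ h
    · exact .refl (.bang _ _ _ (.var _ _ _ (cbvCtx_lookup h)))
    · have := (hθ n τ h).shift (cbvT σ)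
      rwa [← cbvTm_shift] at this
  | app _ _ _ _ _ _ _ ih ih' =>
    intro Θ' θ θ' hθ
    simp only [LTm.psubst, cbvTm, Tm.psubst, Tm.psubst_liftS_shift]
    exact .banglet_cong (ih θ θ' hθ) (.banglet_cong ((ih' θ θ' hθ).shift _)
      (.refl (.vapp _ _ _ _ _ (.var1 _ _ _) (.var0 _ _))))

/-- Soundness of the call-by-value translation. -/
theorem LamC.cbv {Θ : List STy} {M N : LTm} {τ : STy} (h : LamC Θ M N τ) :
    EEq (cbvCtx Θ) none (cbvTm M) (cbvTm N) (.comp (.bang (cbvT τ))) := by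
  induction h with
  | refl d => exact .refl d.cbv
  | symm _ ih => exact ih.symm
  | trans _ _ ih ih' => exact ih.trans ih'
  | pair_cong _ _ ih ih' =>
    exact .banglet_cong ih (.banglet_cong (ih'.shift _)
      (.refl (.bang _ _ _ (.vpair _ _ _ _ _ (.var1 _ _ _) (.var0 _ _)))))
  | fst_cong _ ih => exact .banglet_cong ih (.refl (.bang _ _ _ (.vfst _ _ _ _ (.var0 _ _))))
  | snd_cong _ ih => exact .banglet_cong ih (.refl (.bang _ _ _ (.vsnd _ _ _ _ (.var0 _ _))))
  | lam_cong _ ih => exact .bang_cong (.vlam_cong ih)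
  | app_cong _ _ ih ih' =>
    exact .banglet_cong ih (.banglet_cong (ih'.shift _)
      (.refl (.vapp _ _ _ _ _ (.var1 _ _ _) (.var0 _ _))))
  | @beta_v Θ M V σ τ d e hV =>
    obtain ⟨e'⟩ := hV.cbvVal_typed e
    refine (cbv_let d e).trans ((EEq.banglet_cong (hV.cbv_eq e) (.refl d.cbv)).trans
      ((EEq.bang_beta e' d.cbv).trans ?_))
    rw [Tm.subst0_eq, LTm.subst0_eq]
    refine (cbv_psubst d _ _ ?_).symm
    rintro (_ | n) ρ h
    · cases h
      exact hV.cbv_eq e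
    · exact .refl (.bang _ _ _ (.var _ _ _ (cbvCtx_lookup h)))
  | @eta_v Θ V σ τ hV d =>
    obtain ⟨d'⟩ := hV.cbvVal_typed d
    have h := (hV.cbv_eq d).shift (cbvT σ)
    rw [← cbvTm_shift] at h
    exact (EEq.bang_cong ((EEq.vlam_cong (cbv_app (Θ := σ :: Θ) (N := .var 0) h
      (.refl (LDeriv.var0 Θ σ).cbv) (d'.shift _) (.var0 _ _) (.var0 _ _))).trans
      (.vlam_eta d'))).trans (hV.cbv_eq d).symm
  | fst_beta_v hV hW d e =>
    obtain ⟨d'⟩ := hV.cbvVal_typed d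
    obtain ⟨e'⟩ := hW.cbvVal_typed e
    exact (cbv_fst (cbv_pair (hV.cbv_eq d) (hW.cbv_eq e) d' e') (.vpair _ _ _ _ _ d' e')).trans
      ((EEq.bang_cong (.vfst_beta d' e')).trans (hV.cbv_eq d).symm)
  | snd_beta_v hV hW d e =>
    obtain ⟨d'⟩ := hV.cbvVal_typed d
    obtain ⟨e'⟩ := hW.cbvVal_typed e
    exact (cbv_snd (cbv_pair (hV.cbv_eq d) (hW.cbv_eq e) d' e') (.vpair _ _ _ _ _ d' e')).trans
      ((EEq.bang_cong (.vsnd_beta d' e')).trans (hW.cbv_eq e).symm)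
  | pair_eta_v hV d =>
    obtain ⟨d'⟩ := hV.cbvVal_typed d
    exact (cbv_pair (cbv_fst (hV.cbv_eq d) d') (cbv_snd (hV.cbv_eq d) d') (.vfst _ _ _ _ d')
      (.vsnd _ _ _ _ d')).trans ((EEq.bang_cong (.vpair_eta d')).trans (hV.cbv_eq d).symm)
  | unit_eta_v hV d =>
    obtain ⟨d'⟩ := hV.cbvVal_typed d
    exact (hV.cbv_eq d).trans (.bang_cong (.unit_eta d'))
  | let_eta d => exact (cbv_let (.var0 _ _) d).trans (.bang_eta d.cbv (.svar _ _))
  | @let_assoc Θ M N L σ ρ τ d e g =>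
    have d' := d.rename (Θ' := σ :: ρ :: Θ) (Tm.liftN Nat.succ) (liftN_typed _ fun _ _ h => h)
    refine (cbv_let d (.app _ _ _ _ _ (.lam _ _ _ _ e) g)).trans
      ((EEq.banglet_cong (cbv_let e g) (.refl d.cbv)).trans
      ((banglet_assoc g.cbv e.cbv d.cbv).trans
      ((EEq.banglet_cong (.refl g.cbv) ?_).trans
      (cbv_let (.app _ _ _ _ _ (.lam _ _ _ _ d') e) g).symm)))
    rw [← cbvTm_rename]
    exact (cbv_let d' e).symm
  | @app_left Θ M N σ τ d e =>
    refine (EEq.banglet_cong (.refl d.cbv) ?_).trans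
      (cbv_let (.app _ _ _ _ _ (.var0 _ _) (e.shift _)) d).symm
    rw [← cbvTm_shift]
    exact (cbv_app_left (Θ := _ :: Θ) (.refl (LDeriv.var0 Θ _).cbv) (.var0 _ _) (e.shift _)).symm
  | @app_right Θ V N σ τ hV d e =>
    obtain ⟨d'⟩ := hV.cbvVal_typed d
    refine (cbv_app_left (hV.cbv_eq d) d' e).trans (.trans (.banglet_cong (.refl e.cbv) ?_)
      (cbv_let (.app _ _ _ _ _ (d.shift _) (.var0 _ _)) e).symm)
    have h := (hV.cbv_eq d).shift (cbvT σ)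
    rw [← cbvTm_shift] at h
    exact (cbv_app (Θ := σ :: Θ) (N := .var 0) h (.refl (LDeriv.var0 Θ σ).cbv) (d'.shift _)
      (.var0 _ _) (.var0 _ _)).symm
  | @pair_left Θ M N σ τ d e =>
    refine (EEq.banglet_cong (.refl d.cbv) ?_).trans
      (cbv_let (.pair _ _ _ _ _ (.var0 _ _) (e.shift _)) d).symm
    have hp := Deriv.bang _ _ _
      (.vpair _ _ _ _ _ (.var1 (cbvCtx (σ :: Θ)) (cbvT σ) (cbvT τ)) (.var0 _ _))
    have := EEq.bang_beta (.var0 (cbvCtx Θ) (cbvT σ))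
      (.banglet _ _ _ _ _ _ ((e.cbv.shift (cbvT σ)).shift (cbvT σ)) hp)
    rw [Tm.subst0_eq] at this
    simp only [Tm.psubst, Tm.psubst_shift, Tm.psubst_var, Tm.liftS_one, Tm.liftS_zero,
      Tm.scons_zero] at this
    simp only [cbvTm, cbvTm_shift]
    exact this.symm
  | @pair_right Θ V N σ τ hV d e =>
    obtain ⟨d'⟩ := hV.cbvVal_typed d
    have hp := Deriv.bang _ _ _ (.vpair _ _ _ _ _ (.var1 (cbvCtx Θ) (cbvT σ) (cbvT τ)) (.var0 _ _))
    have h₁ := EEq.bang_beta d' (.banglet _ _ _ _ _ _ (e.cbv.shift (cbvT σ)) hp)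
    rw [Tm.subst0_eq] at h₁
    simp only [Tm.psubst, Tm.psubst_shift, Tm.psubst_var, Tm.liftS_one, Tm.liftS_zero,
      Tm.scons_zero] at h₁
    refine (EEq.banglet_cong (hV.cbv_eq d) (.refl (.banglet _ _ _ _ _ _ (e.cbv.shift _) hp))).trans
      (h₁.trans (.trans (.banglet_cong (.refl e.cbv) ?_)
      (cbv_let (.pair _ _ _ _ _ (d.shift _) (.var0 _ _)) e).symm))
    have h := (hV.cbv_eq d).shift (cbvT τ)
    rw [← cbvTm_shift] at h
    exact (cbv_pair (Θ := τ :: Θ) (N := .var 0) h (.refl (LDeriv.var0 Θ τ).cbv) (d'.shift _)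
      (.var0 _ _)).symm
  | @fst_cc Θ M σ τ d =>
    refine .trans (.banglet_cong (.refl d.cbv) ?_) (cbv_let (.fst _ _ _ _ (.var0 _ _)) d).symm
    exact (cbv_fst (Θ := _ :: Θ) (.refl (LDeriv.var0 Θ _).cbv) (.var0 _ _)).symm
  | @snd_cc Θ M σ τ d =>
    refine .trans (.banglet_cong (.refl d.cbv) ?_) (cbv_let (.snd _ _ _ _ (.var0 _ _)) d).symm
    exact (cbv_snd (Θ := _ :: Θ) (.refl (LDeriv.var0 Θ _).cbv) (.var0 _ _)).symm

/-! ### Structural properties of the computational λ-calculus -/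

theorem LamC.rename {Θ : List STy} {M N : LTm} {τ : STy} (h : LamC Θ M N τ) :
    ∀ {Θ' : List STy} (f : ℕ → ℕ) (_ : ∀ n σ, Θ[n]? = some σ → Θ'[f n]? = some σ),
    LamC Θ' (M.rename f) (N.rename f) τ := by
  induction h with
  | refl d => exact fun f hf => .refl (d.rename f hf)
  | symm _ ih => exact fun f hf => (ih f hf).symm
  | trans _ _ ih ih' => exact fun f hf => (ih f hf).trans (ih' f hf)
  | pair_cong _ _ ih ih' => exact fun f hf => .pair_cong (ih f hf) (ih' f hf)
  | fst_cong _ ih => exact fun f hf => .fst_cong (ih f hf)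
  | snd_cong _ ih => exact fun f hf => .snd_cong (ih f hf)
  | lam_cong _ ih => exact fun f hf => .lam_cong (ih _ (liftN_typed _ hf))
  | app_cong _ _ ih ih' => exact fun f hf => .app_cong (ih f hf) (ih' f hf)
  | beta_v d e hV =>
    intro Θ' f hf
    rw [LTm.rename_subst0]
    exact .beta_v (d.rename _ (liftN_typed _ hf)) (e.rename f hf) (hV.rename f)
  | eta_v hV d =>
    intro Θ' f hf
    simpa [LTm.rename] using LamC.eta_v (hV.rename f) (d.rename f hf)
  | fst_beta_v hV hW d e =>
    exact fun f hf => .fst_beta_v (hV.rename f) (hW.rename f) (d.rename f hf) (e.rename f hf)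
  | snd_beta_v hV hW d e =>
    exact fun f hf => .snd_beta_v (hV.rename f) (hW.rename f) (d.rename f hf) (e.rename f hf)
  | pair_eta_v hV d => exact fun f hf => .pair_eta_v (hV.rename f) (d.rename f hf)
  | unit_eta_v hV d => exact fun f hf => .unit_eta_v (hV.rename f) (d.rename f hf)
  | let_eta d => exact fun f hf => .let_eta (d.rename f hf)
  | let_assoc d e g =>
    intro Θ' f hf
    have := LamC.let_assoc (d.rename _ (liftN_typed _ hf)) (e.rename _ (liftN_typed _ hf))
      (g.rename f hf)
    simp only [LTm.rename, LTm.rename_rename, Tm.liftN_comp] at this ⊢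
    exact this
  | app_left d e =>
    intro Θ' f hf
    simpa [LTm.rename] using LamC.app_left (d.rename f hf) (e.rename f hf)
  | app_right hV d e =>
    intro Θ' f hf
    simpa [LTm.rename] using LamC.app_right (hV.rename f) (d.rename f hf) (e.rename f hf)
  | pair_left d e =>
    intro Θ' f hf
    simpa [LTm.rename] using LamC.pair_left (d.rename f hf) (e.rename f hf)
  | pair_right hV d e =>
    intro Θ' f hf
    simpa [LTm.rename] using LamC.pair_right (hV.rename f) (d.rename f hf) (e.rename f hf)
  | fst_cc d => exact fun f hf => .fst_cc (d.rename f hf)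
  | snd_cc d => exact fun f hf => .snd_cc (d.rename f hf)

theorem LamC.shift {Θ : List STy} {M N : LTm} {τ : STy} (h : LamC Θ M N τ) (σ : STy) :
    LamC (σ :: Θ) M.shift N.shift τ :=
  h.rename Nat.succ fun _ _ h => h

theorem List.IsPrefix.lookup {X : Type} {w w' : List X} (h : w <+: w') (n : ℕ) (x : X)
    (hx : w[n]? = some x) : w'[id n]? = some x := by
  obtain ⟨v, rfl⟩ := h
  obtain ⟨hn, -⟩ := List.getElem?_eq_some_iff.mp hx
  rw [id, List.getElem?_append_left hn, hx]

theorem cons_prefix {X : Type} {w w' : List X} (h : w <+: w') (x : X) : x :: w <+: x :: w' :=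
  (List.cons_prefix_cons).mpr ⟨rfl, h⟩

/-- Typing is preserved when the context is extended by outermost variables. -/
noncomputable def LDeriv.mono {w w' : List STy} {M : LTm} {τ : STy} (d : LDeriv w M τ)
    (h : w <+: w') : LDeriv w' M τ :=
  LTm.rename_id M ▸ d.rename id (List.IsPrefix.lookup h)

theorem LamC.mono {w w' : List STy} {M N : LTm} {τ : STy} (hM : LamC w M N τ)
    (h : w <+: w') : LamC w' M N τ := by
  have := hM.rename id (List.IsPrefix.lookup h)
  rwa [LTm.rename_id, LTm.rename_id] at this

theorem LamC.psubst_cong {Θ : List STy} {M : LTm} {τ : STy} (d : LDeriv Θ M τ) :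
    ∀ {Θ' : List STy} (θ θ' : ℕ → LTm) (_ : ∀ n σ, Θ[n]? = some σ → LamC Θ' (θ n) (θ' n) σ),
    LamC Θ' (M.psubst θ) (M.psubst θ') τ := by
  induction d with
  | var _ n σ h => exact fun θ θ' hθ => hθ n σ h
  | unit => exact fun θ θ' hθ => .refl (.unit _)
  | pair _ _ _ _ _ _ _ ih ih' => exact fun θ θ' hθ => .pair_cong (ih θ θ' hθ) (ih' θ θ' hθ)
  | fst _ _ _ _ _ ih => exact fun θ θ' hθ => .fst_cong (ih θ θ' hθ)
  | snd _ _ _ _ _ ih => exact fun θ θ' hθ => .snd_cong (ih θ θ' hθ)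
  | app _ _ _ _ _ _ _ ih ih' => exact fun θ θ' hθ => .app_cong (ih θ θ' hθ) (ih' θ θ' hθ)
  | lam _ _ σ _ _ ih =>
    intro Θ' θ θ' hθ
    rw [LTm.psubst_lam, LTm.psubst_lam]
    refine .lam_cong (ih _ _ ?_)
    rintro (_ | n) τ h
    · exact .refl (.var _ _ _ h)
    · exact (hθ n τ h).shift σ

theorem LDeriv.psubst_congr {Θ : List STy} {M : LTm} {τ : STy} (d : LDeriv Θ M τ) :
    ∀ (θ θ' : ℕ → LTm) (_ : ∀ n σ, Θ[n]? = some σ → θ n = θ' n),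
    M.psubst θ = M.psubst θ' := by
  induction d with
  | var _ n σ h => exact fun θ θ' hθ => hθ n σ h
  | unit => exact fun θ θ' hθ => rfl
  | pair _ _ _ _ _ _ _ ih ih' =>
    exact fun θ θ' hθ => congrArg₂ LTm.pair (ih θ θ' hθ) (ih' θ θ' hθ)
  | fst _ _ _ _ _ ih => exact fun θ θ' hθ => congrArg LTm.fst (ih θ θ' hθ)
  | snd _ _ _ _ _ ih => exact fun θ θ' hθ => congrArg LTm.snd (ih θ θ' hθ)
  | app _ _ _ _ _ _ _ ih ih' =>
    exact fun θ θ' hθ => congrArg₂ LTm.app (ih θ θ' hθ) (ih' θ θ' hθ)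
  | lam _ _ σ _ _ ih =>
    intro θ θ' hθ
    rw [LTm.psubst_lam, LTm.psubst_lam, ih]
    rintro (_ | n) τ h
    · rfl
    · exact congrArg LTm.shift (hθ n τ h)

theorem LTm.subst0_var_rename (M : LTm) :
    LTm.subst0 (.var 0) (M.rename (Tm.liftN Nat.succ)) = M := by
  rw [LTm.subst0_eq, LTm.psubst_rename]
  convert LTm.psubst_var M using 2
  funext n
  cases n <;> rfl

/-- Equality of abstractions implies equality of their bodies. -/
theorem LamC.of_lam {Θ : List STy} {M N : LTm} {σ τ : STy} (d : LDeriv (σ :: Θ) M τ)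
    (e : LDeriv (σ :: Θ) N τ) (h : LamC Θ (.lam σ M) (.lam σ N) (.arr σ τ)) :
    LamC (σ :: Θ) M N τ := by
  have key : ∀ {M : LTm}, LDeriv (σ :: Θ) M τ →
      LamC (σ :: Θ) (.app (.shift (.lam σ M)) (.var 0)) M τ := by
    intro M d
    have := LamC.beta_v (d.rename (Θ' := σ :: σ :: Θ) (Tm.liftN Nat.succ)
      (liftN_typed _ fun _ _ h => h)) (.var0 _ _) (.var 0)
    rwa [LTm.subst0_var_rename] at this
  exact (key d).symm.trans ((LamC.app_cong (h.shift σ) (.refl (.var0 _ _))).trans (key e))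

/-- Surjective pairing for the innermost variable, in sequenced form. -/
theorem LamC.prod_expand {w : List STy} {G : LTm} {σ τ ρ : STy}
    (d : LDeriv (.prod σ τ :: w) G ρ) :
    LamC (.prod σ τ :: w) G
      (.app (.lam σ (.app (.lam τ ((G.psubst (LTm.scons (.pair (.var 1) (.var 0))
        fun n => .var (n + 2))).rename (Tm.liftN (Tm.liftN Nat.succ)))) (.snd (.var 1))))
        (.fst (.var 0))) ρ := by
  have lift : ∀ {Θ Θ' : List STy} {M : LTm} {α β : STy}, LDeriv (α :: Θ) M β →
      (∀ n α, Θ[n]? = some α → Θ'[n + 1]? = some α) →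
      LDeriv (α :: Θ') (M.rename (Tm.liftN Nat.succ)) β :=
    fun d h => d.rename _ (liftN_typed _ h)
  have d₁ : LDeriv (.prod σ τ :: .prod σ τ :: w) (G.rename (Tm.liftN Nat.succ)) ρ :=
    lift d fun _ _ h => h
  have d₂ : LDeriv (.prod σ τ :: σ :: .prod σ τ :: w) _ ρ := lift d₁ fun _ _ h => h
  have d₃ : LDeriv (.prod σ τ :: τ :: σ :: .prod σ τ :: w) _ ρ := lift d₂ fun _ _ h => h
  have h₁ := LamC.beta_v d₁ (.var0 _ _) (.var 0)
  rw [LTm.subst0_var_rename] at h₁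
  have hfst : LDeriv (.prod σ τ :: w) (.fst (.var 0)) σ := .fst _ _ _ _ (.var0 _ _)
  have hsnd : LDeriv (.prod σ τ :: w) (.snd (.var 0)) τ := .snd _ _ _ _ (.var0 _ _)
  have h₂ := (LamC.pair_eta_v (.var 0) (.var0 w (.prod σ τ))).symm.trans
    (LamC.pair_left hfst hsnd)
  refine h₁.symm.trans ((LamC.app_cong (.refl (.lam _ _ _ _ d₁)) h₂).trans
    ((LamC.let_assoc d₁ (.pair _ _ _ _ _ (.var0 _ _) (hsnd.shift σ)) hfst).trans
    (.app_cong (.lam_cong ?_) (.refl hfst))))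
  refine (LamC.app_cong (.refl (.lam _ _ _ _ d₂))
    (LamC.pair_right (.var 0) (.var0 _ _) (hsnd.shift σ))).trans
    ((LamC.let_assoc d₂ (.pair _ _ _ _ _ ((LDeriv.var0 _ _).shift _) (.var0 _ _))
    (hsnd.shift σ)).trans (.app_cong (.lam_cong ?_) (.refl (hsnd.shift σ))))
  have h₃ := LamC.beta_v d₃ (.pair _ _ _ _ _ ((LDeriv.var0 _ σ).shift τ) (.var0 _ _))
    (.pair (.var _) (.var _))
  refine Eq.mp ?_ h₃
  congr 1
  rw [LTm.subst0_eq, LTm.psubst_rename, LTm.psubst_rename, LTm.psubst_rename, LTm.rename_psubst]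
  congr 1
  funext n
  cases n <;> rfl

/-! ### A Kripke logical relation between the model and the computational λ-calculus -/

/-- The equivalence class of a term in the computational λ-calculus. -/
def cls (w : List STy) (ρ : STy) (M : LTm) : Set LTm := {N | LamC w M N ρ}

theorem cls_eq {w : List STy} {ρ : STy} {M N : LTm} (h : LamC w M N ρ) :
    cls w ρ M = cls w ρ N :=
  Set.ext fun _ => ⟨h.symm.trans, h.trans⟩

/-- Lifting of a relation on values to computations. -/
def RelC {X : Type} (R : List STy → X → LTm → Prop) (τ : STy) (w : List STy)
    (m : (X → Ans) → Ans) (M : LTm) : Prop :=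
  ∀ w', w <+: w' → ∀ (ρ : STy) (k : X → Ans) (K : LTm), Nonempty (LDeriv (τ :: w') K ρ) →
    (∀ w'', w' <+: w'' → ∀ v V, R w'' v V → k v ρ w'' = cls w'' ρ (.app (.lam τ K) V)) →
    m k ρ w' = cls w' ρ (.app (.lam τ K) M)

/-- The logical relation on values. -/
def Rel : (σ : STy) → List STy → Mean Ans (cbvT σ) → LTm → Prop
  | .base a, w, v, W => v = W ∧ LVal W ∧ Nonempty (LDeriv w W (.base a))
  | .unit, _, _, W => W = .unit
  | .prod σ τ, w, v, W => ∃ W₁ W₂, W = .pair W₁ W₂ ∧ Rel σ w v.1 W₁ ∧ Rel τ w v.2 W₂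
  | .arr σ τ, w, f, W => LVal W ∧ Nonempty (LDeriv w W (.arr σ τ)) ∧
      ∀ w', w <+: w' → ∀ v V, Rel σ w' v V → RelC (Rel τ) τ w' (f v) (.app W V)

theorem Rel.typed : ∀ {σ : STy} {w : List STy} {v : Mean Ans (cbvT σ)} {V : LTm},
    Rel σ w v V → LVal V ∧ Nonempty (LDeriv w V σ)
  | .base _, _, _, _, h => h.2
  | .unit, _, _, _, h => by cases h; exact ⟨.unit, ⟨.unit _⟩⟩
  | .prod σ τ, _, _, _, h => by
    obtain ⟨_, _, rfl, h₁, h₂⟩ := h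
    obtain ⟨hV, ⟨d⟩⟩ := Rel.typed h₁
    obtain ⟨hW, ⟨e⟩⟩ := Rel.typed h₂
    exact ⟨.pair hV hW, ⟨.pair _ _ _ _ _ d e⟩⟩
  | .arr _ _, _, _, _, h => ⟨h.1, h.2.1⟩

theorem RelC.mono {X : Type} {R : List STy → X → LTm → Prop} {τ : STy} {w w' : List STy}
    {m : (X → Ans) → Ans} {M : LTm} (h : RelC R τ w m M) (hw : w <+: w') : RelC R τ w' m M :=
  fun w'' hw' => h w'' (hw.trans hw')

theorem Rel.mono : ∀ {σ : STy} {w w' : List STy} {v : Mean Ans (cbvT σ)} {V : LTm},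
    Rel σ w v V → w <+: w' → Rel σ w' v V
  | .base _, _, _, _, _, ⟨h₁, h₂, ⟨d⟩⟩, hw => ⟨h₁, h₂, ⟨d.mono hw⟩⟩
  | .unit, _, _, _, _, h, _ => h
  | .prod _ _, _, _, _, _, ⟨V, W, h, h₁, h₂⟩, hw => ⟨V, W, h, Rel.mono h₁ hw, Rel.mono h₂ hw⟩
  | .arr _ _, _, _, _, _, ⟨h₁, ⟨d⟩, h⟩, hw =>
    ⟨h₁, ⟨d.mono hw⟩, fun w'' hw' => h w'' (hw.trans hw')⟩

theorem RelC.conv {X : Type} {R : List STy → X → LTm → Prop} {τ : STy} {w : List STy}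
    {m : (X → Ans) → Ans} {M N : LTm} (h : RelC R τ w m M) (hM : LamC w M N τ) :
    RelC R τ w m N := by
  rintro w' hw ρ k K ⟨d⟩ hk
  rw [h w' hw ρ k K ⟨d⟩ hk]
  exact cls_eq (.app_cong (.refl (.lam _ _ _ _ d)) (hM.mono hw))

theorem RelC.pure {X : Type} {R : List STy → X → LTm → Prop} {τ : STy} {w : List STy}
    {v : X} {V : LTm} (hR : ∀ w', w <+: w' → R w' v V) : RelC R τ w (fun k => k v) V :=
  fun w' hw _ _ _ _ hk => hk w' (List.prefix_refl _) v V (hR w' hw)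

theorem RelC.bind {X Y : Type} {R : List STy → X → LTm → Prop} {S : List STy → Y → LTm → Prop}
    {σ τ : STy} {w : List STy} {m : (X → Ans) → Ans} {n : X → (Y → Ans) → Ans} {M N : LTm}
    (hM : RelC R σ w m M) (dM : LDeriv w M σ) (dN : LDeriv (σ :: w) N τ)
    (hR : ∀ w' v V, R w' v V → Nonempty (LDeriv w' V σ))
    (hN : ∀ w', w <+: w' → ∀ v V, R w' v V → RelC S τ w' (n v) (.app (.lam σ N) V)) :
    RelC S τ w (fun k => m fun a => n a k) (.app (.lam σ N) M) := by
  rintro w' hw ρ k K ⟨d⟩ hk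
  have dK : LDeriv (σ :: w') (.app (.lam τ (K.rename (Tm.liftN Nat.succ))) N) ρ :=
    .app _ _ _ _ _ (.lam _ _ _ _ (d.rename _ (liftN_typed _ fun _ _ h => h)))
      (dN.mono (cons_prefix hw σ))
  show m (fun a => n a k) ρ w' = _
  rw [hM w' hw ρ _ _ ⟨dK⟩]
  · exact cls_eq (LamC.let_assoc d (dN.mono (cons_prefix hw σ)) (dM.mono hw)).symm
  · intro w'' hw' v V hV
    obtain ⟨dV⟩ := hR _ _ _ hV
    rw [hN w'' (hw.trans hw') v V hV w'' (List.prefix_refl _) ρ k K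
      ⟨d.mono (cons_prefix hw' τ)⟩ fun w₃ hw₃ => hk w₃ (hw'.trans hw₃)]
    exact cls_eq (LamC.let_assoc (d.mono (cons_prefix hw' τ))
      (dN.mono (cons_prefix (hw.trans hw') σ)) dV)

theorem sem_shift {Γ : List VType} {Δ : Option CType} {t : Tm} {A : VType}
    (d : Deriv Γ Δ t A) (B : VType) (ρ : Env Γ) (b : Mean Ans B) :
    sem (d.shift B) (ρ.cons b) = sem d ρ := by
  obtain ⟨d', h⟩ := d.exists_shift B
  rw [Deriv.sem_eq (d.shift B) d', h]

theorem RelC.bind_val {Y : Type} {S : List STy → Y → LTm → Prop}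
    {σ τ : STy} {w : List STy} {m : (Mean Ans (cbvT σ) → Ans) → Ans}
    {n : Mean Ans (cbvT σ) → (Y → Ans) → Ans} {M N : LTm}
    (hM : RelC (Rel σ) σ w m M) (dM : LDeriv w M σ) (dN : LDeriv (σ :: w) N τ)
    (hN : ∀ w', w <+: w' → ∀ v V, Rel σ w' v V → RelC S τ w' (n v) (LTm.subst0 V N)) :
    RelC S τ w (fun k => m fun a => n a k) (.app (.lam σ N) M) :=
  hM.bind dM dN (fun _ _ _ h => h.typed.2) fun w' hw v V h => by
    obtain ⟨hV, ⟨dV⟩⟩ := h.typed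
    exact (hN w' hw v V h).conv (LamC.beta_v (dN.mono (cons_prefix hw σ)) dV hV).symm

theorem LTm.subst0_shift (V M : LTm) : LTm.subst0 V M.shift = M := by
  rw [LTm.subst0_eq, LTm.psubst_shift, LTm.psubst_var]

theorem RelC.pair {σ τ : STy} {w : List STy} {m : (Mean Ans (cbvT σ) → Ans) → Ans}
    {n : (Mean Ans (cbvT τ) → Ans) → Ans} {M N : LTm} (hM : RelC (Rel σ) σ w m M)
    (hN : RelC (Rel τ) τ w n N) (dM : LDeriv w M σ) (dN : LDeriv w N τ) :
    RelC (Rel (.prod σ τ)) (.prod σ τ) w (fun k => m fun a => n fun b => k (a, b))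
      (.pair M N) := by
  refine RelC.conv (RelC.bind_val (n := fun a k => n fun b => k (a, b)) hM dM
    (.pair _ _ _ _ _ (.var0 _ _) (dN.shift σ)) ?_) (LamC.pair_left dM dN).symm
  intro w' hw v V h
  obtain ⟨hV, ⟨dV⟩⟩ := h.typed
  show RelC _ _ _ _ (.pair V (LTm.subst0 V N.shift))
  rw [LTm.subst0_shift]
  refine RelC.conv (RelC.bind_val (n := fun b k => k (v, b)) (hN.mono hw) (dN.mono hw)
    (.pair _ _ _ _ _ (dV.shift τ) (.var0 _ _)) ?_) (LamC.pair_right hV dV (dN.mono hw)).symm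
  intro w'' hw' v' V' h'
  show RelC _ _ _ _ (.pair (LTm.subst0 V' V.shift) V')
  rw [LTm.subst0_shift]
  exact RelC.pure fun w₃ hw₃ => ⟨V, V', rfl, h.mono (hw'.trans hw₃), h'.mono hw₃⟩

theorem RelC.app {σ τ : STy} {w : List STy} {m : (Mean Ans (cbvT (.arr σ τ)) → Ans) → Ans}
    {n : (Mean Ans (cbvT σ) → Ans) → Ans} {M N : LTm} (hM : RelC (Rel (.arr σ τ)) (.arr σ τ) w m M)
    (hN : RelC (Rel σ) σ w n N) (dM : LDeriv w M (.arr σ τ)) (dN : LDeriv w N σ) :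
    RelC (Rel τ) τ w (fun k => m fun a => n fun b => a b k) (.app M N) := by
  refine RelC.conv (RelC.bind_val (σ := .arr σ τ) (n := fun a k => n fun b => a b k) hM dM
    (.app _ _ _ _ _ (.var0 _ _) (dN.shift _)) ?_) (LamC.app_left dM dN).symm
  intro w' hw v V h
  obtain ⟨hV, ⟨dV⟩⟩ := h.typed
  show RelC _ _ _ _ (.app V (LTm.subst0 V N.shift))
  rw [LTm.subst0_shift]
  refine RelC.conv (RelC.bind_val (n := fun b k => v b k) (hN.mono hw) (dN.mono hw)
    (.app _ _ _ _ _ (dV.shift σ) (.var0 _ _)) ?_) (LamC.app_right hV dV (dN.mono hw)).symm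
  intro w'' hw' v' V' h'
  show RelC _ _ _ _ (.app (LTm.subst0 V' V.shift) V')
  rw [LTm.subst0_shift]
  exact h.2.2 w'' hw' v' V' h'

theorem RelC.fst {σ τ : STy} {w : List STy} {m : (Mean Ans (cbvT (.prod σ τ)) → Ans) → Ans}
    {M : LTm} (hM : RelC (Rel (.prod σ τ)) (.prod σ τ) w m M) (dM : LDeriv w M (.prod σ τ)) :
    RelC (Rel σ) σ w (fun k => m fun a => k a.1) (.fst M) := by
  refine RelC.conv (RelC.bind_val (σ := .prod σ τ) (n := fun a k => k a.1) hM dM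
    (.fst _ _ _ _ (.var0 _ _)) ?_) (LamC.fst_cc dM).symm
  rintro w' hw v _ ⟨V, W, rfl, h, h'⟩
  obtain ⟨hV, ⟨dV⟩⟩ := h.typed
  obtain ⟨hW, ⟨dW⟩⟩ := h'.typed
  exact RelC.conv (RelC.pure fun w₃ hw₃ => h.mono hw₃) (LamC.fst_beta_v hV hW dV dW).symm

theorem RelC.snd {σ τ : STy} {w : List STy} {m : (Mean Ans (cbvT (.prod σ τ)) → Ans) → Ans}
    {M : LTm} (hM : RelC (Rel (.prod σ τ)) (.prod σ τ) w m M) (dM : LDeriv w M (.prod σ τ)) :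
    RelC (Rel τ) τ w (fun k => m fun a => k a.2) (.snd M) := by
  refine RelC.conv (RelC.bind_val (σ := .prod σ τ) (n := fun a k => k a.2) hM dM
    (.snd _ _ _ _ (.var0 _ _)) ?_) (LamC.snd_cc dM).symm
  rintro w' hw v _ ⟨V, W, rfl, h, h'⟩
  obtain ⟨hV, ⟨dV⟩⟩ := h.typed
  obtain ⟨hW, ⟨dW⟩⟩ := h'.typed
  exact RelC.conv (RelC.pure fun w₃ hw₃ => h'.mono hw₃) (LamC.snd_beta_v hV hW dV dW).symm

/-- Fundamental lemma of the logical relation. -/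
theorem LDeriv.relC {Θ : List STy} {M : LTm} {τ : STy} (d : LDeriv Θ M τ) :
    ∀ {w : List STy} (ρ : Env (cbvCtx Θ)) (θ : ℕ → LTm)
    (_ : ∀ n σ (h : Θ[n]? = some σ), Rel σ w (ρ n _ (cbvCtx_lookup h)) (θ n)),
    RelC (Rel τ) τ w (sem d.cbv ρ) (M.psubst θ) := by
  have typed : ∀ {Θ : List STy} {w : List STy} {ρ : Env (cbvCtx Θ)} {θ : ℕ → LTm}
      (_ : ∀ n σ (h : Θ[n]? = some σ), Rel σ w (ρ n _ (cbvCtx_lookup h)) (θ n)) n σ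
      (_ : Θ[n]? = some σ), LDeriv w (θ n) σ :=
    fun hθ n σ h => (hθ n σ h).typed.2.some
  induction d with
  | var _ n σ h => exact fun ρ θ hθ => RelC.pure fun w' hw => (hθ n σ h).mono hw
  | unit => exact fun ρ θ hθ => RelC.pure fun w' hw => rfl
  | pair _ _ _ _ _ d e ih ih' =>
    intro w ρ θ hθ
    have := (ih ρ θ hθ).pair (ih' ρ θ hθ) (d.psubst θ (typed hθ)) (e.psubst θ (typed hθ))
    refine Eq.mp (congrArg (fun m => RelC _ _ _ m _) ?_) this
    refine funext fun k => congrArg (sem d.cbv ρ) (funext fun a => ?_)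
    rw [← sem_shift e.cbv _ ρ a]
    rfl
  | fst _ _ _ _ d ih => exact fun ρ θ hθ => (ih ρ θ hθ).fst (d.psubst θ (typed hθ))
  | snd _ _ _ _ d ih => exact fun ρ θ hθ => (ih ρ θ hθ).snd (d.psubst θ (typed hθ))
  | app _ _ _ _ _ d e ih ih' =>
    intro w ρ θ hθ
    have := (ih ρ θ hθ).app (ih' ρ θ hθ) (d.psubst θ (typed hθ)) (e.psubst θ (typed hθ))
    refine Eq.mp (congrArg (fun m => RelC _ _ _ m _) ?_) this
    refine funext fun k => congrArg (sem d.cbv ρ) (funext fun a => ?_)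
    rw [← sem_shift e.cbv _ ρ a]
    rfl
  | lam _ M σ τ d ih =>
    intro w ρ θ hθ
    have dM := (LDeriv.lam _ _ _ _ d).psubst θ (typed hθ)
    refine RelC.pure fun w' hw => ⟨.lam _ _, ⟨dM.mono hw⟩, fun w'' hw' v V hV => ?_⟩
    obtain ⟨hv, ⟨dV⟩⟩ := hV.typed
    have dL : LDeriv w'' _ _ := (dM.mono hw).mono hw'
    rw [LTm.psubst_lam] at dL ⊢
    rcases dL with _ | _ | _ | _ | _ | ⟨_, _, _, _, dL⟩
    refine RelC.conv ?_ (LamC.beta_v dL dV hv).symm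
    rw [LTm.subst0_psubst_liftS]
    refine ih (ρ.cons v) _ ?_
    rintro (_ | n) α h
    · cases h; exact hV
    · exact (hθ n α h).mono (hw.trans hw')

/-- The relation is functional up to provable equality. -/
def Funct (σ : STy) : Prop :=
  ∀ w v V V', Rel σ w v V → Rel σ w v V' → LamC w V V' σ

/-- Enough values are related for equality of open terms to be tested on them. -/
def Surj (σ : STy) : Prop :=
  ∀ w ρ G G', LDeriv (σ :: w) G ρ → LDeriv (σ :: w) G' ρ →
    (∀ w', w <+: w' → ∀ v V, Rel σ w' v V → LamC w' (LTm.subst0 V G) (LTm.subst0 V G') ρ) →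
    LamC (σ :: w) G G' ρ

theorem Funct.comp {τ : STy} (hτ : Funct τ) {w : List STy} {m : (Mean Ans (cbvT τ) → Ans) → Ans}
    {M M' : LTm} (h : RelC (Rel τ) τ w m M) (h' : RelC (Rel τ) τ w m M') (d : LDeriv w M τ)
    (d' : LDeriv w M' τ) : LamC w M M' τ := by
  let k : Mean Ans (cbvT τ) → Ans := fun v _ w => {N | ∃ V, Rel τ w v V ∧ LamC w V N τ}
  have hk : ∀ w' v V, Rel τ w' v V → k v τ w' = cls w' τ (.app (.lam τ (.var 0)) V) := by
    intro w' v V hV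
    rw [cls_eq (LamC.let_eta hV.typed.2.some)]
    exact Set.ext fun N => ⟨fun ⟨V', hV', h⟩ => (hτ _ _ _ _ hV hV').trans h, fun h => ⟨V, hV, h⟩⟩
  have e := (h w (List.prefix_refl _) τ k (.var 0) ⟨.var0 _ _⟩ fun w' _ => hk w').symm.trans
    (h' w (List.prefix_refl _) τ k (.var 0) ⟨.var0 _ _⟩ fun w' _ => hk w')
  rw [cls_eq (LamC.let_eta d), cls_eq (LamC.let_eta d')] at e
  have : M' ∈ cls w τ M := e ▸ LamC.refl d'
  exact this

theorem lookup_last {X : Type} (w : List X) (x : X) : (w ++ [x])[w.length]? = some x := by simp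

/-- The renaming which makes the outermost variable, with index `m`, the innermost one. -/
def cycle (m j : ℕ) : ℕ := if j = m then 0 else j + 1

theorem cycle_of_lookup {X : Type} {w : List X} {n : ℕ} {x : X} (h : w[n]? = some x) :
    cycle w.length n = n + 1 :=
  if_neg (List.getElem?_eq_some_iff.mp h).1.ne

theorem cycle_typed {X : Type} (w : List X) (y : X) :
    ∀ n x, (w ++ [y])[n]? = some x → (y :: w)[cycle w.length n]? = some x := by
  intro n x hn
  by_cases e : n = w.length
  · subst e; simpa [cycle] using hn
  · have : n < w.length := by
      have := (List.getElem?_eq_some_iff.mp hn).1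
      simp at this; omega
    rw [List.getElem?_append_left this] at hn
    simpa [cycle, e] using hn

/-- Equality of open terms can be tested on a fresh outermost variable. -/
theorem LamC.of_fresh {w : List STy} {σ ρ : STy} {G G' : LTm} (d : LDeriv (σ :: w) G ρ)
    (d' : LDeriv (σ :: w) G' ρ) (h : LamC (w ++ [σ]) (LTm.subst0 (.var w.length) G)
      (LTm.subst0 (.var w.length) G') ρ) : LamC (σ :: w) G G' ρ := by
  have key : ∀ {G : LTm}, LDeriv (σ :: w) G ρ →
      (LTm.subst0 (.var w.length) G).rename (cycle w.length) = G := by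
    intro G d
    rw [LTm.subst0_eq, LTm.rename_psubst]
    conv_rhs => rw [← LTm.psubst_var G]
    refine d.psubst_congr _ _ ?_
    rintro (_ | n) α hn
    · simp [LTm.rename, cycle]
    · simp [LTm.rename, cycle_of_lookup (show w[n]? = some α from hn)]
  have := h.rename _ (cycle_typed w σ)
  rwa [key d, key d'] at this

theorem Surj.base (a : ℕ) : Surj (.base a) := by
  intro w ρ G G' d d' h
  refine LamC.of_fresh d d' (h _ (List.prefix_append _ _) (.var w.length) (.var w.length) ?_)
  exact ⟨rfl, .var _, ⟨.var _ _ _ (lookup_last _ _)⟩⟩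

theorem Surj.unit : Surj .unit := by
  intro w ρ G G' d d' h
  have key : ∀ {G : LTm}, LDeriv (.unit :: w) G ρ →
      LamC (.unit :: w) (LTm.subst0 .unit G).shift G ρ := by
    intro G d
    rw [LTm.subst0_eq, LTm.shift, LTm.rename_psubst]
    conv => arg 3; rw [← LTm.psubst_var G]
    refine LamC.psubst_cong d _ _ ?_
    rintro (_ | n) α hn
    · cases hn
      exact (LamC.unit_eta_v (.var 0) (.var0 _ _)).symm
    · exact .refl (.var _ _ _ hn)
  exact (key d).symm.trans (((h w (List.prefix_refl _) () .unit rfl).shift _).trans (key d'))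

/-- Splitting the innermost variable of product type into its components. -/
noncomputable def LDeriv.split {w : List STy} {σ τ ρ : STy} {G : LTm}
    (d : LDeriv (.prod σ τ :: w) G ρ) :
    LDeriv (τ :: σ :: w) (G.psubst (LTm.scons (.pair (.var 1) (.var 0)) fun n => .var (n + 2))) ρ :=
  d.psubst _ (.scons (.pair _ _ _ _ _ (.var _ _ _ rfl) (.var0 _ _)) fun _ _ h => .var _ _ _ h)

theorem Surj.prod {σ τ : STy} (hσ : Surj σ) (hτ : Surj τ) : Surj (.prod σ τ) := by
  intro w ρ G G' d d' h
  have key : LamC (σ :: w) (.lam τ (G.psubst (LTm.scons (.pair (.var 1) (.var 0)) fun n => .var (n + 2))))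
      (.lam τ (G'.psubst (LTm.scons (.pair (.var 1) (.var 0)) fun n => .var (n + 2)))) (.arr τ ρ) := by
    refine hσ _ _ _ _ (.lam _ _ _ _ d.split) (.lam _ _ _ _ d'.split) ?_
    intro w' hw v V hV
    have dV := hV.typed.2.some
    have dS : ∀ {G : LTm}, LDeriv (.prod σ τ :: w) G ρ →
        LDeriv w' (LTm.subst0 V (.lam τ (G.psubst (LTm.scons (.pair (.var 1) (.var 0))
          fun n => .var (n + 2))))) (.arr τ ρ) := fun d =>
      ((LDeriv.lam _ _ _ _ d.split).mono (cons_prefix hw σ)).subst0 dV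
    have e := dS d
    have e' := dS d'
    rw [LTm.subst0_eq, LTm.psubst_lam] at e e'
    rw [LTm.subst0_eq, LTm.psubst_lam, LTm.subst0_eq, LTm.psubst_lam]
    rcases e with _ | _ | _ | _ | _ | ⟨_, _, _, _, e⟩
    rcases e' with _ | _ | _ | _ | _ | ⟨_, _, _, _, e'⟩
    refine .lam_cong (hτ _ _ _ _ e e' ?_)
    intro w'' hw' v' V' hV'
    have := h w'' (hw.trans hw') (v, v') (.pair V V') ⟨V, V', rfl, hV.mono hw', hV'⟩
    rw [LTm.subst0_psubst_liftS, LTm.subst0_psubst_liftS, LTm.psubst_psubst, LTm.psubst_psubst]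
    rw [LTm.subst0_eq, LTm.subst0_eq] at this
    convert this using 2 <;> · funext n; cases n <;> rfl
  have key' := LamC.of_lam d.split d'.split key
  have l : ∀ n α, (τ :: σ :: w)[n]? = some α →
      (τ :: σ :: .prod σ τ :: w)[Tm.liftN (Tm.liftN Nat.succ) n]? = some α :=
    liftN_typed _ (liftN_typed _ fun _ _ h => h)
  have dS : LDeriv (σ :: .prod σ τ :: w) (.snd (.var 1)) τ :=
    .snd _ _ _ _ (.var _ _ _ rfl)
  exact (LamC.prod_expand d).trans ((LamC.app_cong (.lam_cong (.app_cong (.lam_cong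
    (key'.rename _ l)) (.refl dS))) (.refl (.fst _ _ _ _ (.var0 _ _)))).trans
    (LamC.prod_expand d').symm)

theorem Surj.arr {σ τ : STy} (fσ : Funct σ) (sτ : Surj τ) : Surj (.arr σ τ) := by
  intro w ρ G G' d d' h
  let x : LTm := .var w.length
  have dx : LDeriv (w ++ [.arr σ τ]) x (.arr σ τ) := .var _ _ _ (lookup_last _ _)
  let R (K : LTm) (k : Mean Ans (cbvT τ) → Ans) (ρ : STy) (w' : List STy) : Prop :=
    ∀ w'', w' <+: w'' → ∀ v V, Rel τ w'' v V → k v ρ w'' = cls w'' ρ (.app (.lam τ K) V)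
  let f : Mean Ans (cbvT σ) → (Mean Ans (cbvT τ) → Ans) → Ans := fun v k ρ w' =>
    {N | ∃ V K, Rel σ w' v V ∧ Nonempty (LDeriv (τ :: w') K ρ) ∧ R K k ρ w' ∧
      w ++ [.arr σ τ] <+: w' ∧ LamC w' (.app (.lam τ K) (.app x V)) N ρ}
  refine LamC.of_fresh d d' (h _ (List.prefix_append _ _) f x ⟨.var _, ⟨dx⟩, ?_⟩)
  rintro w₁ hw₁ v V hV w₂ hw₂ ρ' k K ⟨dK⟩ hk
  refine Set.ext fun N => ⟨?_, fun hN => ⟨V, K, hV.mono hw₂, ⟨dK⟩, hk, hw₁.trans hw₂, hN⟩⟩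
  rintro ⟨V', K', hV', ⟨dK'⟩, hk', -, hN⟩
  refine LamC.trans (.app_cong (.lam_cong ?_) (.app_cong (.refl (dx.mono (hw₁.trans hw₂)))
    (fσ _ _ _ _ (hV.mono hw₂) hV'))) hN
  refine sτ _ _ _ _ dK dK' fun w₃ hw₃ u U hU => ?_
  obtain ⟨hv, ⟨dU⟩⟩ := hU.typed
  have b := LamC.beta_v (dK.mono (cons_prefix hw₃ τ)) dU hv
  have b' := LamC.beta_v (dK'.mono (cons_prefix hw₃ τ)) dU hv
  have e := (hk w₃ hw₃ u U hU).symm.trans (hk' w₃ hw₃ u U hU)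
  rw [cls_eq b, cls_eq b'] at e
  have : LTm.subst0 U K' ∈ cls w₃ ρ' (LTm.subst0 U K) :=
    e ▸ LamC.refl ((dK'.mono (cons_prefix hw₃ τ)).subst0 dU)
  exact this

theorem Funct.arr {σ τ : STy} (sσ : Surj σ) (fτ : Funct τ) : Funct (.arr σ τ) := by
  rintro w f V V' ⟨hV, ⟨dV⟩, h⟩ ⟨hV', ⟨dV'⟩, h'⟩
  have d : ∀ {V : LTm}, LDeriv w V (.arr σ τ) → LDeriv (σ :: w) (.app V.shift (.var 0)) τ :=
    fun d => .app _ _ _ _ _ (d.shift σ) (.var0 _ _)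
  refine (LamC.eta_v hV dV).symm.trans (LamC.trans (.lam_cong ?_) (LamC.eta_v hV' dV'))
  refine sσ _ _ _ _ (d dV) (d dV') fun w' hw v U hU => ?_
  have dU := hU.typed.2.some
  have e : ∀ V : LTm, LTm.subst0 U (.app V.shift (.var 0)) = .app V U := fun V =>
    congrArg (LTm.app · U) (LTm.subst0_shift U V)
  rw [e, e]
  exact fτ.comp (h w' hw v U hU) (h' w' hw v U hU) (.app _ _ _ _ _ (dV.mono hw) dU)
    (.app _ _ _ _ _ (dV'.mono hw) dU)

theorem funct_surj : ∀ σ : STy, Funct σ ∧ Surj σ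
  | .base a => ⟨fun _ _ _ _ h h' => by
      obtain ⟨rfl, -, ⟨d⟩⟩ := h
      obtain ⟨rfl, -⟩ := h'
      exact .refl d, .base a⟩
  | .unit => ⟨fun _ _ _ _ h h' => by
      cases h; cases h'
      exact .refl (.unit _), .unit⟩
  | .prod σ τ => ⟨fun _ _ _ _ h h' => by
      obtain ⟨_, _, rfl, h₁, h₂⟩ := h
      obtain ⟨_, _, rfl, h₁', h₂'⟩ := h'
      exact .pair_cong ((funct_surj σ).1 _ _ _ _ h₁ h₁') ((funct_surj τ).1 _ _ _ _ h₂ h₂'),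
      (funct_surj σ).2.prod (funct_surj τ).2⟩
  | .arr σ τ => ⟨.arr (funct_surj σ).2 (funct_surj τ).1, .arr (funct_surj σ).1 (funct_surj τ).2⟩

/-- Completeness of the call-by-value translation. -/
theorem LamC.of_cbv : ∀ {Θ : List STy} {M N : LTm} {τ : STy} (_ : LDeriv Θ M τ)
    (_ : LDeriv Θ N τ) (_ : EEq (cbvCtx Θ) none (cbvTm M) (cbvTm N) (.comp (.bang (cbvT τ)))),
    LamC Θ M N τ
  | [], M, N, τ, d, e, h => by
    have key : ∀ {M : LTm} (d : LDeriv [] M τ) (ρ : Env (cbvCtx [])),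
        RelC (Rel τ) τ [] (sem d.cbv ρ) M := by
      intro M d ρ
      have := d.relC (w := []) ρ .var fun n σ h => by simp at h
      rwa [LTm.psubst_var] at this
    let ρ : Env (cbvCtx []) := fun n A h => by simp [cbvCtx] at h
    obtain ⟨d', e', h⟩ := h.exists_sem
    refine (funct_surj τ).1.comp (key d ρ) ?_ d e
    have : sem d.cbv ρ = sem e.cbv ρ :=
      (Deriv.sem_eq _ d' ρ).trans ((h ρ).trans (Deriv.sem_eq e' _ ρ))
    rw [this]
    exact key e ρ
  | σ :: Θ, M, N, τ, d, e, h => by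
    exact LamC.of_lam d e (LamC.of_cbv (.lam _ _ _ _ d) (.lam _ _ _ _ e)
      (.bang_cong (.vlam_cong h)))

/-! ### Substitution lemmas for terms with a stoup -/

/-- Renamings are only relevant on the variables in the context. -/
theorem Deriv.rename_congr {Γ : List VType} {Δ : Option CType} {t : Tm} {A : VType}
    (d : Deriv Γ Δ t A) : ∀ (f g : ℕ → ℕ) (_ : ∀ n A, Γ[n]? = some A → f n = g n),
    t.rename f = t.rename g := by
  have l : ∀ {Γ : List VType} {f g : ℕ → ℕ} (B : VType),
      (∀ n A, Γ[n]? = some A → f n = g n) →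
      ∀ n A, (B :: Γ)[n]? = some A → Tm.liftN f n = Tm.liftN g n := by
    rintro Γ f g B h (_ | n) A hn
    · rfl
    · exact congrArg Nat.succ (h n A hn)
  induction d with
  | var _ n A h => exact fun f g hfg => congrArg Tm.var (hfg n A h)
  | svar | unit | cunit | top => exact fun f g hfg => rfl
  | vlam _ _ A _ _ ih | clam _ _ _ A _ _ ih =>
    intro f g hfg
    simp only [Tm.rename]
    rw [ih _ _ (l A hfg)]
  | banglet _ _ _ _ A _ _ _ ih ih' | copowlet _ _ _ _ A _ _ _ _ ih ih' =>
    intro f g hfg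
    simp only [Tm.rename]
    rw [ih f g hfg, ih' _ _ (l A hfg)]
  | vpair _ _ _ _ _ _ _ ih ih' | vapp _ _ _ _ _ _ _ ih ih' | cpair _ _ _ _ _ _ _ _ ih ih'
  | capp _ _ _ _ _ _ _ _ ih ih' | ilet _ _ _ _ _ _ _ ih ih' | copow _ _ _ _ _ _ _ _ ih ih'
  | lapp _ _ _ _ _ _ _ _ ih ih' =>
    intro f g hfg
    simp only [Tm.rename, ih f g hfg, ih' f g hfg]
  | ccase _ _ _ _ _ _ _ _ _ _ _ ih ih' ih'' =>
    intro f g hfg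
    simp only [Tm.rename, ih f g hfg, ih' f g hfg, ih'' f g hfg]
  | vfst _ _ _ _ _ ih | vsnd _ _ _ _ _ ih | cfst _ _ _ _ _ _ ih | csnd _ _ _ _ _ _ ih
  | bang _ _ _ _ ih | cimage _ _ _ _ _ ih | cinl _ _ _ _ _ _ ih | cinr _ _ _ _ _ _ ih
  | llam _ _ _ _ _ ih =>
    intro f g hfg
    simp only [Tm.rename, ih f g hfg]

/-- Simultaneous substitution in derivations. -/
noncomputable def Deriv.psubst {Γ Γ' : List VType} {Δ : Option CType} {t : Tm} {A : VType}
    (d : Deriv Γ Δ t A) (σ : ℕ → Tm) (hσ : ∀ n A, Γ[n]? = some A → Deriv Γ' none (σ n) A) :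
    Deriv Γ' Δ (t.psubst σ) A :=
  (d.exists_psubst σ hσ).choose

/-- Typing of a lifted substitution. -/
noncomputable def Deriv.liftS {Γ Γ' : List VType} {σ : ℕ → Tm} (B : VType)
    (hσ : ∀ n A, Γ[n]? = some A → Deriv Γ' none (σ n) A) :
    ∀ n A, (B :: Γ)[n]? = some A → Deriv (B :: Γ') none (Tm.liftS σ n) A
  | 0, _, h => .var _ _ _ h
  | n + 1, A, h => (hσ n A h).shift B

/-- Substitution for the stoup variable in derivations. -/
noncomputable def Deriv.ssubst {Γ : List VType} {Δ : Option CType} {t u : Tm} {A B : CType}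
    (d : Deriv Γ (some A) t (.comp B)) (e : Deriv Γ Δ u (.comp A)) :
    Deriv Γ Δ (Tm.ssubst u t) (.comp B) :=
  (d.exists_ssubst e).choose

/-- Typing is preserved when the context is extended by outermost variables. -/
noncomputable def Deriv.mono {Γ Γ' : List VType} {Δ : Option CType} {t : Tm} {A : VType}
    (d : Deriv Γ Δ t A) (h : Γ <+: Γ') : Deriv Γ' Δ t A :=
  Tm.rename_id t ▸ d.rename id (List.IsPrefix.lookup h)

theorem EEq.mono {Γ Γ' : List VType} {Δ : Option CType} {t u : Tm} {A : VType}
    (e : EEq Γ Δ t u A) (h : Γ <+: Γ') : EEq Γ' Δ t u A := by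
  have := e.rename id (List.IsPrefix.lookup h)
  rwa [Tm.rename_id, Tm.rename_id] at this

theorem cbvCtx_prefix {w w' : List STy} (h : w <+: w') : cbvCtx w <+: cbvCtx w' :=
  h.map cbvT

/-! ### A Kripke logical predicate on EEC terms -/

/-- Computations equal to the translation of a λ-term. -/
def Pole (w : List STy) (τ : STy) (t : Tm) : Prop :=
  ∃ M, Nonempty (LDeriv w M τ) ∧ EEq (cbvCtx w) none (cbvTm M) t (.comp (.bang (cbvT τ)))

/-- Well-typed terms over a world. -/
def HT (w : List STy) (Δ : Option CType) (t : Tm) (A : VType) : Prop :=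
  Nonempty (Deriv (cbvCtx w) Δ t A)

mutual
  /-- The logical predicate on terms over a stoup `Δ`, relative to a predicate on the
  computations obtained by applying a stack. -/
  def Pred : VType → Option CType → (List STy → STy → Tm → Prop) → List STy → Tm → Prop
    | .base a, Δ, _, w, t => HT w Δ t (.base a) ∧ ∃ M, Nonempty (LDeriv w M (.base a)) ∧
        EEq (cbvCtx w) Δ (cbvTm M) (.bang t) (.comp (.bang (.base a)))
    | .unit, Δ, _, w, t => HT w Δ t .unit
    | .prod A B, Δ, _, w, t => HT w Δ t (.prod A B) ∧ Pred A none Pole w (.vfst t) ∧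
        Pred B none Pole w (.vsnd t)
    | .arr A B, Δ, _, w, t => HT w Δ t (.arr A B) ∧ ∀ w', w <+: w' → ∀ a,
        Pred A none Pole w' a → Pred B none Pole w' (.vapp t a)
    | .comp A, Δ, K, w, t => HT w Δ t (.comp A) ∧ ∀ w', w <+: w' → ∀ τ s,
        SPred A w' τ s → K w' τ (Tm.ssubst t s)
    | .lin A B, Δ, _, w, t => HT w Δ t (.lin A B) ∧ ∀ w', w <+: w' → ∀ τ s,
        SPred B w' τ s → SPred A w' τ (Tm.ssubst (.lapp t .svar) s)
  termination_by structural A => A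
  /-- The logical predicate on stacks. -/
  def SPred : CType → List STy → STy → Tm → Prop
    | .base _, _, _, _ => False
    | .cunit, _, _, _ => False
    | .cand A B, w, τ, s =>
        (∃ s', SPred A w τ s' ∧ EEq (cbvCtx w) (some (.cand A B)) (Tm.ssubst (.cfst .svar) s') s
          (.comp (.bang (cbvT τ)))) ∨
        ∃ s', SPred B w τ s' ∧ EEq (cbvCtx w) (some (.cand A B)) (Tm.ssubst (.csnd .svar) s') s
          (.comp (.bang (cbvT τ)))
    | .carr A B, w, τ, s => ∃ a s', Pred A none Pole w a ∧ SPred B w τ s' ∧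
        EEq (cbvCtx w) (some (.carr A B)) (Tm.ssubst (.capp .svar a) s') s
          (.comp (.bang (cbvT τ)))
    | .iunit, w, τ, s => HT w (some .iunit) s (.comp (.bang (cbvT τ))) ∧
        Pole w τ (Tm.ssubst .top s)
    | .bang A, w, τ, s => HT w (some (.bang A)) s (.comp (.bang (cbvT τ))) ∧
        ∀ w', w <+: w' → ∀ a, Pred A none Pole w' a → Pole w' τ (Tm.ssubst (.bang a) s)
    | .copow A B, w, τ, s => HT w (some (.copow A B)) s (.comp (.bang (cbvT τ))) ∧
        ∀ w', w <+: w' → ∀ a, Pred A none Pole w' a →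
          SPred B w' τ (Tm.ssubst (.copow a .svar) s)
    | .czero, w, τ, s => HT w (some .czero) s (.comp (.bang (cbvT τ)))
    | .csum A B, w, τ, s => HT w (some (.csum A B)) s (.comp (.bang (cbvT τ))) ∧
        SPred A w τ (Tm.ssubst (.cinl .svar) s) ∧ SPred B w τ (Tm.ssubst (.cinr .svar) s)
  termination_by structural A => A
end

/-- The predicate on computations over a stoup. -/
def SPole : Option CType → List STy → STy → Tm → Prop
  | none => Pole
  | some D => SPred D

theorem Pole.mono {w w' : List STy} {τ : STy} {t : Tm} (h : Pole w τ t) (hw : w <+: w') :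
    Pole w' τ t := by
  obtain ⟨M, ⟨d⟩, e⟩ := h
  exact ⟨M, ⟨d.mono hw⟩, e.mono (cbvCtx_prefix hw)⟩

theorem Pole.conv {w : List STy} {τ : STy} {t u : Tm} (h : Pole w τ t)
    (e : EEq (cbvCtx w) none t u (.comp (.bang (cbvT τ)))) : Pole w τ u := by
  obtain ⟨M, d, e'⟩ := h
  exact ⟨M, d, e'.trans e⟩

theorem HT.mono {w w' : List STy} {Δ : Option CType} {t : Tm} {A : VType} (h : HT w Δ t A)
    (hw : w <+: w') : HT w' Δ t A :=
  ⟨h.some.mono (cbvCtx_prefix hw)⟩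

theorem Pred.typed {A : VType} {Δ : Option CType} {K : List STy → STy → Tm → Prop}
    {w : List STy} {t : Tm} (h : Pred A Δ K w t) : HT w Δ t A := by
  cases A <;> first | exact h.1 | exact h

theorem SPred.typed {A : CType} {w : List STy} {τ : STy} {s : Tm} (h : SPred A w τ s) :
    HT w (some A) s (.comp (.bang (cbvT τ))) := by
  cases A with
  | base | cunit => exact h.elim
  | cand => rcases h with ⟨_, _, e⟩ | ⟨_, _, e⟩ <;> exact e.right
  | carr => obtain ⟨_, _, _, _, e⟩ := h; exact e.right
  | czero => exact h
  | iunit | bang | copow | csum => exact h.1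

mutual
  theorem Pred.mono : ∀ {A : VType} {Δ : Option CType} {K : List STy → STy → Tm → Prop}
      {w w' : List STy} {t : Tm}, Pred A Δ K w t → w <+: w' → Pred A Δ K w' t
    | .base _, _, _, _, _, _, h, hw => by
      obtain ⟨h, M, ⟨d⟩, e⟩ := h
      exact ⟨h.mono hw, M, ⟨d.mono hw⟩, e.mono (cbvCtx_prefix hw)⟩
    | .unit, _, _, _, _, _, h, hw => HT.mono h hw
    | .prod _ _, _, _, _, _, _, h, hw => ⟨h.1.mono hw, Pred.mono h.2.1 hw, Pred.mono h.2.2 hw⟩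
    | .arr _ _, _, _, _, _, _, h, hw => ⟨h.1.mono hw, fun w'' hw' => h.2 w'' (hw.trans hw')⟩
    | .comp _, _, _, _, _, _, h, hw => ⟨h.1.mono hw, fun w'' hw' => h.2 w'' (hw.trans hw')⟩
    | .lin _ _, _, _, _, _, _, h, hw => ⟨h.1.mono hw, fun w'' hw' => h.2 w'' (hw.trans hw')⟩
  theorem SPred.mono : ∀ {A : CType} {w w' : List STy} {τ : STy} {s : Tm},
      SPred A w τ s → w <+: w' → SPred A w' τ s
    | .base _, _, _, _, _, h, _ => h.elim
    | .cunit, _, _, _, _, h, _ => h.elim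
    | .cand _ _, _, _, _, _, h, hw => by
      rcases h with ⟨s', h, e⟩ | ⟨s', h, e⟩
      · exact .inl ⟨s', SPred.mono h hw, e.mono (cbvCtx_prefix hw)⟩
      · exact .inr ⟨s', SPred.mono h hw, e.mono (cbvCtx_prefix hw)⟩
    | .carr _ _, _, _, _, _, h, hw => by
      obtain ⟨a, s', ha, h, e⟩ := h
      exact ⟨a, s', Pred.mono ha hw, SPred.mono h hw, e.mono (cbvCtx_prefix hw)⟩
    | .iunit, _, _, _, _, h, hw => ⟨h.1.mono hw, h.2.mono hw⟩
    | .bang _, _, _, _, _, h, hw => ⟨h.1.mono hw, fun w'' hw' => h.2 w'' (hw.trans hw')⟩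
    | .copow _ _, _, _, _, _, h, hw => ⟨h.1.mono hw, fun w'' hw' => h.2 w'' (hw.trans hw')⟩
    | .czero, _, _, _, _, h, hw => HT.mono h hw
    | .csum _ _, _, _, _, _, h, hw => ⟨h.1.mono hw, SPred.mono h.2.1 hw, SPred.mono h.2.2 hw⟩
end

theorem SPred.conv : ∀ {A : CType} {w : List STy} {τ : STy} {s s' : Tm}, SPred A w τ s →
    EEq (cbvCtx w) (some A) s s' (.comp (.bang (cbvT τ))) → SPred A w τ s'
  | .base _, _, _, _, _, h, _ => h.elim
  | .cunit, _, _, _, _, h, _ => h.elim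
  | .cand _ _, _, _, _, _, h, e => by
    rcases h with ⟨s', h, e'⟩ | ⟨s', h, e'⟩
    · exact .inl ⟨s', h, e'.trans e⟩
    · exact .inr ⟨s', h, e'.trans e⟩
  | .carr _ _, _, _, _, _, h, e => by
    obtain ⟨a, s', ha, h, e'⟩ := h
    exact ⟨a, s', ha, h, e'.trans e⟩
  | .iunit, _, _, _, _, h, e => ⟨e.right, h.2.conv (e.ssubst (.refl (.top _)))⟩
  | .bang _, _, _, _, _, h, e => ⟨e.right, fun w' hw a ha => (h.2 w' hw a ha).conv
      ((e.mono (cbvCtx_prefix hw)).ssubst (.refl (.bang _ _ _ ha.typed.some)))⟩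
  | .copow _ _, _, _, _, _, h, e => ⟨e.right, fun w' hw a ha => SPred.conv (h.2 w' hw a ha)
      ((e.mono (cbvCtx_prefix hw)).ssubst (.refl (.copow _ _ _ _ _ _ ha.typed.some (.svar _ _))))⟩
  | .czero, _, _, _, _, _, e => e.right
  | .csum _ _, _, _, _, _, h, e => ⟨e.right,
      SPred.conv h.2.1 (e.ssubst (.refl (.cinl _ _ _ _ _ (.svar _ _)))),
      SPred.conv h.2.2 (e.ssubst (.refl (.cinr _ _ _ _ _ (.svar _ _))))⟩

theorem SPole.conv {Δ : Option CType} {w : List STy} {τ : STy} {t u : Tm} (h : SPole Δ w τ t)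
    (e : EEq (cbvCtx w) Δ t u (.comp (.bang (cbvT τ)))) : SPole Δ w τ u :=
  match Δ, h, e with
  | none, h, e => Pole.conv h e
  | some _, h, e => SPred.conv h e

theorem Pred.conv : ∀ {A : VType} {w : List STy} {t u : Tm}, Pred A none Pole w t →
    EEq (cbvCtx w) none t u A → Pred A none Pole w u
  | .base _, _, _, _, h, e => by
    obtain ⟨_, M, d, e'⟩ := h
    exact ⟨e.right, M, d, e'.trans (.bang_cong e)⟩
  | .unit, _, _, _, _, e => e.right
  | .prod _ _, _, _, _, h, e => ⟨e.right, Pred.conv h.2.1 (.vfst_cong e),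
      Pred.conv h.2.2 (.vsnd_cong e)⟩
  | .arr _ _, _, _, _, h, e => ⟨e.right, fun w' hw a ha => Pred.conv (h.2 w' hw a ha)
      (.vapp_cong (e.mono (cbvCtx_prefix hw)) (.refl ha.typed.some))⟩
  | .comp _, _, _, _, h, e => ⟨e.right, fun w' hw τ s hs => Pole.conv (h.2 w' hw τ s hs)
      (EEq.ssubst (.refl hs.typed.some) (e.mono (cbvCtx_prefix hw)))⟩
  | .lin _ _, _, _, _, h, e => ⟨e.right, fun w' hw τ s hs => SPred.conv (h.2 w' hw τ s hs)
      (EEq.ssubst (.refl hs.typed.some)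
        (.lapp_cong (e.mono (cbvCtx_prefix hw)) (.refl (.svar _ _))))⟩

/-! ### The fundamental lemma of the predicate -/

/-- The logical predicate on substitutions. -/
def PredSubst (Γ : List VType) (w : List STy) (σ : ℕ → Tm) : Prop :=
  ∀ n A, Γ[n]? = some A → Pred A none Pole w (σ n)

theorem PredSubst.mono {Γ : List VType} {w w' : List STy} {σ : ℕ → Tm} (h : PredSubst Γ w σ)
    (hw : w <+: w') : PredSubst Γ w' σ :=
  fun n A hn => (h n A hn).mono hw

theorem PredSubst.scons {Γ : List VType} {w : List STy} {σ : ℕ → Tm} (h : PredSubst Γ w σ)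
    {a : Tm} {A : VType} (ha : Pred A none Pole w a) : PredSubst (A :: Γ) w (Tm.scons a σ)
  | 0, _, hn => by cases hn; exact ha
  | n + 1, B, hn => h n B hn

/-- Application of a substitution satisfying the predicate. -/
noncomputable def Deriv.close {Γ : List VType} {Δ : Option CType} {t : Tm} {A : VType}
    (d : Deriv Γ Δ t A) {w : List STy} {σ : ℕ → Tm} (h : PredSubst Γ w σ) :
    Deriv (cbvCtx w) Δ (t.psubst σ) A :=
  d.psubst σ fun n A hn => (h n A hn).typed.some

/-- Application of a lifted substitution. -/
noncomputable def Deriv.closeBody {Γ : List VType} {Δ : Option CType} {t : Tm} {A B : VType}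
    (d : Deriv (B :: Γ) Δ t A) {w : List STy} {σ : ℕ → Tm} (h : PredSubst Γ w σ) :
    Deriv (B :: cbvCtx w) Δ (t.psubst (Tm.liftS σ)) A :=
  d.psubst _ (Deriv.liftS B fun n A hn => (h n A hn).typed.some)

theorem Pred.vlam {w : List STy} {t : Tm} {A B : VType} {σ : ℕ → Tm}
    (d : Deriv (A :: cbvCtx w) none (t.psubst (Tm.liftS σ)) B)
    (h : ∀ w', w <+: w' → ∀ a, Pred A none Pole w' a →
      Pred B none Pole w' (t.psubst (Tm.scons a σ))) :
    Pred (.arr A B) none Pole w (.vlam A (t.psubst (Tm.liftS σ))) := by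
  refine ⟨⟨.vlam _ _ _ _ d⟩, fun w' hw a ha => (h w' hw a ha).conv ?_⟩
  rw [← Tm.subst0_psubst_liftS]
  exact (EEq.vlam_beta (d.mono (cons_prefix (cbvCtx_prefix hw) A)) ha.typed.some).symm

theorem Pred.clam {w : List STy} {Δ : Option CType} {t : Tm} {A : VType} {B : CType}
    {σ : ℕ → Tm} (d : Deriv (A :: cbvCtx w) Δ (t.psubst (Tm.liftS σ)) (.comp B))
    (h : ∀ w', w <+: w' → ∀ a, Pred A none Pole w' a →
      Pred (.comp B) Δ (SPole Δ) w' (t.psubst (Tm.scons a σ))) :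
    Pred (.comp (.carr A B)) Δ (SPole Δ) w (.clam A (t.psubst (Tm.liftS σ))) := by
  refine ⟨⟨.clam _ _ _ _ _ d⟩, fun w' hw τ s hs => ?_⟩
  obtain ⟨a, s', ha, hs', e⟩ := hs
  obtain ⟨da⟩ := ha.typed
  have d' := d.mono (cons_prefix (cbvCtx_prefix hw) A)
  have e' := (EEq.refl hs'.typed.some).ssubst (EEq.clam_beta d' da).symm
  refine ((h w' hw a ha).2 w' (List.prefix_refl _) τ s' hs').conv ?_
  rw [← Tm.subst0_psubst_liftS]
  refine e'.trans ?_
  have := e.ssubst (.refl (.clam _ _ _ _ _ d'))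
  rw [Tm.ssubst_ssubst, Tm.ssubst, (da.sfree rfl).ssubst, Tm.ssubst] at this
  exact this

theorem Pred.cpair {w : List STy} {Δ : Option CType} {t u : Tm} {A B : CType}
    (h : Pred (.comp A) Δ (SPole Δ) w t) (h' : Pred (.comp B) Δ (SPole Δ) w u) :
    Pred (.comp (.cand A B)) Δ (SPole Δ) w (.cpair t u) := by
  obtain ⟨d⟩ := h.typed
  obtain ⟨d'⟩ := h'.typed
  refine ⟨⟨.cpair _ _ _ _ _ _ d d'⟩, fun w' hw τ s hs => ?_⟩
  have dw := d.mono (cbvCtx_prefix hw)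
  have dw' := d'.mono (cbvCtx_prefix hw)
  rcases hs with ⟨s', hs', e⟩ | ⟨s', hs', e⟩
  · refine (h.2 w' hw τ s' hs').conv
      (((EEq.refl hs'.typed.some).ssubst (EEq.cfst_beta dw dw').symm).trans ?_)
    have := e.ssubst (.refl (.cpair _ _ _ _ _ _ dw dw'))
    rw [Tm.ssubst_ssubst] at this
    exact this
  · refine (h'.2 w' hw τ s' hs').conv
      (((EEq.refl hs'.typed.some).ssubst (EEq.csnd_beta dw dw').symm).trans ?_)
    have := e.ssubst (.refl (.cpair _ _ _ _ _ _ dw dw'))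
    rw [Tm.ssubst_ssubst] at this
    exact this

/-- Computations satisfying the predicate are closed under evaluation contexts `E` which send
stacks to stacks. -/
theorem Pred.frame {w : List STy} {Δ : Option CType} {t E E' : Tm} {A B : CType}
    (h : Pred (.comp A) Δ (SPole Δ) w t) (d : Deriv (cbvCtx w) Δ E' (.comp B))
    (hE : Tm.ssubst t E = E')
    (hs : ∀ w', w <+: w' → ∀ τ s, SPred B w' τ s → SPred A w' τ (Tm.ssubst E s)) :
    Pred (.comp B) Δ (SPole Δ) w E' := by
  refine ⟨⟨d⟩, fun w' hw τ s h' => ?_⟩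
  have := h.2 w' hw τ _ (hs w' hw τ s h')
  rwa [Tm.ssubst_ssubst, hE] at this

/-- The fundamental lemma. -/
theorem Deriv.pred {Γ : List VType} {Δ : Option CType} {t : Tm} {A : VType}
    (d : Deriv Γ Δ t A) : ∀ (w : List STy) (σ : ℕ → Tm) (_ : PredSubst Γ w σ),
    Pred A Δ (SPole Δ) w (t.psubst σ) := by
  induction d with
  | var _ n A h => exact fun w σ hσ => hσ n A h
  | svar =>
    refine fun w σ hσ => ⟨⟨.svar _ _⟩, fun w' hw τ s hs => ?_⟩
    rw [Tm.psubst, Tm.ssubst_svar]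
    exact hs
  | unit => exact fun w σ hσ => ⟨.unit _⟩
  | vpair _ t u A B d e ih ih' =>
    intro w σ hσ
    have d' := d.close hσ
    have e' := e.close hσ
    exact ⟨⟨.vpair _ _ _ _ _ d' e'⟩, (ih w σ hσ).conv (EEq.vfst_beta d' e').symm,
      (ih' w σ hσ).conv (EEq.vsnd_beta d' e').symm⟩
  | vfst _ t A B d ih => exact fun w σ hσ => (ih w σ hσ).2.1
  | vsnd _ t A B d ih => exact fun w σ hσ => (ih w σ hσ).2.2
  | vlam _ t A B d ih =>
    exact fun w σ hσ => .vlam (d.closeBody hσ) fun w' hw a ha => ih w' _ ((hσ.mono hw).scons ha)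
  | vapp _ s t A B d e ih ih' =>
    exact fun w σ hσ => (ih w σ hσ).2 w (List.prefix_refl _) _ (ih' w σ hσ)
  | cunit => exact fun w σ hσ => ⟨⟨.cunit _ _⟩, fun _ _ _ _ hs => hs.elim⟩
  | cpair _ _ t u A B d e ih ih' => exact fun w σ hσ => .cpair (ih w σ hσ) (ih' w σ hσ)
  | cfst _ _ t A B d ih =>
    intro w σ hσ
    exact (ih w σ hσ).frame (E := .cfst .svar) (.cfst _ _ _ _ _ (d.close hσ)) rfl
      fun w' hw τ s hs => .inl ⟨s, hs, .refl (hs.typed.some.ssubst (.cfst _ _ _ _ _ (.svar _ _)))⟩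
  | csnd _ _ t A B d ih =>
    intro w σ hσ
    exact (ih w σ hσ).frame (E := .csnd .svar) (.csnd _ _ _ _ _ (d.close hσ)) rfl
      fun w' hw τ s hs => .inr ⟨s, hs, .refl (hs.typed.some.ssubst (.csnd _ _ _ _ _ (.svar _ _)))⟩
  | clam _ _ t A B d ih =>
    exact fun w σ hσ => .clam (d.closeBody hσ) fun w' hw a ha => ih w' _ ((hσ.mono hw).scons ha)
  | capp _ _ s t A B d e ih ih' =>
    intro w σ hσ
    have e' := e.close hσ
    refine (ih w σ hσ).frame (E := .capp .svar (t.psubst σ)) (.capp _ _ _ _ _ _ (d.close hσ) e')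
      ?_ fun w' hw τ s hs => ?_
    · rw [Tm.ssubst, (e'.sfree rfl).ssubst]; rfl
    · exact ⟨_, s, (ih' w σ hσ).mono hw, hs, .refl (hs.typed.some.ssubst
        (.capp _ _ _ _ _ _ (.svar _ _) (e'.mono (cbvCtx_prefix hw))))⟩
  | top => exact fun w σ hσ => ⟨⟨.top _⟩, fun _ _ _ _ hs => hs.2⟩
  | ilet _ _ t u A d e ih ih' =>
    intro w σ hσ
    have e' := e.close hσ
    refine (ih w σ hσ).frame (E := .ilet .svar (u.psubst σ)) (.ilet _ _ _ _ _ (d.close hσ) e')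
      ?_ fun w' hw τ s hs => ?_
    · rw [Tm.ssubst, (e'.sfree rfl).ssubst]; rfl
    · have e'' := e'.mono (cbvCtx_prefix hw)
      refine ⟨⟨hs.typed.some.ssubst (.ilet _ _ _ _ _ (.svar _ _) e'')⟩, ?_⟩
      rw [Tm.ssubst_ssubst, Tm.ssubst, (e'.sfree rfl).ssubst]
      exact ((ih' w σ hσ).2 w' hw τ s hs).conv
        ((EEq.refl hs.typed.some).ssubst (EEq.ilet_beta e'').symm)
  | bang _ t A d ih =>
    exact fun w σ hσ => ⟨⟨.bang _ _ _ (d.close hσ)⟩, fun w' hw τ s hs =>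
      hs.2 w' (List.prefix_refl _) _ ((ih w σ hσ).mono hw)⟩
  | banglet _ _ t u A B d e ih ih' =>
    intro w σ hσ
    have e' := e.closeBody hσ
    refine (ih w σ hσ).frame (E := .banglet .svar (u.psubst (Tm.liftS σ)))
      (.banglet _ _ _ _ _ _ (d.close hσ) e') ?_ fun w' hw τ s hs => ?_
    · rw [Tm.ssubst, (e'.sfree rfl).ssubst]; rfl
    · refine ⟨⟨hs.typed.some.ssubst (.banglet _ _ _ _ _ _ (.svar _ _)
        (e'.mono (cons_prefix (cbvCtx_prefix hw) A)))⟩, fun w'' hw' a ha => ?_⟩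
      rw [Tm.ssubst_ssubst, Tm.ssubst, (e'.sfree rfl).ssubst]
      have := (ih' w'' _ ((hσ.mono (hw.trans hw')).scons ha)).2 w'' (List.prefix_refl _) τ s
        (hs.mono hw')
      rw [← Tm.subst0_psubst_liftS] at this
      exact this.conv ((EEq.refl (hs.mono hw').typed.some).ssubst (EEq.bang_beta ha.typed.some
        (e'.mono (cons_prefix (cbvCtx_prefix (hw.trans hw')) A))).symm)
  | copow _ _ t u A B d e ih ih' =>
    intro w σ hσ
    have d' := d.close hσ
    refine (ih' w σ hσ).frame (E := .copow (t.psubst σ) .svar)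
      (.copow _ _ _ _ _ _ d' (e.close hσ)) ?_ fun w' hw τ s hs => ?_
    · rw [Tm.ssubst, (d'.sfree rfl).ssubst]; rfl
    · exact hs.2 w' (List.prefix_refl _) _ ((ih w σ hσ).mono hw)
  | copowlet _ _ s₀ t A B C d e ih ih' =>
    intro w σ hσ
    have e' := e.closeBody hσ
    refine (ih w σ hσ).frame (E := .copowlet .svar (t.psubst (Tm.liftS σ)))
      (.copowlet _ _ _ _ _ _ _ (d.close hσ) e') rfl fun w' hw τ s hs => ?_
    refine ⟨⟨hs.typed.some.ssubst (.copowlet _ _ _ _ _ _ _ (.svar _ _)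
      (e'.mono (cons_prefix (cbvCtx_prefix hw) A)))⟩, fun w'' hw' a ha => ?_⟩
    have hs' := hs.mono hw'
    have b := EEq.copow_beta ha.typed.some (.svar _ _)
      (e'.mono (cons_prefix (cbvCtx_prefix (hw.trans hw')) A))
    have := (ih' w'' _ ((hσ.mono (hw.trans hw')).scons ha)).2 w'' (List.prefix_refl _) τ s hs'
    rw [Tm.ssubst_svar, Tm.subst0_psubst_liftS] at b
    rw [Tm.ssubst_ssubst]
    exact SPred.conv this ((EEq.refl hs'.typed.some).ssubst b.symm)
  | cimage _ _ t A d ih =>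
    intro w σ hσ
    exact (ih w σ hσ).frame (E := .cimage A .svar) (.cimage _ _ _ _ (d.close hσ)) rfl
      fun w' hw τ s hs => ⟨hs.typed.some.ssubst (.cimage _ _ _ _ (.svar _ _))⟩
  | cinl _ _ t A B d ih =>
    intro w σ hσ
    exact (ih w σ hσ).frame (E := .cinl .svar) (.cinl _ _ _ _ _ (d.close hσ)) rfl
      fun w' hw τ s hs => hs.2.1
  | cinr _ _ t A B d ih =>
    intro w σ hσ
    exact (ih w σ hσ).frame (E := .cinr .svar) (.cinr _ _ _ _ _ (d.close hσ)) rfl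
      fun w' hw τ s hs => hs.2.2
  | ccase _ _ s₀ t u A B C d e f ih ih' ih'' =>
    intro w σ hσ
    have e' := e.close hσ
    have f' := f.close hσ
    refine (ih w σ hσ).frame (E := .ccase .svar (t.psubst σ) (u.psubst σ))
      (.ccase _ _ _ _ _ _ _ _ (d.close hσ) e' f') rfl fun w' hw τ s hs => ?_
    have ew := e'.mono (cbvCtx_prefix hw)
    have fw := f'.mono (cbvCtx_prefix hw)
    have ds := hs.typed.some
    refine ⟨⟨ds.ssubst (.ccase _ _ _ _ _ _ _ _ (.svar _ _) ew fw)⟩, ?_, ?_⟩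
    · have b := EEq.csum_beta_inl ew fw (.svar _ _)
      rw [Tm.ssubst_svar] at b
      rw [Tm.ssubst_ssubst]
      exact SPred.conv ((ih' w σ hσ).2 w' hw τ s hs) ((EEq.refl ds).ssubst b.symm)
    · have b := EEq.csum_beta_inr ew fw (.svar _ _)
      rw [Tm.ssubst_svar] at b
      rw [Tm.ssubst_ssubst]
      exact SPred.conv ((ih'' w σ hσ).2 w' hw τ s hs) ((EEq.refl ds).ssubst b.symm)
  | llam _ t A B d ih =>
    intro w σ hσ
    have d' := d.close hσ
    refine ⟨⟨.llam _ _ _ _ d'⟩, fun w' hw τ s hs => ?_⟩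
    have b := EEq.llam_beta (d'.mono (cbvCtx_prefix hw)) (.svar _ _)
    rw [Tm.ssubst_svar] at b
    exact SPred.conv ((ih w σ hσ).2 w' hw τ s hs) ((EEq.refl hs.typed.some).ssubst b.symm)
  | lapp _ _ s₀ t A B d e ih ih' =>
    intro w σ hσ
    have d' := d.close hσ
    refine (ih' w σ hσ).frame (E := .lapp (s₀.psubst σ) .svar)
      (.lapp _ _ _ _ _ _ d' (e.close hσ)) ?_ fun w' hw τ s hs => (ih w σ hσ).2 w' hw τ s hs
    rw [Tm.ssubst, (d'.sfree rfl).ssubst]; rfl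

/-! ### Reification -/

/-- Turning the outermost variable of the world into the innermost one. -/
theorem Pole.cycle {w : List STy} {σ τ : STy} {t : Tm} (h : Pole (w ++ [σ]) τ t) :
    Pole (σ :: w) τ (t.rename (cycle w.length)) := by
  obtain ⟨M, ⟨d⟩, e⟩ := h
  refine ⟨M.rename (EEC.cycle w.length), ⟨d.rename _ (cycle_typed w σ)⟩, ?_⟩
  rw [cbvTm_rename]
  refine e.rename _ ?_
  have := cycle_typed (cbvCtx w) (cbvT σ)
  simpa [cbvCtx] using this

theorem Deriv.rename_cycle {w : List STy} {Δ : Option CType} {t : Tm} {A : VType}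
    (d : Deriv (cbvCtx w) Δ t A) : t.rename (cycle w.length) = t.shift := by
  refine d.rename_congr _ _ fun n A h => ?_
  have := cycle_of_lookup h
  simpa [cbvCtx] using this

/-- Sequencing of computations. -/
theorem Pole.bind {w : List STy} {τ ρ : STy} {u s : Tm} (h : Pole w τ u)
    (d : Deriv (cbvCtx w) (some (.bang (cbvT τ))) s (.comp (.bang (cbvT ρ))))
    (h' : Pole (w ++ [τ]) ρ (Tm.ssubst (.bang (.var w.length)) s)) :
    Pole w ρ (Tm.ssubst u s) := by
  obtain ⟨M, ⟨dM⟩, e⟩ := h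
  obtain ⟨K, ⟨dK⟩, e'⟩ := h'.cycle
  rw [Tm.rename_ssubst, d.rename_cycle] at e'
  simp only [Tm.rename, EEC.cycle, if_true] at e'
  exact ⟨.app (.lam τ K) M, ⟨.app _ _ _ _ _ (.lam _ _ _ _ dK) dM⟩,
    (cbv_let dK dM).trans ((EEq.banglet_cong e e').trans (.bang_eta e.right.some d))⟩

/-- At the translation of a type, the predicate says that a term is definable as a value. -/
theorem pred_iff : ∀ (σ : STy) (w : List STy) (t : Tm), Pred (cbvT σ) none Pole w t ↔
    HT w none t (cbvT σ) ∧ Pole w σ (.bang t)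
  | .base a, w, t => Iff.rfl
  | .unit, w, t => by
    refine ⟨fun h => ⟨h, .unit, ⟨.unit _⟩, ?_⟩, fun h => h.1⟩
    exact .bang_cong (EEq.unit_eta h.some).symm
  | .prod σ τ, w, t => by
    refine ⟨fun h => ?_, fun h => ?_⟩
    · obtain ⟨d, h, h'⟩ := h
      obtain ⟨dt, M, ⟨dM⟩, e⟩ := (pred_iff σ w _).1 h
      obtain ⟨dt', M', ⟨dM'⟩, e'⟩ := (pred_iff τ w _).1 h'
      exact ⟨d, .pair M M', ⟨.pair _ _ _ _ _ dM dM'⟩,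
        (cbv_pair e e' dt.some dt'.some).trans (.bang_cong (.vpair_eta d.some))⟩
    · obtain ⟨⟨d⟩, M, ⟨dM⟩, e⟩ := h
      exact ⟨⟨d⟩,
        (pred_iff σ w _).2 ⟨⟨.vfst _ _ _ _ d⟩, _, ⟨.fst _ _ _ _ dM⟩, cbv_fst e d⟩,
        (pred_iff τ w _).2 ⟨⟨.vsnd _ _ _ _ d⟩, _, ⟨.snd _ _ _ _ dM⟩, cbv_snd e d⟩⟩
  | .arr σ τ, w, t => by
    have fresh : ∀ (ρ : STy) (w : List STy), (∀ t, HT (w ++ [ρ]) none t (cbvT ρ) ∧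
        Pole (w ++ [ρ]) ρ (.bang t) → Pred (cbvT ρ) none Pole (w ++ [ρ]) t) →
        Pred (cbvT ρ) none Pole (w ++ [ρ]) (.var w.length) := by
      intro ρ w h
      have d : LDeriv (w ++ [ρ]) (.var w.length) ρ := .var _ _ _ (lookup_last w ρ)
      exact h _ ⟨⟨.var _ _ _ (cbvCtx_lookup (lookup_last w ρ))⟩, _, ⟨d⟩, .refl d.cbv⟩
    refine ⟨fun h => ?_, fun h => ?_⟩
    · obtain ⟨⟨d⟩, h⟩ := h
      have hs : SPred (.bang (cbvT τ)) (w ++ [σ]) τ .svar :=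
        ⟨⟨.svar _ _⟩, fun w' _ a ha => ((pred_iff τ w' a).1 ha).2⟩
      have hp := (h (w ++ [σ]) (List.prefix_append _ _) (.var w.length)
        (fresh σ w fun t => (pred_iff σ _ t).2)).2 _ (List.prefix_refl _) τ .svar hs
      obtain ⟨M, ⟨dM⟩, e⟩ := Pole.cycle hp
      simp only [Tm.ssubst, Tm.rename, d.rename_cycle, cycle, if_true] at e
      exact ⟨⟨d⟩, .lam σ M, ⟨.lam _ _ _ _ dM⟩,
        .bang_cong ((EEq.vlam_cong e).trans (.vlam_eta d))⟩
    · obtain ⟨⟨d⟩, h⟩ := h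
      refine ⟨⟨d⟩, fun w' hw a ha => ⟨⟨.vapp _ _ _ _ _ (d.mono (cbvCtx_prefix hw))
        ha.typed.some⟩, fun w'' hw' ρ s hs => ?_⟩⟩
      obtain ⟨⟨da⟩, N, ⟨dN⟩, e⟩ := (pred_iff σ w'' a).1 (ha.mono hw')
      obtain ⟨M, ⟨dM⟩, e'⟩ := h.mono (hw.trans hw')
      refine Pole.bind ⟨_, ⟨.app _ _ _ _ _ dM dN⟩,
        cbv_app e' e (d.mono (cbvCtx_prefix (hw.trans hw'))) da dN⟩ hs.typed.some ?_
      exact hs.2 _ (List.prefix_append _ _) _ (fresh τ w'' fun t => (pred_iff τ _ t).2)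

/-- Fullness of the call-by-value translation. -/
theorem Deriv.pole {Θ : List STy} {τ : STy} {t : Tm}
    (d : Deriv (cbvCtx Θ) none t (.comp (.bang (cbvT τ)))) : Pole Θ τ t := by
  have hσ : PredSubst (cbvCtx Θ) Θ .var := by
    intro n A h
    obtain ⟨σ, hn, rfl⟩ : ∃ σ, Θ[n]? = some σ ∧ cbvT σ = A := by simpa [cbvCtx] using h
    have d : LDeriv Θ (.var n) σ := .var _ _ _ hn
    exact (pred_iff σ Θ _).2 ⟨⟨.var _ _ _ h⟩, _, ⟨d⟩, .refl d.cbv⟩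
  have := d.pred Θ .var hσ
  rw [Tm.psubst_var] at this
  exact this.2 Θ (List.prefix_refl _) τ .svar
    ⟨⟨.svar _ _⟩, fun w' _ a ha => ((pred_iff τ w' a).1 ha).2⟩

end EEC

namespace EEC

/-- **Soundness and full completeness of the call-by-value translation into
EEC** (Proposition 3.2): (1) if `Θ ⊢ M =_{λc} N : τ` then
`Θᵛ ⊢ Mᵛ = Nᵛ : !(τᵛ)` in the equational theory of EEC; (2) conversely for
well-typed `M`, `N`; (3) every EEC term `Θᵛ ⊢ t : !(τᵛ)` is equal to the
translation `Mᵛ` of some simply-typed term `Θ ⊢ M : τ`. -/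
theorem cbv_sound_fully_complete :
    (∀ (Θ : List STy) (M N : LTm) (τ : STy),
      LamC Θ M N τ →
      EEq (cbvCtx Θ) none (cbvTm M) (cbvTm N) (.comp (.bang (cbvT τ)))) ∧
    (∀ (Θ : List STy) (M N : LTm) (τ : STy),
      Nonempty (LDeriv Θ M τ) → Nonempty (LDeriv Θ N τ) →
      EEq (cbvCtx Θ) none (cbvTm M) (cbvTm N) (.comp (.bang (cbvT τ))) →
      LamC Θ M N τ) ∧
    (∀ (Θ : List STy) (τ : STy) (t : Tm),
      Nonempty (Deriv (cbvCtx Θ) none t (.comp (.bang (cbvT τ)))) →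
      ∃ M : LTm, Nonempty (LDeriv Θ M τ) ∧
        EEq (cbvCtx Θ) none (cbvTm M) t (.comp (.bang (cbvT τ)))) := by
  exact ⟨fun _ _ _ _ h => h.cbv, fun _ _ _ _ ⟨d⟩ ⟨e⟩ h => .of_cbv d e h, fun _ _ _ ⟨d⟩ => d.pole⟩

end EEC
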